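/- arXiv:0712.1393 — 3 statements merged into one kernel-verified Lean document; each statement's English description precedes it below -/
import Mathlib

section
/- Let 0 < α < 1. There is a constant C such that for all Schwartz functions g, h on ℝ², ‖(D^α g)·h‖_{L²(ℝ²)} ≤ C·‖∇g‖_{L²(ℝ²)}·‖D^α h‖_{L²(ℝ²)}, where D^α denotes the Fourier multiplier on ℝ² with symbol |ξ|^α, and ‖D^α h‖_{L²} = ‖|ξ|^α ĥ(ξ)‖_{L²_ξ}. -/
noncomputable section

open MeasureTheory Real
open scoped ENNReal RealInnerProductSpace

/-- The spatial domain `ℝ²`. -/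
abbrev V2 : Type := EuclideanSpace ℝ (Fin 2)

/-- Fourier transform on `ℝ²`, convention `e^{-i x·ξ}`. -/
def ft2 (g : V2 → ℂ) (ξ : V2) : ℂ :=
  ∫ x : V2, Complex.exp (-Complex.I * ((⟪x, ξ⟫ : ℝ) : ℂ)) * g x

/-- Inverse Fourier transform on `ℝ²`. -/
def ift2 (G : V2 → ℂ) (x : V2) : ℂ :=
  ((((2 * π) ^ 2)⁻¹ : ℝ) : ℂ) *
    ∫ ξ : V2, Complex.exp (Complex.I * ((⟪x, ξ⟫ : ℝ) : ℂ)) * G ξ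

/-- The Fourier multiplier `D^α` on `ℝ²` with symbol `|ξ|^α`. -/
def Dal (α : ℝ) (g : V2 → ℂ) : V2 → ℂ :=
  fun x => ift2 (fun ξ => ((‖ξ‖ ^ α : ℝ) : ℂ) * ft2 g ξ) x

/-- Spatial partial derivative `∂ⱼ g`, `j = 0, 1`. -/
def pd2 (j : Fin 2) (g : V2 → ℂ) : V2 → ℂ :=
  fun x => fderiv ℝ g x (EuclideanSpace.single j 1)

open FourierTransform SchwartzMap in
lemma planch (F : V2 → ℂ) (h1 : Integrable F) (h2 : MemLp F 2) :
    ∫⁻ x, ‖𝓕⁻ F x‖ₑ ^ 2 = ∫⁻ x, ‖F x‖ₑ ^ 2 := by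
  have hcont : Continuous (𝓕⁻ F) := by
    refine VectorFourier.fourierIntegral_continuous Real.continuous_fourierChar ?_ h1
    simp only [LinearMap.neg_apply, innerₗ_apply_apply]
    fun_prop
  have hae : ∀ᵐ x, 𝓕⁻ F x = (𝓕⁻ (h2.toLp F) : Lp ℂ 2 (volume : Measure V2)) x := by
    apply ae_eq_of_integral_contDiff_smul_eq
    · exact hcont.locallyIntegrable
    · exact (Lp.memLp _).locallyIntegrable (by norm_num)
    intro g g_smooth g_cpt
    have hg₁ : HasCompactSupport (Complex.ofRealCLM ∘ g) := g_cpt.comp_left rfl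
    have hg₂ : ContDiff ℝ (↑(⊤ : ℕ∞)) (Complex.ofRealCLM ∘ g) := by fun_prop
    set G : SchwartzMap V2 ℂ := hg₁.toSchwartzMap hg₂ with hG
    have e1 := congrArg (fun T => T G) (Lp.fourierInv_toTemperedDistribution_eq (h2.toLp F))
    simp only [TemperedDistribution.fourierInv_apply, Lp.toTemperedDistribution_apply] at e1
    have e2 : ∫ x, g x • 𝓕⁻ F x = ∫ x, (𝓕⁻ F x) • G x := by
      simp [hG, mul_comm]
    have e3 : ∫ x, g x • (𝓕⁻ (h2.toLp F) : Lp ℂ 2 (volume : Measure V2)) x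
       = ∫ x, G x • (𝓕⁻ (h2.toLp F) : Lp ℂ 2 (volume : Measure V2)) x := by
      simp [hG]
    rw [e2, e3, ← e1]
    have e4 := VectorFourier.integral_fourierIntegral_smul_eq_flip (μ := volume) (ν := volume) (L := -innerₗ V2)
      Real.continuous_fourierChar (by simp only [LinearMap.neg_apply, innerₗ_apply_apply]; fun_prop) h1 G.integrable
    refine e4.trans ?_
    apply integral_congr_ae
    filter_upwards [h2.coeFn_toLp] with x hx
    rw [hx, fourierInv_coe, smul_eq_mul, smul_eq_mul, mul_comm]
    congr 1
    simp [FourierTransformInv.fourierInv, VectorFourier.fourierIntegral, real_inner_comm]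
  have n1 : ‖(𝓕⁻ (h2.toLp F) : Lp ℂ 2 (volume : Measure V2))‖ = ‖h2.toLp F‖ :=
    (Lp.fourierTransformₗᵢ V2 ℂ).symm.norm_map _
  have n2 : eLpNorm (𝓕⁻ F) 2 volume = eLpNorm F 2 volume := by
    rw [eLpNorm_congr_ae hae, ← Lp.enorm_def, ← eLpNorm_congr_ae h2.coeFn_toLp, ← Lp.enorm_def]
    simp only [← ofReal_norm, n1]
  rw [eLpNorm_eq_lintegral_rpow_enorm_toReal (by norm_num) (by norm_num),
    eLpNorm_eq_lintegral_rpow_enorm_toReal (by norm_num) (by norm_num)] at n2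
  have := congrArg (fun t => t ^ (2:ℝ)) n2
  simp only [← ENNReal.rpow_mul] at this
  simpa using this

lemma lint_smul (f : V2 → ℝ≥0∞) {r : ℝ} (hr : 0 < r) :
    ∫⁻ x, f (r • x) = ENNReal.ofReal ((r ^ 2)⁻¹) * ∫⁻ x, f x := by
  have h := Measure.map_addHaar_smul (volume : Measure V2) hr.ne'
  have h2 : ∫⁻ x, f x ∂(Measure.map (r • ·) (volume : Measure V2)) = ∫⁻ x, f (r • x) :=
    (Homeomorph.smul (isUnit_iff_ne_zero.2 hr.ne').unit).toMeasurableEquiv.measurableEmbedding.lintegral_map f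
  rw [← h2, h, lintegral_smul_measure]
  simp [abs_of_pos hr]

lemma ball_int (s : ℝ) (hs : s < 1) :
    ∃ K : ℝ, 0 < K ∧ ∀ A : ℝ, 0 < A →
      ∫⁻ ξ : V2 in Metric.ball 0 A, ENNReal.ofReal (‖ξ‖ ^ (-(2*s))) ≤
        ENNReal.ofReal (K * A ^ (2 - 2*s)) := by
  have hint : IntegrableOn (fun ξ : V2 => ‖ξ‖ ^ (-(2*s))) (Metric.ball 0 1) := by
    rw [integrableOn_fun_norm_addHaar volume (f := fun y => y ^ (-(2*s)))]
    have h : IntegrableOn (fun y : ℝ => y ^ (1 - 2*s)) (Set.Ioo 0 1) := by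
      have := (intervalIntegral.intervalIntegrable_rpow' (a := 0) (b := 1) (r := 1 - 2*s) (by linarith))
      rw [intervalIntegrable_iff_integrableOn_Ioo_of_le zero_le_one] at this
      exact this
    refine h.congr_fun ?_ measurableSet_Ioo
    intro y hy
    simp only [finrank_euclideanSpace, Fintype.card_fin, smul_eq_mul]
    rw [sub_eq_add_neg, Real.rpow_add hy.1]
    simp
  have hfin : ∫⁻ ξ : V2 in Metric.ball 0 1, ENNReal.ofReal (‖ξ‖ ^ (-(2*s))) < ∞ :=
    hint.lintegral_lt_top
  set K0 := ∫⁻ ξ : V2 in Metric.ball 0 1, ENNReal.ofReal (‖ξ‖ ^ (-(2*s))) with hK0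
  refine ⟨K0.toReal + 1, by positivity, fun A hA => ?_⟩
  have hsc := lint_smul (fun ξ => (Metric.ball 0 A).indicator (fun ξ : V2 => ENNReal.ofReal (‖ξ‖ ^ (-(2*s)))) ξ) hA
  have e : ∀ x : V2, (Metric.ball 0 A).indicator (fun ξ : V2 => ENNReal.ofReal (‖ξ‖ ^ (-(2*s)))) (A • x)
     = ENNReal.ofReal (A ^ (-(2*s))) * (Metric.ball 0 1).indicator (fun ξ : V2 => ENNReal.ofReal (‖ξ‖ ^ (-(2*s)))) x := by
    intro x
    by_cases hx : ‖x‖ < 1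
    · have hx' : ‖A • x‖ < A := by
        rw [norm_smul, Real.norm_of_nonneg hA.le]; nlinarith
      rw [Set.indicator_of_mem (by simpa using hx'), Set.indicator_of_mem (by simpa using hx),
        ← ENNReal.ofReal_mul (by positivity), norm_smul, Real.norm_of_nonneg hA.le,
        Real.mul_rpow hA.le (norm_nonneg _)]
    · have hx' : ¬ ‖A • x‖ < A := by
        rw [norm_smul, Real.norm_of_nonneg hA.le]; push Not at hx ⊢; nlinarith
      rw [Set.indicator_of_notMem (by simpa using hx'), Set.indicator_of_notMem (by simpa using hx),
        mul_zero]
  simp only [e] at hsc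
  rw [lintegral_const_mul' _ _ (by simp), lintegral_indicator measurableSet_ball,
    lintegral_indicator measurableSet_ball, ← hK0] at hsc
  have h2 : ∫⁻ ξ : V2 in Metric.ball 0 A, ENNReal.ofReal (‖ξ‖ ^ (-(2*s))) =
      ENNReal.ofReal (A ^ 2) * (ENNReal.ofReal (A ^ (-(2*s))) * K0) := by
    rw [hsc, ← mul_assoc, ← ENNReal.ofReal_mul (by positivity), mul_inv_cancel₀ (by positivity)]
    simp
  rw [h2]
  nth_rw 1 [← ENNReal.ofReal_toReal hfin.ne]
  rw [← ENNReal.ofReal_mul (by positivity),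
    ← ENNReal.ofReal_mul (by positivity)]
  apply ENNReal.ofReal_le_ofReal
  rw [sub_eq_add_neg, Real.rpow_add hA]
  have : A ^ (2:ℝ) = A ^ 2 := by simp
  rw [this]
  have : 0 < A ^ 2 * A ^ (-(2*s)) := by positivity
  nlinarith

lemma low_bound (s : ℝ) (_hs0 : 0 < s) (F : V2 → ℂ) (hF : Continuous F) (B : Set V2) :
    ∫⁻ ξ in B, ‖F ξ‖ₑ ≤ (∫⁻ ξ in B, ENNReal.ofReal (‖ξ‖ ^ (-(2*s)))) ^ (1/2 : ℝ) *
      (∫⁻ ξ, ENNReal.ofReal (‖ξ‖ ^ (2*s)) * ‖F ξ‖ₑ ^ 2) ^ (1/2 : ℝ) := by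
  have hol := ENNReal.lintegral_mul_le_Lp_mul_Lq (volume.restrict B) (p := 2) (q := 2)
    (by constructor <;> norm_num) (f := fun ξ : V2 => ENNReal.ofReal (‖ξ‖ ^ (-s)))
    (g := fun ξ : V2 => ENNReal.ofReal (‖ξ‖ ^ s) * ‖F ξ‖ₑ) (by fun_prop) (by fun_prop)
  have e0 : ∫⁻ ξ in B, ‖F ξ‖ₑ = ∫⁻ ξ in B, ((fun ξ : V2 => ENNReal.ofReal (‖ξ‖ ^ (-s))) *
     (fun ξ : V2 => ENNReal.ofReal (‖ξ‖ ^ s) * ‖F ξ‖ₑ)) ξ := by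
    apply lintegral_congr_ae
    have : ∀ᵐ ξ : V2 ∂(volume.restrict B), ξ ≠ 0 := by
      apply ae_restrict_of_ae
      simp [ae_iff]
    filter_upwards [this] with ξ hξ
    have hp : 0 < ‖ξ‖ := norm_pos_iff.2 hξ
    simp only [Pi.mul_apply]
    rw [← mul_assoc, ← ENNReal.ofReal_mul (by positivity), ← Real.rpow_add hp]
    simp
  rw [e0]
  refine hol.trans ?_
  have e1 : ∀ ξ : V2, ENNReal.ofReal (‖ξ‖ ^ (-s)) ^ (2:ℝ) = ENNReal.ofReal (‖ξ‖ ^ (-(2*s))) := by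
    intro ξ
    rw [ENNReal.ofReal_rpow_of_nonneg (by positivity) (by norm_num), ← Real.rpow_mul (norm_nonneg _)]
    congr 2; ring
  have e2 : ∀ ξ : V2, (ENNReal.ofReal (‖ξ‖ ^ s) * ‖F ξ‖ₑ) ^ (2:ℝ) = ENNReal.ofReal (‖ξ‖ ^ (2*s)) * ‖F ξ‖ₑ ^ 2 := by
    intro ξ
    rw [ENNReal.mul_rpow_of_nonneg _ _ (by norm_num), ENNReal.ofReal_rpow_of_nonneg (by positivity) (by norm_num), ← Real.rpow_mul (norm_nonneg _)]
    rw [mul_comm s 2, ENNReal.rpow_two]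
  simp only [e1, e2]
  gcongr
  exact Measure.restrict_le_self

lemma lint_rpow (q R : ℝ) (hq : -1 < q) (hR : 0 ≤ R) :
    ∫⁻ t in Set.Ioc 0 R, ENNReal.ofReal (t ^ q) = ENNReal.ofReal (R ^ (q+1) / (q+1)) := by
  have h := intervalIntegral.intervalIntegrable_rpow' (a := 0) (b := R) hq
  rw [intervalIntegrable_iff_integrableOn_Ioc_of_le hR] at h
  rw [← ofReal_integral_eq_lintegral_ofReal h, ← intervalIntegral.integral_of_le hR,
    integral_rpow (Or.inl hq), Real.zero_rpow (by linarith), sub_zero]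
  filter_upwards [ae_restrict_mem measurableSet_Ioc] with t ht
  exact Real.rpow_nonneg ht.1.le _

open FourierTransform in
lemma enorm_fi_le (F : V2 → ℂ) (x : V2) : ‖𝓕⁻ F x‖ₑ ≤ ∫⁻ ξ, ‖F ξ‖ₑ := by
  rw [Real.fourierInv_eq]
  refine (enorm_integral_le_lintegral_enorm _).trans (le_of_eq ?_)
  congr 1; ext ξ
  simp [← ofReal_norm]

open FourierTransform in
lemma cont_fi (F : V2 → ℂ) (h1 : Integrable F) : Continuous (𝓕⁻ F) := by
  refine VectorFourier.fourierIntegral_continuous Real.continuous_fourierChar ?_ h1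
  simp only [LinearMap.neg_apply, innerₗ_apply_apply]
  fun_prop

open FourierTransform in
lemma weak_bound (s K N b t : ℝ) (hs0 : 0 < s) (hs1 : s < 1) (hK : 0 < K) (hN : 0 < N)
    (hb : b = 2 * √K * N) (ht : 0 < t)
    (hKb : ∀ A : ℝ, 0 < A →
      ∫⁻ ξ : V2 in Metric.ball 0 A, ENNReal.ofReal (‖ξ‖ ^ (-(2*s))) ≤
        ENNReal.ofReal (K * A ^ (2 - 2*s)))
    (F : V2 → ℂ) (hF : Continuous F) (hFi : Integrable F)
    (hW : ∫⁻ ξ, ENNReal.ofReal (‖ξ‖ ^ (2*s)) * ‖F ξ‖ₑ ^ 2 = ENNReal.ofReal (N ^ 2)) :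
    volume {x : V2 | t < ‖𝓕⁻ F x‖} ≤
      ENNReal.ofReal (4 * t ^ (-2 : ℝ)) * ∫⁻ ξ in {ξ : V2 | t ≤ b * ‖ξ‖ ^ (1 - s)}, ‖F ξ‖ₑ ^ 2 := by
  have hb0 : 0 < b := by rw [hb]; positivity
  have h1s : 0 < 1 - s := by linarith
  set A := (t / b) ^ (1 - s)⁻¹ with hA
  have hA0 : 0 < A := by positivity
  have hAs : A ^ (1 - s) = t / b := by
    rw [hA, ← Real.rpow_mul (by positivity), inv_mul_cancel₀ h1s.ne', Real.rpow_one]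
  set B : Set V2 := Metric.ball 0 A with hB
  have hBm : MeasurableSet B := measurableSet_ball
  have hBc : {ξ : V2 | t ≤ b * ‖ξ‖ ^ (1 - s)} = Bᶜ := by
    ext ξ
    simp only [Set.mem_ofPred_eq, hB, Set.mem_compl_iff, mem_ball_zero_iff, not_lt]
    rw [← Real.rpow_le_rpow_iff hA0.le (norm_nonneg ξ) h1s, hAs, div_le_iff₀ hb0, mul_comm]
  rw [hBc]
  have hi1 : Integrable (B.indicator F) := hFi.indicator hBm
  have hi2 : Integrable (Bᶜ.indicator F) := hFi.indicator hBm.compl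
  have hsplit : ∀ x, 𝓕⁻ F x = 𝓕⁻ (B.indicator F) x + 𝓕⁻ (Bᶜ.indicator F) x := by
    intro x
    simp only [Real.fourierInv_eq]
    rw [← integral_add]
    · congr 1; ext ξ
      rw [← smul_add, Set.indicator_self_add_compl_apply]
    · have := (Real.fourierIntegral_convergent_iff (-x)).2 hi1
      simpa using this
    · have := (Real.fourierIntegral_convergent_iff (-x)).2 hi2
      simpa using this
  have hlow : ∀ x, ‖𝓕⁻ (B.indicator F) x‖ ≤ t / 2 := by
    intro x
    have h1 := enorm_fi_le (B.indicator F) x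
    have h2 : ∫⁻ ξ, ‖B.indicator F ξ‖ₑ = ∫⁻ ξ in B, ‖F ξ‖ₑ := by
      rw [← lintegral_indicator hBm]
      congr 1; ext ξ
      exact enorm_indicator_eq_indicator_enorm F ξ
    rw [h2] at h1
    have h3 := h1.trans (low_bound s hs0 F hF B)
    rw [hW] at h3
    have h4 : ‖𝓕⁻ (B.indicator F) x‖ₑ ≤ ENNReal.ofReal (t / 2) := by
      refine h3.trans ((mul_le_mul_left (ENNReal.rpow_le_rpow (hKb A hA0) (by norm_num)) _).trans (le_of_eq ?_))
      rw [ENNReal.ofReal_rpow_of_nonneg (by positivity) (by norm_num),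
        ENNReal.ofReal_rpow_of_nonneg (by positivity) (by norm_num), ← ENNReal.ofReal_mul (by positivity)]
      congr 1
      rw [← Real.sqrt_eq_rpow, ← Real.sqrt_eq_rpow, Real.sqrt_sq hN.le, Real.sqrt_mul hK.le]
      have : A ^ (2 - 2*s) = (A ^ (1-s))^2 := by
        rw [← Real.rpow_natCast, ← Real.rpow_mul hA0.le]; congr 1; push_cast; ring
      rw [this, Real.sqrt_sq (by positivity), hAs, hb]
      have : 0 < √K := by positivity
      field_simp
    rw [← ofReal_norm] at h4
    exact (ENNReal.ofReal_le_ofReal_iff (by positivity)).1 h4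
  have hind : ∫⁻ ξ, ‖Bᶜ.indicator F ξ‖ₑ ^ 2 = ∫⁻ ξ in Bᶜ, ‖F ξ‖ₑ ^ 2 := by
    rw [← lintegral_indicator hBm.compl]
    congr 1; ext ξ
    by_cases h : ξ ∈ Bᶜ
    · simp only [Set.indicator_of_mem h]
    · simp only [Set.indicator_of_notMem h]; simp
  have hfin : ∫⁻ ξ in Bᶜ, ‖F ξ‖ₑ ^ 2 < ∞ := by
    calc ∫⁻ ξ in Bᶜ, ‖F ξ‖ₑ ^ 2
      ≤ ∫⁻ ξ in Bᶜ, ENNReal.ofReal (A ^ (-(2*s))) * (ENNReal.ofReal (‖ξ‖ ^ (2*s)) * ‖F ξ‖ₑ ^ 2) := by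
          apply setLIntegral_mono' hBm.compl
          intro ξ hξ
          have hξ' : A ≤ ‖ξ‖ := by simpa [hB] using hξ
          rw [← mul_assoc, ← ENNReal.ofReal_mul (by positivity)]
          have : 1 ≤ A ^ (-(2*s)) * ‖ξ‖ ^ (2*s) := by
            rw [Real.rpow_neg hA0.le, inv_mul_eq_div, one_le_div (by positivity)]
            exact Real.rpow_le_rpow hA0.le hξ' (by linarith)
          calc ‖F ξ‖ₑ ^ 2 = 1 * ‖F ξ‖ₑ ^ 2 := (one_mul _).symm
            _ ≤ _ := by gcongr; exact ENNReal.one_le_ofReal.2 this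
      _ ≤ ∫⁻ ξ, ENNReal.ofReal (A ^ (-(2*s))) * (ENNReal.ofReal (‖ξ‖ ^ (2*s)) * ‖F ξ‖ₑ ^ 2) :=
          setLIntegral_le_lintegral _ _
      _ = ENNReal.ofReal (A ^ (-(2*s))) * ENNReal.ofReal (N ^ 2) := by
          rw [lintegral_const_mul' _ _ (by simp), hW]
      _ < ∞ := ENNReal.mul_lt_top (by simp) (by simp)
  have hL2 : MemLp (Bᶜ.indicator F) 2 := by
    refine ⟨hi2.1, ?_⟩
    rw [eLpNorm_lt_top_iff_lintegral_rpow_enorm_lt_top (by norm_num) (by norm_num)]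
    simpa [hind] using hfin
  have hpl := planch _ hi2 hL2
  rw [hind] at hpl
  have hmk := mul_meas_ge_le_lintegral (μ := (volume : Measure V2))
    (f := fun x => ‖𝓕⁻ (Bᶜ.indicator F) x‖ₑ ^ 2)
    (by have := (cont_fi _ hi2).measurable; fun_prop) (ENNReal.ofReal ((t/2)^2))
  rw [hpl] at hmk
  have hsub : {x : V2 | t < ‖𝓕⁻ F x‖} ⊆
      {x | ENNReal.ofReal ((t/2)^2) ≤ ‖𝓕⁻ (Bᶜ.indicator F) x‖ₑ ^ 2} := by
    intro x hx
    simp only [Set.mem_ofPred_eq] at hx ⊢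
    rw [hsplit] at hx
    have h5 := norm_add_le (𝓕⁻ (B.indicator F) x) (𝓕⁻ (Bᶜ.indicator F) x)
    have h6 := hlow x
    have h7 : t / 2 ≤ ‖𝓕⁻ (Bᶜ.indicator F) x‖ := by linarith
    rw [← ofReal_norm, ← ENNReal.ofReal_pow (norm_nonneg _)]
    apply ENNReal.ofReal_le_ofReal
    gcongr
  calc volume {x : V2 | t < ‖𝓕⁻ F x‖}
      ≤ volume {x | ENNReal.ofReal ((t/2)^2) ≤ ‖𝓕⁻ (Bᶜ.indicator F) x‖ₑ ^ 2} := measure_mono hsub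
    _ = ENNReal.ofReal (4 * t ^ (-2 : ℝ)) * (ENNReal.ofReal ((t/2)^2) * volume {x | ENNReal.ofReal ((t/2)^2) ≤ ‖𝓕⁻ (Bᶜ.indicator F) x‖ₑ ^ 2}) := by
        rw [← mul_assoc, ← ENNReal.ofReal_mul (by positivity)]
        have : 4 * t ^ (-2 : ℝ) * (t/2)^2 = 1 := by
          rw [Real.rpow_neg ht.le, Real.rpow_two]; field_simp; norm_num
        rw [this]; simp
    _ ≤ _ := by gcongr

open FourierTransform in
lemma sobolev (s : ℝ) (hs0 : 0 < s) (hs1 : s < 1) :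
    ∃ C : ℝ≥0∞, C ≠ ∞ ∧ ∀ F : V2 → ℂ, Continuous F → Integrable F →
      ∫⁻ x, ‖𝓕⁻ F x‖ₑ ^ (2 / (1 - s)) ≤
        C * (∫⁻ ξ, ENNReal.ofReal (‖ξ‖ ^ (2*s)) * ‖F ξ‖ₑ ^ 2) ^ (1 / (1 - s)) := by
  obtain ⟨K, hK, hKb⟩ := ball_int s hs1
  have h1s : 0 < 1 - s := by linarith
  set p := 2 / (1 - s) with hp
  have hp2 : 2 < p := by rw [hp, lt_div_iff₀ h1s]; linarith
  have hp20 : 0 < p - 2 := by linarith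
  refine ⟨ENNReal.ofReal (p * (4 / (p-2) * (2 * √K) ^ (p-2))), by simp, fun F hF hFi => ?_⟩
  have hC0 : 0 < p * (4 / (p-2) * (2 * √K) ^ (p-2)) := by positivity
  set W := ∫⁻ ξ, ENNReal.ofReal (‖ξ‖ ^ (2*s)) * ‖F ξ‖ₑ ^ 2 with hW
  by_cases hWt : W = ∞
  · rw [hWt, ENNReal.top_rpow_of_pos (by positivity), ENNReal.mul_top (by simpa using hC0)]
    exact le_top
  by_cases hW0 : W = 0
  · have h1 := low_bound s hs0 F hF Set.univ
    rw [← hW, hW0, ENNReal.zero_rpow_of_pos (by norm_num), mul_zero, setLIntegral_univ] at h1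
    have h2 : ∀ x, ‖𝓕⁻ F x‖ₑ = 0 := fun x => le_antisymm ((enorm_fi_le F x).trans h1) zero_le
    simp only [h2]
    rw [ENNReal.zero_rpow_of_pos (by linarith)]
    simp
  set N := √W.toReal with hN
  have hWr : 0 < W.toReal := ENNReal.toReal_pos hW0 hWt
  have hN0 : 0 < N := by positivity
  have hWN : W = ENNReal.ofReal (N ^ 2) := by
    rw [hN, Real.sq_sqrt hWr.le, ENNReal.ofReal_toReal hWt]
  set b := 2 * √K * N with hb
  have hb0 : 0 < b := by positivity
  have hlc := lintegral_rpow_eq_lintegral_meas_lt_mul (volume : Measure V2)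
    (f := fun x => ‖𝓕⁻ F x‖) (Filter.Eventually.of_forall fun x => norm_nonneg _)
    (cont_fi F hFi).norm.measurable.aemeasurable (p := p) (by linarith)
  have e1 : ∀ x, ‖𝓕⁻ F x‖ₑ ^ p = ENNReal.ofReal (‖𝓕⁻ F x‖ ^ p) := by
    intro x
    rw [← ofReal_norm, ENNReal.ofReal_rpow_of_nonneg (norm_nonneg _) (by linarith)]
  simp only [e1]
  rw [hlc]
  let G : ℝ → V2 → ℝ≥0∞ := fun t ξ =>
    {q : ℝ × V2 | q.1 ≤ b * ‖q.2‖ ^ (1 - s)}.indicator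
      (fun q => ENNReal.ofReal (4 * q.1 ^ (p - 3)) * ‖F q.2‖ₑ ^ 2) (t, ξ)
  have hGm : Measurable (Function.uncurry G) := by
    have hm : MeasurableSet {q : ℝ × V2 | q.1 ≤ b * ‖q.2‖ ^ (1 - s)} :=
      measurableSet_le (by fun_prop) (by fun_prop)
    refine Measurable.indicator ?_ hm
    have := hF.measurable
    fun_prop
  have step1 : ∫⁻ t in Set.Ioi 0, volume {x : V2 | t < ‖𝓕⁻ F x‖} * ENNReal.ofReal (t ^ (p - 1))
      ≤ ∫⁻ t in Set.Ioi 0, ∫⁻ ξ, G t ξ := by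
    apply setLIntegral_mono' measurableSet_Ioi
    intro t ht
    have ht : 0 < t := ht
    have hwb := weak_bound s K N b t hs0 hs1 hK hN0 hb ht hKb F hF hFi hWN
    have hm : MeasurableSet {ξ : V2 | t ≤ b * ‖ξ‖ ^ (1 - s)} :=
      measurableSet_le (by fun_prop) (by fun_prop)
    calc _ ≤ (ENNReal.ofReal (4 * t ^ (-2 : ℝ)) *
          ∫⁻ ξ in {ξ : V2 | t ≤ b * ‖ξ‖ ^ (1 - s)}, ‖F ξ‖ₑ ^ 2) * ENNReal.ofReal (t ^ (p - 1)) := by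
          gcongr
      _ = ENNReal.ofReal (4 * t ^ (p - 3)) *
          ∫⁻ ξ in {ξ : V2 | t ≤ b * ‖ξ‖ ^ (1 - s)}, ‖F ξ‖ₑ ^ 2 := by
          rw [mul_right_comm, ← ENNReal.ofReal_mul (by positivity), mul_assoc, ← Real.rpow_add ht]
          congr 4; ring
      _ = _ := by
          rw [← lintegral_const_mul' _ _ ENNReal.ofReal_ne_top, ← lintegral_indicator hm]
          rfl
  have step2 : ∫⁻ t in Set.Ioi 0, ∫⁻ ξ, G t ξ = ∫⁻ ξ, ∫⁻ t in Set.Ioi 0, G t ξ :=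
    lintegral_lintegral_swap hGm.aemeasurable
  have step3 : ∀ ξ, ∫⁻ t in Set.Ioi 0, G t ξ = ENNReal.ofReal (4 / (p-2) * b ^ (p-2)) *
      (ENNReal.ofReal (‖ξ‖ ^ (2*s)) * ‖F ξ‖ₑ ^ 2) := by
    intro ξ
    set R := b * ‖ξ‖ ^ (1 - s) with hR
    have hR0 : 0 ≤ R := by positivity
    have : ∀ t, G t ξ = (Set.Iic R).indicator (fun t => ENNReal.ofReal (4 * t ^ (p - 3)) * ‖F ξ‖ₑ ^ 2) t := by
      intro t; rfl
    simp only [this]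
    rw [lintegral_indicator measurableSet_Iic, Measure.restrict_restrict measurableSet_Iic,
      Set.inter_comm, Set.Ioi_inter_Iic, lintegral_mul_const' _ _ (by simp)]
    simp only [ENNReal.ofReal_mul (show (0:ℝ) ≤ 4 by norm_num)]
    rw [lintegral_const_mul' _ _ (by simp), lint_rpow _ _ (by linarith) hR0, ← mul_assoc,
      ← ENNReal.ofReal_mul (by norm_num), ← ENNReal.ofReal_mul (by positivity)]
    congr 2
    have e3 : p - 3 + 1 = p - 2 := by ring
    rw [e3, hR, Real.mul_rpow hb0.le (by positivity), ← Real.rpow_mul (norm_nonneg _)]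
    have e4 : (1 - s) * (p - 2) = 2 * s := by
      rw [hp]; field_simp; ring
    rw [e4]; ring
  calc ENNReal.ofReal p * ∫⁻ t in Set.Ioi 0, volume {x : V2 | t < ‖𝓕⁻ F x‖} * ENNReal.ofReal (t ^ (p - 1))
      ≤ ENNReal.ofReal p * ∫⁻ ξ, ENNReal.ofReal (4 / (p-2) * b ^ (p-2)) *
      (ENNReal.ofReal (‖ξ‖ ^ (2*s)) * ‖F ξ‖ₑ ^ 2) := by
        simp only [← step3]
        rw [← step2]
        gcongr
    _ = ENNReal.ofReal (p * (4 / (p-2) * b ^ (p-2) * N ^ 2)) := by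
        rw [lintegral_const_mul' _ _ (by simp), ← hW, hWN, ← ENNReal.ofReal_mul (by positivity),
          ← ENNReal.ofReal_mul (by positivity)]
    _ = _ := by
        rw [hWN, ENNReal.ofReal_rpow_of_nonneg (by positivity) (by positivity),
          ← ENNReal.ofReal_mul (by positivity)]
        congr 1
        rw [hb, Real.mul_rpow (by positivity) hN0.le]
        have : (N ^ 2) ^ (1 / (1 - s)) = N ^ (p - 2) * N ^ 2 := by
          rw [← Real.rpow_natCast, ← Real.rpow_mul hN0.le, ← Real.rpow_add hN0]
          congr 1; push_cast; rw [hp]; ring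
        rw [this]; ring

open FourierTransform in
lemma ft2_eq (g : V2 → ℂ) (ξ : V2) : ft2 g ξ = 𝓕 g ((2 * π)⁻¹ • ξ) := by
  rw [ft2, Real.fourier_eq']
  congr 1; ext x
  rw [smul_eq_mul, inner_smul_right]
  congr 2
  have := Real.pi_ne_zero
  have h : -2 * π * ((2 * π)⁻¹ * ⟪x, ξ⟫) = -⟪x, ξ⟫ := by field_simp
  rw [h]; push_cast; ring

open FourierTransform in
lemma ift2_eq (G : V2 → ℂ) (x : V2) : ift2 G x = 𝓕⁻ (fun η => G ((2 * π) • η)) x := by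
  have h := Measure.integral_comp_smul_of_nonneg (volume : Measure V2)
    (fun ξ => Complex.exp (Complex.I * ((⟪x, ξ⟫ : ℝ) : ℂ)) * G ξ) (2 * π) (hR := by positivity)
  rw [finrank_euclideanSpace, Fintype.card_fin, Complex.real_smul] at h
  rw [ift2, ← h, Real.fourierInv_eq']
  congr 1; ext ξ
  rw [smul_eq_mul, inner_smul_right, real_inner_comm, mul_comm Complex.I]

open FourierTransform in
lemma Dal_eq (α : ℝ) (g : V2 → ℂ) (x : V2) : Dal α g x =
    𝓕⁻ (fun η => (((2 * π) ^ α * ‖η‖ ^ α : ℝ) : ℂ) * 𝓕 g η) x := by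
  rw [Dal, ift2_eq]
  refine congrArg (fun H : V2 → ℂ => 𝓕⁻ H x) ?_
  funext η
  have hp : 0 < 2 * π := by positivity
  rw [ft2_eq, smul_smul, inv_mul_cancel₀ hp.ne', one_smul, norm_smul, Real.norm_of_nonneg hp.le,
    Real.mul_rpow hp.le (norm_nonneg _)]

open FourierTransform in
lemma pd_planch (g : SchwartzMap V2 ℂ) (j : Fin 2) :
    ∫⁻ x, ‖pd2 j g x‖ₑ ^ 2 = ∫⁻ η : V2, ENNReal.ofReal ((2 * π * η j) ^ 2) * ‖𝓕 (g : V2 → ℂ) η‖ₑ ^ 2 := by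
  set m : V2 := EuclideanSpace.single j 1
  set D : SchwartzMap V2 ℂ := LineDeriv.lineDerivOp m g with hD
  have h1 : ∀ x, pd2 j g x = 𝓕⁻ (𝓕 D : SchwartzMap V2 ℂ) x := by
    intro x
    rw [FourierTransform.fourierInv_fourier_eq]
    rfl
  have h2 := planch (𝓕 D : SchwartzMap V2 ℂ) (SchwartzMap.integrable _) (SchwartzMap.memLp _ _ _)
  simp only [h1, SchwartzMap.fourierInv_coe]
  rw [h2]
  congr 1; ext η
  have ht : (fun x : V2 => inner ℝ x m).HasTemperateGrowth := by fun_prop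
  rw [hD, SchwartzMap.fourier_lineDerivOp_eq, smul_apply,
    SchwartzMap.smulLeftCLM_apply_apply ht, SchwartzMap.fourier_coe, enorm_smul, enorm_smul,
    mul_pow, mul_pow, ← mul_assoc]
  congr 1
  rw [← ofReal_norm, ← ofReal_norm, ← ENNReal.ofReal_pow (norm_nonneg _),
    ← ENNReal.ofReal_pow (norm_nonneg _), ← ENNReal.ofReal_mul (by positivity)]
  congr 1
  have : inner ℝ η m = η j := by simp [m, EuclideanSpace.inner_single_right]
  rw [this]
  simp [abs_of_pos Real.pi_pos]
  ring

open FourierTransform in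
/-- For `0 < α < 1` there is a constant `C` such that for Schwartz `g, h` on `ℝ²`,
`‖(D^α g)·h‖_{L²} ≤ C ‖∇g‖_{L²} ‖D^α h‖_{L²}`, where
`‖D^α h‖_{L²} = ‖|ξ|^α ĥ(ξ)‖_{L²}`. -/
theorem Dalpha_product_estimate (α : ℝ) (hα1 : 0 < α) (hα2 : α < 1) :
    ∃ C : ℝ, 0 < C ∧
      ∀ g h : SchwartzMap V2 ℂ,
        (∫⁻ x : V2, (‖Dal α ⇑g x * h x‖₊ : ℝ≥0∞) ^ (2 : ℕ)) ^ ((1 : ℝ) / 2) ≤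
          ENNReal.ofReal C *
            ((∫⁻ x : V2, ((‖pd2 0 ⇑g x‖₊ : ℝ≥0∞) ^ (2 : ℕ) +
                (‖pd2 1 ⇑g x‖₊ : ℝ≥0∞) ^ (2 : ℕ))) ^ ((1 : ℝ) / 2) *
              (∫⁻ ξ : V2, (ENNReal.ofReal (‖ξ‖ ^ α) *
                (‖ft2 ⇑h ξ‖₊ : ℝ≥0∞)) ^ (2 : ℕ)) ^ ((1 : ℝ) / 2)) := by
  obtain ⟨C1, hC1, H1⟩ := sobolev (1 - α) (by linarith) (by linarith)
  obtain ⟨C2, hC2, H2⟩ := sobolev α hα1 hα2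
  have h1a : 0 < 1 - α := by linarith
  have hp : 0 < 2 * π := by positivity
  set D : ℝ≥0∞ := C1 ^ α * C2 ^ (1 - α) *
    (ENNReal.ofReal ((2*π) ^ (2*α) * ((2*π)^2)⁻¹) * ENNReal.ofReal (((2*π)^2)⁻¹ * ((2*π) ^ (2*α))⁻¹))
    with hD
  have hDt : D ≠ ∞ := by
    refine ENNReal.mul_ne_top (ENNReal.mul_ne_top ?_ ?_) (ENNReal.mul_ne_top ?_ ?_)
    · exact ENNReal.rpow_ne_top_of_nonneg hα1.le hC1
    · exact ENNReal.rpow_ne_top_of_nonneg h1a.le hC2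
    · exact ENNReal.ofReal_ne_top
    · exact ENNReal.ofReal_ne_top
  have hDt2 : D ^ ((1:ℝ)/2) ≠ ∞ := ENNReal.rpow_ne_top_of_nonneg (by norm_num) hDt
  refine ⟨(D ^ ((1:ℝ)/2)).toReal + 1, by positivity, fun g h => ?_⟩
  set X := ∫⁻ x : V2, ((‖pd2 0 ⇑g x‖₊ : ℝ≥0∞) ^ (2 : ℕ) +
                (‖pd2 1 ⇑g x‖₊ : ℝ≥0∞) ^ (2 : ℕ)) with hX
  set Y := ∫⁻ ξ : V2, (ENNReal.ofReal (‖ξ‖ ^ α) *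
                (‖ft2 ⇑h ξ‖₊ : ℝ≥0∞)) ^ (2 : ℕ) with hY
  suffices hmain : (∫⁻ x : V2, (‖Dal α ⇑g x * h x‖₊ : ℝ≥0∞) ^ (2 : ℕ)) ≤ D * (X * Y) by
    calc _ ≤ (D * (X * Y)) ^ ((1:ℝ)/2) := ENNReal.rpow_le_rpow hmain (by norm_num)
      _ = D ^ ((1:ℝ)/2) * (X ^ ((1:ℝ)/2) * Y ^ ((1:ℝ)/2)) := by
          rw [ENNReal.mul_rpow_of_nonneg D (X * Y) (by norm_num), ENNReal.mul_rpow_of_nonneg X Y (by norm_num)]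
      _ ≤ _ := by
          gcongr
          rw [ENNReal.le_ofReal_iff_toReal_le hDt2 (by positivity)]
          linarith
  set Fg : V2 → ℂ := fun η => (((2 * π) ^ α * ‖η‖ ^ α : ℝ) : ℂ) * 𝓕 (g : V2 → ℂ) η with hFg
  set Fh : V2 → ℂ := 𝓕 (h : V2 → ℂ) with hFh
  have cg : Continuous (𝓕 (g : V2 → ℂ)) := (𝓕 g : SchwartzMap V2 ℂ).continuous
  have ch : Continuous Fh := (𝓕 h : SchwartzMap V2 ℂ).continuous
  have ih : Integrable Fh := (𝓕 h : SchwartzMap V2 ℂ).integrable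
  have cn : Continuous (fun η : V2 => ‖η‖ ^ α) :=
    continuous_norm.rpow_const (fun _ => Or.inr hα1.le)
  have cFg : Continuous Fg := by
    rw [hFg]
    exact (Complex.continuous_ofReal.comp (continuous_const.mul cn)).mul cg
  have iFg : Integrable Fg := by
    have i0 : Integrable (fun η => ‖𝓕 (g : V2 → ℂ) η‖) := (𝓕 g : SchwartzMap V2 ℂ).integrable.norm
    have i1 : Integrable (fun η => ‖η‖ ^ 1 * ‖𝓕 (g : V2 → ℂ) η‖) :=
      (𝓕 g : SchwartzMap V2 ℂ).integrable_pow_mul volume 1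
    refine ((i0.add i1).const_mul ((2*π)^α)).mono' cFg.aestronglyMeasurable
      (Filter.Eventually.of_forall fun η => ?_)
    have hb : ‖η‖ ^ α ≤ 1 + ‖η‖ := by
      rcases le_total ‖η‖ 1 with h | h
      · have := Real.rpow_le_one (norm_nonneg η) h hα1.le
        linarith [norm_nonneg η]
      · have := Real.rpow_le_rpow_of_exponent_le h hα2.le
        rw [Real.rpow_one] at this
        linarith
    rw [hFg]
    simp only [norm_mul, Complex.norm_real, Pi.add_apply, pow_one]
    rw [Real.norm_of_nonneg (by positivity), Real.norm_of_nonneg (by positivity), mul_assoc]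
    gcongr
    nlinarith [norm_nonneg (𝓕 (g : V2 → ℂ) η)]
  have eh : ∀ x, h x = 𝓕⁻ Fh x := by
    intro x
    have : 𝓕⁻ (𝓕 h : SchwartzMap V2 ℂ) x = h x := by
      rw [FourierTransform.fourierInv_fourier_eq]
    rw [← this, SchwartzMap.fourierInv_coe, SchwartzMap.fourier_coe]
  have B1 := H1 Fg cFg iFg
  have B2 := H2 Fh ch ih
  rw [sub_sub_cancel] at B1
  have W1 : ∫⁻ ξ, ENNReal.ofReal (‖ξ‖ ^ (2 * (1 - α))) * ‖Fg ξ‖ₑ ^ 2 =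
      ENNReal.ofReal ((2*π) ^ (2*α) * ((2*π)^2)⁻¹) * X := by
    have hX2 : X = ∫⁻ η : V2, ENNReal.ofReal ((2*π)^2 * ‖η‖^2) * ‖𝓕 (g : V2 → ℂ) η‖ₑ ^ 2 := by
      have m0 : Measurable (fun x => ‖pd2 0 ⇑g x‖ₑ ^ 2) := by
        have : Continuous (pd2 0 ⇑g) :=
          (LineDeriv.lineDerivOp (EuclideanSpace.single 0 1 : V2) g : SchwartzMap V2 ℂ).continuous
        exact (this.measurable.enorm).pow_const 2
      have : X = ∫⁻ x, ‖pd2 0 ⇑g x‖ₑ ^ 2 + ‖pd2 1 ⇑g x‖ₑ ^ 2 := rfl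
      rw [this, lintegral_add_left m0, pd_planch, pd_planch, ← lintegral_add_left]
      · congr 1; ext η
        rw [← add_mul, ← ENNReal.ofReal_add (by positivity) (by positivity)]
        congr 2
        rw [EuclideanSpace.norm_sq_eq, Fin.sum_univ_two]
        simp only [Real.norm_eq_abs, sq_abs]
        ring
      · have := cg.measurable
        fun_prop
    rw [hX2, ← lintegral_const_mul' _ _ ENNReal.ofReal_ne_top]
    congr 1; ext η
    rw [hFg]
    simp only [enorm_mul, mul_pow]
    rw [← mul_assoc, ← mul_assoc, ← ENNReal.ofReal_mul (by positivity)]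
    congr 1
    rw [← ofReal_norm, Complex.norm_real, Real.norm_of_nonneg (by positivity),
      ← ENNReal.ofReal_pow (by positivity), ← ENNReal.ofReal_mul (by positivity)]
    congr 1
    have a1 : (2*π) ^ (2*α) = ((2*π)^α)^2 := by
      rw [← Real.rpow_natCast, ← Real.rpow_mul hp.le]; congr 1; push_cast; ring
    have a2 : ‖η‖ ^ 2 = ‖η‖ ^ (2 * (1 - α)) * (‖η‖ ^ α)^2 := by
      rw [← Real.rpow_natCast (‖η‖ ^ α), ← Real.rpow_mul (norm_nonneg _),
        ← Real.rpow_add_of_nonneg (norm_nonneg _) (by linarith) (by positivity),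
        ← Real.rpow_natCast]
      congr 1; push_cast; ring
    rw [a1, a2]
    field_simp
  have W2 : ∫⁻ ξ, ENNReal.ofReal (‖ξ‖ ^ (2 * α)) * ‖Fh ξ‖ₑ ^ 2 =
      ENNReal.ofReal (((2*π)^2)⁻¹ * ((2*π) ^ (2*α))⁻¹) * Y := by
    have hsc := lint_smul (fun ξ => (ENNReal.ofReal (‖ξ‖ ^ α) *
                (‖ft2 ⇑h ξ‖₊ : ℝ≥0∞)) ^ (2 : ℕ)) hp
    rw [← hY] at hsc
    rw [mul_comm (((2*π)^2)⁻¹), ENNReal.ofReal_mul (by positivity), mul_assoc, ← hsc,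
      ← lintegral_const_mul' _ _ ENNReal.ofReal_ne_top]
    congr 1; ext η
    rw [ft2_eq, smul_smul, inv_mul_cancel₀ hp.ne', one_smul, mul_pow, ← mul_assoc]
    refine congrArg₂ (· * ·) ?_ rfl
    rw [← ENNReal.ofReal_pow (by positivity), ← ENNReal.ofReal_mul (by positivity), norm_smul,
      Real.norm_of_nonneg hp.le, Real.mul_rpow hp.le (norm_nonneg _), mul_pow]
    congr 1
    have a1 : ∀ r : ℝ, 0 ≤ r → r ^ (2*α) = (r^α)^2 := by
      intro r hr
      rw [← Real.rpow_natCast, ← Real.rpow_mul hr]; congr 1; push_cast; ring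
    rw [a1 _ hp.le, a1 _ (norm_nonneg _)]
    field_simp
  rw [W1] at B1
  rw [W2] at B2
  have hol := ENNReal.lintegral_mul_le_Lp_mul_Lq (volume : Measure V2) (p := 1/α) (q := 1/(1-α))
    (by
      rw [Real.holderConjugate_iff]
      refine ⟨by rw [lt_div_iff₀ hα1]; linarith, by simp⟩)
    (f := fun x => ‖𝓕⁻ Fg x‖ₑ ^ 2) (g := fun x => ‖𝓕⁻ Fh x‖ₑ ^ 2)
    (by have := (cont_fi _ iFg).measurable; fun_prop) (by have := (cont_fi _ ih).measurable; fun_prop)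
  have r1 : ∀ (z : ℝ≥0∞) (a : ℝ), (z ^ 2) ^ (1 / a) = z ^ (2 / a) := by
    intro z a
    rw [← ENNReal.rpow_two, ← ENNReal.rpow_mul]; congr 1; ring
  simp only [r1, one_div_one_div, Pi.mul_apply] at hol
  have e0 : ∀ x, (‖Dal α ⇑g x * h x‖₊ : ℝ≥0∞) ^ (2 : ℕ) = ‖𝓕⁻ Fg x‖ₑ ^ 2 * ‖𝓕⁻ Fh x‖ₑ ^ 2 := by
    intro x
    rw [Dal_eq, eh x, ← mul_pow, ← enorm_mul]
    rfl
  simp only [e0]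
  refine hol.trans ((mul_le_mul' (ENNReal.rpow_le_rpow B1 hα1.le)
    (ENNReal.rpow_le_rpow B2 h1a.le)).trans (le_of_eq ?_))
  rw [ENNReal.mul_rpow_of_nonneg _ _ hα1.le, ENNReal.mul_rpow_of_nonneg _ _ h1a.le,
    ← ENNReal.rpow_mul, ← ENNReal.rpow_mul, one_div_mul_cancel hα1.ne', one_div_mul_cancel h1a.ne',
    ENNReal.rpow_one, ENNReal.rpow_one, hD]
  ring
end
end

section
/- Let 0 < α < 1 and n ≥ 1. There is a constant C such that for every smooth map g: ℝ² → U(n) (the group of n×n unitary matrices) whose gradient ∇g is a Schwartz function, and every Schwartz function h: ℝ² → M_n(ℂ), the gauge-transformed field h_g = g·h·g^{−1} + g·∂_j(g^{−1}) (j = 1,2, each spatial component measured and summed) satisfies ‖h_g‖_{H^α(ℝ²)} ≤ C·(‖h‖_{H^α(ℝ²)} + 1)·K², where K = ‖∇g‖_{L²(ℝ²)} + ‖D^α∇g‖_{L²(ℝ²)} + sup_{x}‖g(x)‖. -/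
noncomputable section

open MeasureTheory Real
open scoped ENNReal RealInnerProductSpace ComplexConjugate

/-- The inhomogeneous Sobolev norm `H^α(ℝ²)` of a scalar function,
`‖(1+|ξ|²)^{α/2} ĝ‖_{L²}`. -/
def HalS (α : ℝ) (g : V2 → ℂ) : ℝ≥0∞ :=
  (∫⁻ ξ : V2, (ENNReal.ofReal ((1 + ‖ξ‖ ^ 2) ^ (α / 2)) *
      (‖ft2 g ξ‖₊ : ℝ≥0∞)) ^ (2 : ℕ)) ^ ((1 : ℝ) / 2)

/-- `H^α(ℝ²)` norm of a matrix-valued function, applied entrywise and summed. -/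
def HalM {n : ℕ} (α : ℝ) (u : V2 → Matrix (Fin n) (Fin n) ℂ) : ℝ≥0∞ :=
  ∑ i, ∑ k, HalS α (fun x => u x i k)

/-- `‖∇g‖_{L²(ℝ²)}` of a matrix-valued map (entrywise and summed). -/
def gradL2 {n : ℕ} (g : V2 → Matrix (Fin n) (Fin n) ℂ) : ℝ≥0∞ :=
  (∫⁻ x : V2, ∑ j : Fin 2, ∑ i, ∑ k,
      (‖pd2 j (fun y => g y i k) x‖₊ : ℝ≥0∞) ^ (2 : ℕ)) ^ ((1 : ℝ) / 2)

/-- `‖D^α ∇g‖_{L²(ℝ²)}`, computed on the Fourier side (entrywise and summed);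
an equivalent expression for the homogeneous `Ḣ^{α+1}` norm of `g`. -/
def DalGradL2 {n : ℕ} (α : ℝ) (g : V2 → Matrix (Fin n) (Fin n) ℂ) : ℝ≥0∞ :=
  (∫⁻ ξ : V2, ∑ j : Fin 2, ∑ i, ∑ k,
      (ENNReal.ofReal (‖ξ‖ ^ α) *
        (‖ft2 (pd2 j (fun y => g y i k)) ξ‖₊ : ℝ≥0∞)) ^ (2 : ℕ)) ^ ((1 : ℝ) / 2)

/-- `sup_x ‖g(x)‖` of a matrix-valued map. -/
def supM {n : ℕ} (g : V2 → Matrix (Fin n) (Fin n) ℂ) : ℝ≥0∞ :=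
  ⨆ x : V2, (∑ i, ∑ k, (‖g x i k‖₊ : ℝ≥0∞) ^ (2 : ℕ)) ^ ((1 : ℝ) / 2)

open scoped FourierTransform SchwartzMap

lemma ft2_eq_fourier (f : V2 → ℂ) (ξ : V2) : ft2 f ξ = 𝓕 f ((2 * π)⁻¹ • ξ) := by
  rw [Real.fourier_eq', ft2]
  congr 1
  ext x
  rw [smul_eq_mul, inner_smul_right]
  congr 2
  have : (π : ℂ) ≠ 0 := by exact_mod_cast Real.pi_ne_zero
  push_cast
  field_simp

def scl : V2 ≃L[ℝ] V2 := ContinuousLinearEquiv.smulLeft (Units.mk0 ((2 * π)⁻¹ : ℝ) (by positivity))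

lemma scl_apply (x : V2) : scl x = (2 * π)⁻¹ • x := rfl

/-- Schwartz version of `ft2`. -/
def Ft (f : 𝓢(V2, ℂ)) : 𝓢(V2, ℂ) :=
  SchwartzMap.compCLMOfContinuousLinearEquiv ℂ scl (𝓕 f)

lemma Ft_apply (f : 𝓢(V2, ℂ)) (ξ : V2) : Ft f ξ = ft2 f ξ := by
  rw [ft2_eq_fourier]; rfl

lemma Ft_add (f g : 𝓢(V2, ℂ)) : Ft (f + g) = Ft f + Ft g := by
  simp [Ft, FourierTransform.fourier_add]

lemma Ft_smul (c : ℂ) (f : 𝓢(V2, ℂ)) : Ft (c • f) = c • Ft f := by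
  simp [Ft, FourierTransform.fourier_smul]

lemma Ft_surj (a : 𝓢(V2, ℂ)) : ∃ p, Ft p = a := by
  refine ⟨𝓕⁻ (SchwartzMap.compCLMOfContinuousLinearEquiv ℂ scl.symm a), ?_⟩
  rw [Ft, FourierTransform.fourier_fourierInv_eq]
  ext x
  simp

lemma sch_lint (f : 𝓢(V2, ℂ)) :
    ∫⁻ x, (‖f x‖₊ : ℝ≥0∞) ^ 2 = ENNReal.ofReal (∫ x, ‖f x‖ ^ 2) := by
  rw [ofReal_integral_eq_lintegral_ofReal]
  · congr 1; ext x
    rw [ENNReal.ofReal_pow (norm_nonneg _), ofReal_norm]; rfl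
  · have := f.memLp 2 volume
    exact this.integrable_norm_pow (by norm_num)
  · exact Filter.Eventually.of_forall fun x => by positivity

lemma Ft_plancherel (f : 𝓢(V2, ℂ)) :
    ∫⁻ x, (‖Ft f x‖₊ : ℝ≥0∞) ^ 2 = ENNReal.ofReal ((2 * π) ^ 2) * ∫⁻ x, (‖f x‖₊ : ℝ≥0∞) ^ 2 := by
  rw [sch_lint, sch_lint, ← ENNReal.ofReal_mul (by positivity)]
  congr 1
  have : ∀ x, ‖Ft f x‖ ^ 2 = ‖𝓕 f ((2 * π)⁻¹ • x)‖ ^ 2 := fun x => rfl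
  simp_rw [this]
  rw [Measure.integral_comp_inv_smul volume (fun x => ‖𝓕 f x‖ ^ 2) (2 * π),
    SchwartzMap.integral_norm_sq_fourier]
  simp [abs_of_pos Real.pi_pos]

lemma Ft_mul (v f P : 𝓢(V2, ℂ)) (hP : ∀ x, P x = v x * f x) (ξ : V2) :
    Ft P ξ = (((2 * π) ^ 2)⁻¹ : ℝ) * ∫ ζ, Ft v ζ * Ft f (ξ - ζ) := by
  have h1 : P = SchwartzMap.pairing (ContinuousLinearMap.mul ℂ ℂ) v f := by
    ext x; simp [hP]
  have h2 : 𝓕 P = SchwartzMap.convolution (ContinuousLinearMap.mul ℂ ℂ) (𝓕 v) (𝓕 f) := by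
    have key : 𝓕⁻ (SchwartzMap.convolution (ContinuousLinearMap.mul ℂ ℂ) (𝓕 v) (𝓕 f)) = P := by
      ext x
      have e : 𝓕 (SchwartzMap.convolution (ContinuousLinearMap.mul ℂ ℂ) (𝓕 v) (𝓕 f)) (-x)
          = P x := by
        rw [SchwartzMap.fourier_convolution]
        have hv : ∀ v : 𝓢(V2, ℂ), 𝓕 (𝓕 v) (-x) = v x := by
          intro v
          have : 𝓕⁻ (𝓕 v) x = 𝓕 (𝓕 v) (-x) := rfl
          rw [← this, FourierTransform.fourierInv_fourier_eq]
        simp [hv, hP]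
      exact e
    rw [← key, FourierTransform.fourier_fourierInv_eq]
  change 𝓕 P ((2 * π)⁻¹ • ξ) = _
  rw [h2, SchwartzMap.convolution_apply, convolution_def]
  have := Measure.integral_comp_inv_smul (volume : Measure V2)
    (fun t => 𝓕 v t * 𝓕 f ((2 * π)⁻¹ • ξ - t)) (2 * π)
  have e2 : ∀ ζ, Ft v ζ * Ft f (ξ - ζ) = 𝓕 v ((2 * π)⁻¹ • ζ) * 𝓕 f ((2 * π)⁻¹ • ξ - (2 * π)⁻¹ • ζ) := by
    intro ζ; rw [← smul_sub]; rfl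
  simp_rw [e2]
  rw [this]
  have hpi : (π : ℂ) ≠ 0 := by exact_mod_cast Real.pi_ne_zero
  simp [abs_of_pos Real.pi_pos]

lemma Ft_deriv (v G : 𝓢(V2, ℂ)) (j : Fin 2) (hG : ∀ x, G x = pd2 j v x) (ξ : V2) :
    Ft G ξ = Complex.I * (ξ j : ℝ) * Ft v ξ := by
  have h1 : G = LineDeriv.lineDerivOp (EuclideanSpace.single j (1:ℝ)) v := by
    ext x; rw [hG]; rfl
  change 𝓕 G ((2 * π)⁻¹ • ξ) = _ * 𝓕 v ((2 * π)⁻¹ • ξ)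
  rw [h1, SchwartzMap.fourier_lineDerivOp_eq]
  have : (inner ℝ · (EuclideanSpace.single j (1:ℝ)) : V2 → ℝ).HasTemperateGrowth := by fun_prop
  have hpi : (π : ℂ) ≠ 0 := by exact_mod_cast Real.pi_ne_zero
  have h2 := SchwartzMap.smulLeftCLM_apply_apply this (𝓕 v) ((2 * π)⁻¹ • ξ)
  rw [smul_apply, h2, EuclideanSpace.inner_single_right]
  simp
  field_simp

lemma ft2_conj (f : V2 → ℂ) (ξ : V2) : ft2 (fun x => conj (f x)) ξ = conj (ft2 f (-ξ)) := by
  rw [ft2, ft2, ← integral_conj]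
  congr 1; ext x
  rw [map_mul, ← Complex.exp_conj]
  simp

lemma HalS_conj (α : ℝ) (f : V2 → ℂ) : HalS α (fun x => conj (f x)) = HalS α f := by
  rw [HalS, HalS]
  congr 1
  rw [← lintegral_neg_eq_self]
  congr 1; ext ξ
  rw [ft2_conj]
  simp [nnnorm]

/-- L2 norm of an extended nonnegative function. -/
def N2 (a : V2 → ℝ≥0∞) : ℝ≥0∞ := (∫⁻ x, a x ^ (2 : ℕ)) ^ ((1 : ℝ) / 2)

lemma N2_mono {a b : V2 → ℝ≥0∞} (h : ∀ x, a x ≤ b x) : N2 a ≤ N2 b := by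
  unfold N2
  gcongr
  exact h _

lemma N2_congr {a b : V2 → ℝ≥0∞} (h : ∀ x, a x = b x) : N2 a = N2 b := by
  rw [funext h]

lemma N2_add {a b : V2 → ℝ≥0∞} (ha : Measurable a) (hb : Measurable b) :
    N2 (fun x => a x + b x) ≤ N2 a + N2 b := by
  have := ENNReal.lintegral_Lp_add_le (μ := volume) (p := 2) ha.aemeasurable hb.aemeasurable
    (by norm_num)
  simpa [N2] using this

lemma N2_const_mul (c : ℝ≥0∞) (hc : c ≠ ⊤) (a : V2 → ℝ≥0∞) :
    N2 (fun x => c * a x) = c * N2 a := by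
  unfold N2
  simp_rw [mul_pow]
  rw [lintegral_const_mul' _ _ (by simp [hc]), ENNReal.mul_rpow_of_nonneg _ _ (by norm_num)]
  congr 1
  rw [← ENNReal.rpow_natCast, ← ENNReal.rpow_mul]
  norm_num

lemma N2_sq (a : V2 → ℝ≥0∞) : N2 a ^ 2 = ∫⁻ x, a x ^ (2 : ℕ) := by
  unfold N2
  rw [← ENNReal.rpow_natCast, ← ENNReal.rpow_mul]
  norm_num

lemma le_of_sq {a b : ℝ≥0∞} (h : a ^ 2 ≤ b ^ 2) : a ≤ b :=
  (ENNReal.pow_le_pow_left_iff (by norm_num)).1 h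

lemma CS {a b : V2 → ℝ≥0∞} (ha : Measurable a) (hb : Measurable b) :
    (∫⁻ x, a x * b x) ^ 2 ≤ (∫⁻ x, a x ^ 2) * ∫⁻ x, b x ^ 2 := by
  have := ENNReal.lintegral_mul_le_Lp_mul_Lq (μ := volume) (p := 2) (q := 2) (by constructor <;> norm_num)
    ha.aemeasurable hb.aemeasurable
  rw [← N2_sq, ← N2_sq, ← mul_pow]
  gcongr
  simpa [N2] using this

lemma conv_bound {w B F : V2 → ℝ≥0∞} (hw : Measurable w) (hB : Measurable B) (hF : Measurable F) :
    N2 (fun ξ => ∫⁻ ζ, (w ζ + w (ξ - ζ)) * (B ζ * F (ξ - ζ))) ≤ 2 * N2 w * (N2 B * N2 F) := by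
  apply le_of_sq
  rw [N2_sq, mul_pow, mul_pow, mul_pow, N2_sq, N2_sq, N2_sq]
  calc _ ≤ ∫⁻ ξ, (2 ^ 2 * ∫⁻ x, w x ^ 2) * ∫⁻ ζ, (B ζ ^ 2 * F (ξ - ζ) ^ 2) := by
        gcongr with ξ
        refine (CS (by fun_prop) (by fun_prop)).trans ?_
        simp_rw [mul_pow]
        gcongr
        rw [← N2_sq, ← N2_sq, ← mul_pow]
        gcongr
        refine (N2_add (by fun_prop) (by fun_prop)).trans_eq ?_
        have : N2 (fun x => w (ξ - x)) = N2 w := by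
          unfold N2
          rw [lintegral_sub_left_eq_self (fun x => w x ^ 2) ξ]
        rw [this, two_mul]
    _ = _ := by
        rw [lintegral_const_mul _ (Measurable.lintegral_prod_right' (f := fun z : V2 × V2 => B z.2 ^ 2 * F (z.1 - z.2) ^ 2) (by fun_prop))]
        congr 1
        rw [lintegral_lintegral_swap (by fun_prop)]
        have : ∀ y, ∫⁻ x, B y ^ 2 * F (x - y) ^ 2 = B y ^ 2 * ∫⁻ x, F x ^ 2 := by
          intro y
          rw [lintegral_const_mul _ (by fun_prop), lintegral_sub_right_eq_self (fun x => F x ^ 2) y]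
        simp_rw [this]
        rw [lintegral_mul_const _ (by fun_prop)]

def wf (α : ℝ) (r : ℝ) : ℝ := if r ≤ 1 then r ^ (α - 1) else r ^ (-1 - α)

lemma wf_nonneg (α : ℝ) {r : ℝ} (hr : 0 ≤ r) : 0 ≤ wf α r := by
  unfold wf; split_ifs <;> positivity

lemma wf_meas (α : ℝ) : Measurable (wf α) := by
  unfold wf
  exact Measurable.ite measurableSet_Iic (by fun_prop) (by fun_prop)

lemma wf_int (α : ℝ) (h0 : 0 < α) : N2 (fun x : V2 => ENNReal.ofReal (wf α ‖x‖)) ≠ ⊤ := by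
  have h : Integrable (fun x : V2 => (wf α ‖x‖) ^ 2) := by
    rw [integrable_fun_norm_addHaar volume (f := fun r => wf α r ^ 2)]
    simp only [finrank_euclideanSpace, Fintype.card_fin]
    rw [← Set.Ioc_union_Ioi_eq_Ioi (zero_le_one' ℝ)]
    apply IntegrableOn.union
    · have : IntegrableOn (fun y : ℝ => y ^ (2 * α - 1)) (Set.Ioc 0 1) := by
        rw [← intervalIntegrable_iff_integrableOn_Ioc_of_le zero_le_one]
        exact intervalIntegral.intervalIntegrable_rpow' (by linarith)
      refine this.congr_fun (fun y hy => ?_) measurableSet_Ioc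
      simp only [wf, if_pos hy.2, smul_eq_mul]
      rw [← Real.rpow_natCast, ← Real.rpow_natCast, ← Real.rpow_mul hy.1.le, ← Real.rpow_add hy.1]
      congr 1; push_cast; ring
    · have := integrableOn_Ioi_rpow_of_lt (a := -1 - 2 * α) (c := 1) (by linarith) one_pos
      refine this.congr_fun (fun y hy => ?_) measurableSet_Ioi
      have hy' : 1 < y := hy
      have hy0 : 0 < y := by linarith
      simp only [wf, if_neg hy'.not_ge, smul_eq_mul]
      rw [← Real.rpow_natCast, ← Real.rpow_natCast, ← Real.rpow_mul hy0.le, ← Real.rpow_add hy0]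
      congr 1; push_cast; ring
  have h2 := h.lintegral_lt_top
  unfold N2
  refine ENNReal.rpow_ne_top_of_nonneg (by norm_num) ?_
  convert h2.ne using 3 with x
  rw [ENNReal.ofReal_pow (wf_nonneg _ (norm_nonneg _))]

/-- Bessel weight. -/
def Wt (α : ℝ) (x : V2) : ℝ := (1 + ‖x‖ ^ 2) ^ (α / 2)

lemma Wt_pos (α : ℝ) (x : V2) : 0 < Wt α x := by unfold Wt; positivity

lemma Wt_temp (α : ℝ) : (Wt α).HasTemperateGrowth :=
  Function.hasTemperateGrowth_one_add_norm_sq_rpow V2 (α / 2)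

lemma Wt_eq (α : ℝ) (x : V2) : Wt α x = (√(1 + ‖x‖ ^ 2)) ^ α := by
  rw [Wt, Real.sqrt_eq_rpow, ← Real.rpow_mul (by positivity)]; congr 1; ring

lemma Wt_sub_le (α : ℝ) (h0 : 0 < α) (h1 : α < 1) (x y : V2) :
    Wt α x ≤ Wt α y + ‖x - y‖ ^ α := by
  rw [Wt_eq, Wt_eq]
  refine le_trans ?_ (Real.rpow_add_le_add_rpow (by positivity) (by positivity) h0.le h1.le)
  gcongr
  rw [Real.sqrt_le_left (by positivity), add_sq, Real.sq_sqrt (by positivity)]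
  have h3 : ‖x‖ ≤ ‖y‖ + ‖x - y‖ := by
    have := norm_add_le y (x - y); simpa using this
  have h4 : ‖y‖ ≤ √(1 + ‖y‖ ^ 2) := Real.le_sqrt_of_sq_le (by linarith)
  have h5 := mul_le_mul_of_nonneg_right h4 (norm_nonneg (x - y))
  have h6 := pow_le_pow_left₀ (norm_nonneg x) h3 2
  nlinarith

lemma Wt_abs (α : ℝ) (h0 : 0 < α) (h1 : α < 1) (x y : V2) :
    |Wt α x - Wt α y| ≤ ‖x - y‖ ^ α := by
  rw [abs_le]
  have h2 := Wt_sub_le α h0 h1 x y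
  have h3 := Wt_sub_le α h0 h1 y x
  rw [norm_sub_rev] at h3
  constructor <;> linarith

lemma Wt_ge_one (α : ℝ) (h0 : 0 < α) (x : V2) : 1 ≤ Wt α x := by
  apply Real.one_le_rpow <;> nlinarith [sq_nonneg ‖x‖]

lemma Wt_ge (α : ℝ) (h0 : 0 < α) (x : V2) : ‖x‖ ^ α ≤ Wt α x := by
  rw [Wt_eq]
  gcongr
  exact Real.le_sqrt_of_sq_le (by linarith)

lemma key_ineq (α : ℝ) (h0 : 0 < α) (h1 : α < 1) (z e : V2) (hz : z ≠ 0) (he : e ≠ 0) :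
    ‖z‖ ^ α ≤ (wf α ‖z‖ + wf α ‖e‖) * ((‖z‖ + ‖z‖ ^ (1 + α)) * Wt α e) := by
  have hW1 := Wt_ge_one α h0 e
  have hW2 := Wt_ge α h0 e
  have hwz := wf_nonneg α (norm_nonneg z)
  have hwe := wf_nonneg α (norm_nonneg e)
  have hz' : 0 < ‖z‖ := norm_pos_iff.2 hz
  have he' : 0 < ‖e‖ := norm_pos_iff.2 he
  generalize Wt α e = W at *
  generalize ‖z‖ = z at *
  generalize ‖e‖ = e at *
  have hA : (0:ℝ) ≤ z ^ (1 + α) := by positivity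
  rcases le_or_gt z e with h | h
  · refine le_trans ?_ (mul_le_mul_of_nonneg_right (le_add_of_nonneg_right hwe) (by positivity))
    by_cases hz1 : z ≤ 1
    · rw [wf, if_pos hz1]
      calc z ^ α = z ^ (α - 1) * (z * 1) := by
            rw [mul_one, ← Real.rpow_add_one hz'.ne']; ring_nf
        _ ≤ _ := by gcongr; linarith
    · rw [wf, if_neg hz1]
      calc z ^ α = z ^ (-1 - α) * (z ^ (1 + α) * z ^ α) := by
            rw [← Real.rpow_add hz', ← Real.rpow_add hz']; ring_nf
        _ ≤ _ := by
            gcongr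
            · linarith
            · exact le_trans (by gcongr) hW2
  · refine le_trans ?_ (mul_le_mul_of_nonneg_right (le_add_of_nonneg_left hwz) (by positivity))
    by_cases hz1 : e ≤ 1
    · rw [wf, if_pos hz1]
      calc z ^ α = z ^ (α - 1) * (z * 1) := by
            rw [mul_one, ← Real.rpow_add_one hz'.ne']; ring_nf
        _ ≤ _ := by
            gcongr ?_ * (?_ * ?_)
            · exact Real.rpow_le_rpow_of_nonpos he' h.le (by linarith)
            · linarith
    · rw [wf, if_neg hz1]
      calc z ^ α = 1 * z ^ α := by ring
        _ ≤ (z / e) * z ^ α := by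
            gcongr
            rw [le_div_iff₀ he']; linarith
        _ = e ^ (-1 - α) * (z ^ (1 + α) * e ^ α) := by
            rw [Real.rpow_sub he', Real.rpow_add hz', Real.rpow_neg he'.le]
            have := (Real.rpow_pos_of_pos he' α).ne'
            simp
            field_simp
        _ ≤ _ := by
            gcongr
            linarith

lemma int_mul (v f : 𝓢(V2, ℂ)) (ξ : V2) : Integrable (fun ζ => v ζ * f (ξ - ζ)) := by
  refine v.integrable.mul_bdd (c := SchwartzMap.seminorm ℝ 0 0 f) ?_ ?_
  · exact (f.continuous.comp (by fun_prop)).aestronglyMeasurable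
  · exact Filter.Eventually.of_forall fun x => SchwartzMap.norm_le_seminorm ℝ f _

lemma comm_bound (α : ℝ) (h0 : 0 < α) (h1 : α < 1) (v f p vf vp : 𝓢(V2, ℂ))
    (hvf : ∀ x, vf x = v x * f x) (hvp : ∀ x, vp x = v x * p x)
    (hp : ∀ ξ, Ft p ξ = Wt α ξ * Ft f ξ) (ξ : V2) :
    (‖Wt α ξ * Ft vf ξ - Ft vp ξ‖₊ : ℝ≥0∞) ≤ ENNReal.ofReal (((2 * π) ^ 2)⁻¹) *
      ∫⁻ ζ, (ENNReal.ofReal (wf α ‖ζ‖) + ENNReal.ofReal (wf α ‖ξ - ζ‖)) *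
        ((ENNReal.ofReal (‖ζ‖ + ‖ζ‖ ^ (1 + α)) * ‖Ft v ζ‖₊) *
          (ENNReal.ofReal (Wt α (ξ - ζ)) * ‖Ft f (ξ - ζ)‖₊)) := by
  have e1 : Wt α ξ * Ft vf ξ - Ft vp ξ = (((2 * π) ^ 2)⁻¹ : ℝ) *
      ∫ ζ, ((Wt α ξ - Wt α (ξ - ζ) : ℝ) : ℂ) * (Ft v ζ * Ft f (ξ - ζ)) := by
    rw [Ft_mul v f vf hvf, Ft_mul v p vp hvp, mul_left_comm, ← mul_sub,
      ← integral_const_mul, ← integral_sub ((int_mul _ _ _).const_mul _) (int_mul _ _ _)]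
    congr 2; ext ζ; rw [hp]; push_cast; ring
  rw [e1]
  change ‖(_ : ℂ)‖ₑ ≤ _
  rw [enorm_mul]
  gcongr
  · rw [← ofReal_norm, Complex.norm_real, Real.norm_of_nonneg (by positivity)]
  refine (enorm_integral_le_lintegral_enorm _).trans ?_
  apply lintegral_mono_ae
  have hz : ∀ᵐ ζ : V2, ζ ≠ 0 := by simp [ae_iff]
  have he : ∀ᵐ ζ : V2, ζ ≠ ξ := by simp [ae_iff]
  filter_upwards [hz, he] with ζ hz he
  have hk := key_ineq α h0 h1 ζ (ξ - ζ) hz (sub_ne_zero.2 he.symm)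
  have ha := Wt_abs α h0 h1 ξ (ξ - ζ)
  rw [sub_sub_cancel] at ha
  have hk2 := ENNReal.ofReal_le_ofReal (ha.trans hk)
  have w1 := wf_nonneg α (norm_nonneg ζ)
  have w2 := wf_nonneg α (norm_nonneg (ξ - ζ))
  rw [ENNReal.ofReal_mul (by positivity), ENNReal.ofReal_mul (by positivity),
    ENNReal.ofReal_add w1 w2] at hk2
  rw [enorm_mul, enorm_mul, ← ofReal_norm, Complex.norm_real, Real.norm_eq_abs]
  refine (mul_le_mul' hk2 le_rfl).trans_eq ?_
  change _ = _ * (_ * ‖(_ : ℂ)‖ₑ * (_ * ‖(_ : ℂ)‖ₑ)); ring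

lemma Wt_meas (α : ℝ) : Measurable (Wt α) := by unfold Wt; fun_prop

lemma HalS_eq (α : ℝ) (f : 𝓢(V2, ℂ)) :
    HalS α f = N2 (fun ξ => ENNReal.ofReal (Wt α ξ) * ‖Ft f ξ‖₊) := by
  simp_rw [Ft_apply]; rfl

lemma N2_Ft (f : 𝓢(V2, ℂ)) :
    N2 (fun ξ => ‖Ft f ξ‖₊) = ENNReal.ofReal (2 * π) * N2 (fun ξ => ‖f ξ‖₊) := by
  rw [← N2_const_mul _ ENNReal.ofReal_ne_top, N2, N2, Ft_plancherel,
    ENNReal.ofReal_pow (by positivity)]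
  simp only [mul_pow (ENNReal.ofReal (2 * π))]
  rw [lintegral_const_mul' _ _ (ENNReal.pow_ne_top ENNReal.ofReal_ne_top)]

lemma nnn_meas (f : 𝓢(V2, ℂ)) : Measurable (fun x => (‖f x‖₊ : ℝ≥0∞)) :=
  (f.continuous.measurable).nnnorm.coe_nnreal_ennreal

/-- gradient size. -/
def Agr (α : ℝ) (G : Fin 2 → 𝓢(V2, ℂ)) : ℝ≥0∞ :=
  ∑ j, (N2 (fun ξ => ‖G j ξ‖₊) + N2 (fun ξ => ENNReal.ofReal (‖ξ‖ ^ α) * ‖ft2 (G j) ξ‖₊))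

lemma norm_le_coord (ξ : V2) : ‖ξ‖ ≤ ∑ j, |ξ j| := by
  rw [EuclideanSpace.norm_eq, Real.sqrt_le_left (by positivity)]
  simp only [Fin.sum_univ_two, Real.norm_eq_abs]
  nlinarith [abs_nonneg (ξ 0), abs_nonneg (ξ 1)]

lemma B_bound (α : ℝ) (h0 : 0 < α) (v : 𝓢(V2, ℂ)) (G : Fin 2 → 𝓢(V2, ℂ))
    (hG : ∀ j x, G j x = pd2 j v x) :
    N2 (fun ζ => ENNReal.ofReal (‖ζ‖ + ‖ζ‖ ^ (1 + α)) * ‖Ft v ζ‖₊) ≤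
      ENNReal.ofReal (2 * π) * Agr α G := by
  have hm := fun j => nnn_meas (Ft (G j))
  have hpt : ∀ ζ : V2, ENNReal.ofReal (‖ζ‖ + ‖ζ‖ ^ (1 + α)) * (‖Ft v ζ‖₊ : ℝ≥0∞) ≤
      ((‖Ft (G 0) ζ‖₊ : ℝ≥0∞) + ENNReal.ofReal (‖ζ‖ ^ α) * ‖Ft (G 0) ζ‖₊) +
      (‖Ft (G 1) ζ‖₊ + ENNReal.ofReal (‖ζ‖ ^ α) * ‖Ft (G 1) ζ‖₊) := by
    intro ζ
    have hj : ∀ j, (‖Ft (G j) ζ‖₊ : ℝ≥0∞) = ENNReal.ofReal (|ζ j| * ‖Ft v ζ‖) := by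
      intro j
      rw [Ft_deriv v (G j) j (hG j)]
      change ‖(_ : ℂ)‖ₑ = _
      rw [← ofReal_norm]; simp
    have hv : (‖Ft v ζ‖₊ : ℝ≥0∞) = ENNReal.ofReal ‖Ft v ζ‖ := (ofReal_norm _).symm
    rw [hj, hj, hv]
    rw [← ENNReal.ofReal_mul (by positivity), ← ENNReal.ofReal_mul (by positivity),
      ← ENNReal.ofReal_mul (by positivity), ← ENNReal.ofReal_add (by positivity) (by positivity),
      ← ENNReal.ofReal_add (by positivity) (by positivity),
      ← ENNReal.ofReal_add (by positivity) (by positivity)]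
    apply ENNReal.ofReal_le_ofReal
    have := norm_le_coord ζ
    rw [Fin.sum_univ_two] at this
    have e : ‖ζ‖ + ‖ζ‖ ^ (1 + α) = ‖ζ‖ * (1 + ‖ζ‖ ^ α) := by
      rw [Real.rpow_add_of_nonneg (norm_nonneg _) zero_le_one h0.le, Real.rpow_one]; ring
    rw [e]
    calc _ ≤ (|ζ 0| + |ζ 1|) * (1 + ‖ζ‖ ^ α) * ‖Ft v ζ‖ := by gcongr
      _ = _ := by ring
  refine (N2_mono hpt).trans ?_
  refine (N2_add (by fun_prop) (by fun_prop)).trans ?_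
  have h2 : ∀ j, N2 (fun ζ => (‖Ft (G j) ζ‖₊ : ℝ≥0∞) + ENNReal.ofReal (‖ζ‖ ^ α) * ‖Ft (G j) ζ‖₊) ≤
      ENNReal.ofReal (2 * π) * (N2 (fun ξ => ‖G j ξ‖₊) +
        N2 (fun ξ => ENNReal.ofReal (‖ξ‖ ^ α) * ‖ft2 (G j) ξ‖₊)) := by
    intro j
    refine (N2_add (by fun_prop) (by fun_prop)).trans ?_
    rw [N2_Ft, mul_add]
    gcongr
    simp_rw [Ft_apply]
    refine le_mul_of_one_le_left (by simp) ?_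
    rw [ENNReal.one_le_ofReal]
    linarith [Real.pi_gt_three]
  rw [Agr, Fin.sum_univ_two, mul_add]
  gcongr
  · exact h2 0
  · exact h2 1

lemma prod_schwartz (α : ℝ) (h0 : 0 < α) (h1 : α < 1) (c : ℂ) (v f P : 𝓢(V2, ℂ))
    (G : Fin 2 → 𝓢(V2, ℂ)) (hG : ∀ j x, G j x = pd2 j v x) (hb : ∀ x, ‖c + v x‖ ≤ 1)
    (hP : ∀ x, P x = (c + v x) * f x) :
    HalS α P ≤ (1 + 2 * N2 (fun x : V2 => ENNReal.ofReal (wf α ‖x‖)) * Agr α G) * HalS α f := by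
  obtain ⟨p, hp'⟩ := Ft_surj (SchwartzMap.smulLeftCLM ℂ (Wt α) (Ft f))
  have hp : ∀ ξ, Ft p ξ = Wt α ξ * Ft f ξ := by
    intro ξ; rw [hp', SchwartzMap.smulLeftCLM_apply_apply (Wt_temp α)]; simp
  set vf := SchwartzMap.pairing (ContinuousLinearMap.mul ℂ ℂ) v f with hvf
  set vp := SchwartzMap.pairing (ContinuousLinearMap.mul ℂ ℂ) v p with hvp
  have hPe : P = c • f + vf := by ext x; simp [hP, hvf, add_mul]
  set Q := c • p + vp with hQ
  have hQe : ∀ x, Q x = (c + v x) * p x := by intro x; simp [hQ, hvp, add_mul]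
  have hpt : ∀ ξ, ENNReal.ofReal (Wt α ξ) * (‖Ft P ξ‖₊ : ℝ≥0∞) ≤
      ‖Ft Q ξ‖₊ + (‖Wt α ξ * Ft vf ξ - Ft vp ξ‖₊ : ℝ≥0∞) := by
    intro ξ
    have e : Wt α ξ * Ft P ξ = Ft Q ξ + (Wt α ξ * Ft vf ξ - Ft vp ξ) := by
      rw [hPe, hQ]; simp only [Ft_add, Ft_smul, add_apply, smul_apply, hp, smul_eq_mul]
      ring
    have e2 : ENNReal.ofReal (Wt α ξ) * (‖Ft P ξ‖₊ : ℝ≥0∞) = ‖Wt α ξ * Ft P ξ‖ₑ := by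
      rw [enorm_mul, ← ofReal_norm, Complex.norm_real, Real.norm_of_nonneg (Wt_pos _ _).le]; rfl
    rw [e2, e]
    exact enorm_add_le _ _
  have hW := Wt_meas α
  have hwm := wf_meas α
  have hm := nnn_meas (Ft v)
  have hmf := nnn_meas (Ft f)
  have hmm : Measurable fun ξ => (‖Wt α ξ * Ft vf ξ - Ft vp ξ‖₊ : ℝ≥0∞) := by
    have a1 := (Ft vf).continuous.measurable
    have a2 := (Ft vp).continuous.measurable
    fun_prop
  rw [HalS_eq]
  refine (N2_mono hpt).trans ((N2_add (nnn_meas _) hmm).trans ?_)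
  rw [add_mul, one_mul]
  gcongr
  · rw [N2_Ft, HalS_eq]
    calc _ ≤ ENNReal.ofReal (2 * π) * N2 (fun ξ => ‖p ξ‖₊) := by
          gcongr
          apply N2_mono
          intro x
          rw [hQe]
          have : ‖(c + v x) * p x‖ ≤ ‖p x‖ := by
            rw [norm_mul]; exact mul_le_of_le_one_left (norm_nonneg _) (hb x)
          exact_mod_cast this
      _ = N2 (fun ξ => ‖Ft p ξ‖₊) := (N2_Ft p).symm
      _ ≤ _ := by
          apply N2_mono
          intro ξ
          rw [hp]
          change ‖(_ : ℂ)‖ₑ ≤ _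
          rw [enorm_mul, ← ofReal_norm, Complex.norm_real, Real.norm_of_nonneg (Wt_pos _ _).le]; rfl
  · refine (N2_mono (comm_bound α h0 h1 v f p vf vp (fun x => by simp [hvf])
      (fun x => by simp [hvp]) hp)).trans ?_
    rw [N2_const_mul _ (by simp)]
    have hcb := conv_bound (w := fun ζ => ENNReal.ofReal (wf α ‖ζ‖))
      (B := fun ζ => ENNReal.ofReal (‖ζ‖ + ‖ζ‖ ^ (1 + α)) * ‖Ft v ζ‖₊)
      (F := fun ζ => ENNReal.ofReal (Wt α ζ) * ‖Ft f ζ‖₊) (by fun_prop) (by fun_prop) (by fun_prop)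
    rw [← HalS_eq] at hcb
    calc _ ≤ ENNReal.ofReal (((2 * π) ^ 2)⁻¹) *
          (2 * N2 (fun ζ : V2 => ENNReal.ofReal (wf α ‖ζ‖)) *
            ((ENNReal.ofReal (2 * π) * Agr α G) * HalS α f)) := by
          gcongr
          refine hcb.trans ?_
          gcongr
          exact B_bound α h0 v G hG
      _ = (ENNReal.ofReal (((2 * π) ^ 2)⁻¹) * ENNReal.ofReal (2 * π)) *
          (2 * N2 (fun ζ : V2 => ENNReal.ofReal (wf α ‖ζ‖)) * Agr α G * HalS α f) := by ring
      _ ≤ 1 * _ := by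
          gcongr
          rw [← ENNReal.ofReal_mul (by positivity), ENNReal.ofReal_le_one]
          have : 1 ≤ 2 * π := by linarith [Real.pi_gt_three]
          rw [pow_two, mul_inv, mul_assoc, inv_mul_cancel₀ (by positivity), mul_one]
          exact inv_le_one_of_one_le₀ this
      _ = _ := by rw [one_mul]

open Filter Topology in
lemma half_decay (u : V2 → ℂ) (hu : Differentiable ℝ u) (D : 𝓢(V2, V2 →L[ℝ] ℂ))
    (hD : ∀ x, D x = fderiv ℝ u x) (e : V2) (he : ‖e‖ = 1) :
    ∃ c : ℂ, ∀ k : ℕ, ∃ C : ℝ, ∀ x : V2, 0 ≤ ⟪x, e⟫ → ‖x‖ ^ k * ‖u x - c‖ ≤ C := by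
  have hnorm : ∀ x : V2, 0 ≤ ⟪x, e⟫ → ∀ t : ℝ, 0 ≤ t →
      ‖x‖ ^ 2 ≤ ‖x + t • e‖ ^ 2 ∧ t ^ 2 ≤ ‖x + t • e‖ ^ 2 := by
    intro x hx t ht
    have : ‖x + t • e‖ ^ 2 = ‖x‖ ^ 2 + 2 * (t * ⟪x, e⟫) + t ^ 2 := by
      rw [norm_add_sq_real, inner_smul_right, norm_smul, he, Real.norm_of_nonneg ht, mul_one]
    have h2 : 0 ≤ t * ⟪x, e⟫ := by positivity
    constructor <;> nlinarith [sq_nonneg t, sq_nonneg ‖x‖]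
  have hdec : ∀ k : ℕ, ∃ C : ℝ, ∀ x : V2, 0 ≤ ⟪x, e⟫ → ∀ t : ℝ, 0 ≤ t →
      ‖x‖ ^ k * ‖fderiv ℝ u (x + t • e)‖ ≤ C * (1 / (1 + t ^ 2)) := by
    intro k
    refine ⟨SchwartzMap.seminorm ℝ k 0 D + SchwartzMap.seminorm ℝ (k + 2) 0 D, fun x hx t ht => ?_⟩
    obtain ⟨h1, h2⟩ := hnorm x hx t ht
    set y := x + t • e
    have h3 := SchwartzMap.norm_pow_mul_le_seminorm ℝ D k y
    have h4 := SchwartzMap.norm_pow_mul_le_seminorm ℝ D (k + 2) y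
    rw [hD] at h3 h4
    have h5 : ‖x‖ ≤ ‖y‖ := le_of_sq_le_sq h1 (norm_nonneg _)
    rw [mul_one_div, le_div_iff₀ (by positivity)]
    calc ‖x‖ ^ k * ‖fderiv ℝ u y‖ * (1 + t ^ 2) ≤ ‖y‖ ^ k * ‖fderiv ℝ u y‖ * (1 + ‖y‖ ^ 2) := by
          gcongr
      _ = ‖y‖ ^ k * ‖fderiv ℝ u y‖ + ‖y‖ ^ (k + 2) * ‖fderiv ℝ u y‖ := by ring
      _ ≤ _ := add_le_add h3 h4
  have hder : ∀ x : V2, ∀ t : ℝ, HasDerivAt (fun t : ℝ => u (x + t • e)) (fderiv ℝ u (x + t • e) e) t := by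
    intro x t
    have h1 : HasDerivAt (fun t : ℝ => x + t • e) e t := by
      simpa using ((hasDerivAt_id t).smul_const e).const_add x
    exact (hu _).hasFDerivAt.comp_hasDerivAt t h1
  have hn : ∀ y, ‖fderiv ℝ u y e‖ ≤ ‖fderiv ℝ u y‖ := by
    intro y; simpa [he] using (fderiv ℝ u y).le_opNorm e
  obtain ⟨C0, hC0⟩ := hdec 0
  have hlim0 : Tendsto (fun t : ℝ => u ((0 : V2) + t • e)) atTop
      (𝓝 (limUnder atTop fun t : ℝ => u ((0 : V2) + t • e))) := by
    refine tendsto_limUnder_of_hasDerivAt_of_integrableOn_Ioi (a := 0) (fun t _ => hder 0 t) ?_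
    have hi : Integrable (fun t : ℝ => C0 * (1 / (1 + t ^ 2))) := by
      simpa using integrable_inv_one_add_sq.const_mul C0
    refine Integrable.mono' hi.integrableOn ?_ ?_
    · have : Continuous fun t : ℝ => D ((0 : V2) + t • e) e :=
        (D.continuous.comp (by fun_prop)).clm_apply continuous_const
      simp_rw [hD] at this
      exact this.aestronglyMeasurable
    · refine (ae_restrict_iff' measurableSet_Ioi).2 (Eventually.of_forall fun t ht => ?_)
      refine (hn _).trans ?_
      simpa using hC0 0 (by simp) t (le_of_lt ht)
  set c := limUnder atTop fun t : ℝ => u ((0 : V2) + t • e)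
  have htend : Tendsto (fun t : ℝ => C0 * (1 / (1 + t ^ 2))) atTop (𝓝 0) := by
    have : Tendsto (fun t : ℝ => 1 + t ^ 2) atTop atTop :=
      tendsto_atTop_add_const_left _ _ (tendsto_pow_atTop (by norm_num))
    simpa using (this.inv_tendsto_atTop).const_mul C0
  have hlim : ∀ x : V2, 0 ≤ ⟪x, e⟫ → Tendsto (fun t : ℝ => u (x + t • e)) atTop (𝓝 c) := by
    intro x hx
    have hd : Tendsto (fun t : ℝ => u (x + t • e) - u ((0 : V2) + t • e)) atTop (𝓝 0) := by
      apply squeeze_zero_norm' (a := fun t : ℝ => C0 * (1 / (1 + t ^ 2)) * ‖x‖)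
      · filter_upwards [eventually_ge_atTop 0] with t ht
        have := (convex_segment (𝕜 := ℝ) ((0 : V2) + t • e) (x + t • e)).norm_image_sub_le_of_norm_fderiv_le
          (f := u) (𝕜 := ℝ) (C := C0 * (1 / (1 + t ^ 2))) (fun y _ => hu y) ?_
          (left_mem_segment _ _ _) (right_mem_segment _ _ _)
        · simpa using this
        · intro y hy
          rw [segment_eq_image'] at hy
          obtain ⟨s, hs, rfl⟩ := hy
          have := hC0 (s • x) (by rw [real_inner_smul_left]; exact mul_nonneg hs.1 hx) t ht
          rw [pow_zero, one_mul] at this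
          have hy : (0 : V2) + t • e + s • (x + t • e - ((0 : V2) + t • e)) = s • x + t • e := by
            simp [add_comm]
          beta_reduce
          rw [hy]
          exact this
      · simpa using htend.mul_const ‖x‖
    simpa using hd.add hlim0
  refine ⟨c, fun k => ?_⟩
  obtain ⟨C, hC⟩ := hdec k
  refine ⟨|C| * (π / 2), fun x hx => ?_⟩
  have hb : ∀ t : ℝ, 0 ≤ t → ‖x‖ ^ k * ‖u x - u (x + t • e)‖ ≤ |C| * (π / 2) := by
    intro t ht
    have hds : ∀ s : ℝ, HasDerivAt (fun t : ℝ => (‖x‖ ^ k : ℝ) • (u (x + t • e) - u x))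
        ((‖x‖ ^ k : ℝ) • (fderiv ℝ u (x + s • e) e)) s :=
      fun s => ((hder x s).sub_const (u x)).fun_const_smul (‖x‖ ^ k : ℝ)
    have := image_norm_le_of_norm_deriv_right_le_deriv_boundary (a := 0) (b := t)
      (f := fun t : ℝ => (‖x‖ ^ k : ℝ) • (u (x + t • e) - u x))
      (f' := fun t : ℝ => (‖x‖ ^ k : ℝ) • (fderiv ℝ u (x + t • e) e))
      (B := fun t => C * Real.arctan t) (B' := fun t => C * (1 / (1 + t ^ 2)))
      (fun s _ => (hds s).continuousAt.continuousWithinAt)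
      (fun s _ => (hds s).hasDerivWithinAt)
      (by simp) (fun s => (Real.hasDerivAt_arctan s).const_mul C)
      (fun s hs => by
        rw [norm_smul, Real.norm_of_nonneg (by positivity)]
        refine le_trans ?_ (hC x hx s hs.1)
        gcongr
        exact hn _) (Set.right_mem_Icc.2 ht)
    rw [norm_smul, Real.norm_of_nonneg (by positivity), norm_sub_rev] at this
    refine this.trans ?_
    have ha : 0 ≤ Real.arctan t := Real.arctan_nonneg.2 ht
    calc C * Real.arctan t ≤ |C| * Real.arctan t := by gcongr; exact le_abs_self C
      _ ≤ _ := by gcongr; exact (Real.arctan_lt_pi_div_two t).le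
  have hl : Tendsto (fun t : ℝ => ‖x‖ ^ k * ‖u x - u (x + t • e)‖) atTop (𝓝 (‖x‖ ^ k * ‖u x - c‖)) :=
    (((tendsto_const_nhds).sub (hlim x hx)).norm).const_mul _
  exact le_of_tendsto hl (by filter_upwards [eventually_ge_atTop 0] with t ht using hb t ht)

lemma exists_schwartz (u : V2 → ℂ) (hu : ContDiff ℝ (⊤ : ℕ∞) u) (G : Fin 2 → 𝓢(V2, ℂ))
    (hG : ∀ j x, pd2 j u x = G j x) : ∃ (c : ℂ) (v : 𝓢(V2, ℂ)), ∀ x, u x = c + v x := by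
  have hd : Differentiable ℝ u := hu.differentiable (by simp)
  let D : 𝓢(V2, V2 →L[ℝ] ℂ) := ∑ j, SchwartzMap.postcompCLM
    (ContinuousLinearMap.smulRightL ℝ V2 ℂ (EuclideanSpace.proj j : V2 →L[ℝ] ℝ)) (G j)
  have hD : ∀ x, D x = fderiv ℝ u x := by
    intro x
    ext y
    have hy : y = y 0 • EuclideanSpace.single (0 : Fin 2) (1:ℝ) +
        y 1 • EuclideanSpace.single (1 : Fin 2) (1:ℝ) := by
      ext i; fin_cases i <;> simp
    have h2 : fderiv ℝ u x y = y 0 • G 0 x + y 1 • G 1 x := by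
      conv_lhs => rw [hy]
      rw [map_add, map_smul, map_smul, ← hG, ← hG]; rfl
    rw [h2]
    simp [D, Fin.sum_univ_two]
  set e : V2 := EuclideanSpace.single 0 1
  have he : ‖e‖ = 1 := by simp [e]
  obtain ⟨c, hc⟩ := half_decay u hd D hD e he
  obtain ⟨c', hc'⟩ := half_decay u hd D hD (-e) (by rw [norm_neg, he])
  have hcc : c = c' := by
    obtain ⟨C, hC⟩ := hc 1
    obtain ⟨C', hC'⟩ := hc' 1
    by_contra hne
    have hpos : 0 < ‖c - c'‖ := norm_pos_iff.2 (sub_ne_zero.2 hne)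
    obtain ⟨s, hs⟩ := exists_gt (max 0 ((C + C') / ‖c - c'‖))
    have hs0 : 0 < s := (le_max_left _ _).trans_lt hs
    have hs1 := (le_max_right _ _).trans_lt hs
    rw [div_lt_iff₀ hpos] at hs1
    have a1 := hC (EuclideanSpace.single 1 s) (by simp [e, EuclideanSpace.inner_single_left])
    have a2 := hC' (EuclideanSpace.single 1 s) (by simp [e, EuclideanSpace.inner_single_left])
    simp only [PiLp.norm_single, Real.norm_of_nonneg hs0.le, pow_one] at a1 a2
    set z := u (EuclideanSpace.single 1 s)
    have h3 : ‖c - c'‖ ≤ ‖z - c‖ + ‖z - c'‖ := by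
      have := norm_sub_le (z - c') (z - c)
      rw [show z - c' - (z - c) = c - c' by ring] at this
      linarith
    nlinarith
  subst hcc
  refine ⟨c, ⟨fun x => u x - c, hu.sub contDiff_const, fun k m => ?_⟩, fun x => by
    change u x = c + (u x - c); ring⟩
  rcases m with _ | m
  · obtain ⟨C, hC⟩ := hc k
    obtain ⟨C', hC'⟩ := hc' k
    refine ⟨max C C', fun x => ?_⟩
    rw [norm_iteratedFDeriv_zero]
    rcases le_total 0 ⟪x, e⟫ with h | h
    · exact (hC x h).trans (le_max_left _ _)
    · exact (hC' x (by rw [inner_neg_right]; linarith)).trans (le_max_right _ _)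
  · obtain ⟨C, hC⟩ := D.decay' k m
    refine ⟨C, fun x => ?_⟩
    rw [← norm_iteratedFDeriv_fderiv]
    have : fderiv ℝ (fun x => u x - c) = D := by
      ext1 x; rw [hD, fderiv_sub_const]
    rw [this]
    exact hC x

lemma prod_main (α : ℝ) (h0 : 0 < α) (h1 : α < 1) (u : V2 → ℂ) (hu : ContDiff ℝ (⊤ : ℕ∞) u)
    (G : Fin 2 → 𝓢(V2, ℂ)) (hG : ∀ j x, pd2 j u x = G j x) (hb : ∀ x, ‖u x‖ ≤ 1) (f : 𝓢(V2, ℂ)) :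
    ∃ P : 𝓢(V2, ℂ), (∀ x, P x = u x * f x) ∧
      HalS α P ≤ (1 + 2 * N2 (fun x : V2 => ENNReal.ofReal (wf α ‖x‖)) * Agr α G) * HalS α f := by
  obtain ⟨c, v, hv⟩ := exists_schwartz u hu G hG
  refine ⟨c • f + SchwartzMap.pairing (ContinuousLinearMap.mul ℂ ℂ) v f, fun x => ?_, ?_⟩
  · simp [hv, add_mul]
  · refine prod_schwartz α h0 h1 c v f _ G (fun j x => ?_) (fun x => by rw [← hv]; exact hb x)
      (fun x => by simp [add_mul])
    rw [← hG, pd2, pd2]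
    have : u = fun x => c + v x := funext hv
    rw [this, fderiv_const_add]

/-- `F` is a Schwartz function of Sobolev size at most `B`. -/
def HS (α : ℝ) (F : V2 → ℂ) (B : ℝ≥0∞) : Prop :=
  ∃ P : 𝓢(V2, ℂ), (∀ x, P x = F x) ∧ HalS α P ≤ B

lemma HS_le {α : ℝ} {F : V2 → ℂ} {B : ℝ≥0∞} (h : HS α F B) : HalS α F ≤ B := by
  obtain ⟨P, hP, hB⟩ := h
  rwa [funext hP] at hB

lemma HS_add {α : ℝ} {F F' : V2 → ℂ} {B B' : ℝ≥0∞} (h : HS α F B) (h' : HS α F' B') :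
    HS α (fun x => F x + F' x) (B + B') := by
  obtain ⟨P, hP, hB⟩ := h
  obtain ⟨P', hP', hB'⟩ := h'
  refine ⟨P + P', fun x => by simp [hP, hP'], le_trans ?_ (add_le_add hB hB')⟩
  rw [HalS_eq, HalS_eq, HalS_eq]
  refine le_trans (N2_mono fun x => ?_) (N2_add ?_ ?_)
  · rw [Ft_add, ← mul_add]
    gcongr
    exact_mod_cast nnnorm_add_le _ _
  · exact (Wt_meas α).ennreal_ofReal.mul (nnn_meas _)
  · exact (Wt_meas α).ennreal_ofReal.mul (nnn_meas _)

lemma HS_zero {α : ℝ} : HS α (fun _ => 0) 0 := by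
  refine ⟨0, fun x => by simp, ?_⟩
  have h : Ft (0 : 𝓢(V2, ℂ)) = 0 := by simpa using Ft_smul 0 0
  rw [HalS_eq, h]
  simp [N2]

lemma HS_sum {α : ℝ} {ι : Type} (s : Finset ι) (F : ι → V2 → ℂ) (B : ι → ℝ≥0∞)
    (h : ∀ i, HS α (F i) (B i)) : HS α (fun x => ∑ i ∈ s, F i x) (∑ i ∈ s, B i) := by
  classical
  induction s using Finset.induction_on with
  | empty => simpa using HS_zero
  | insert a s ha ih =>
    simp only [Finset.sum_insert ha]
    exact HS_add (h a) ih

lemma HS_conj {α : ℝ} {F : V2 → ℂ} {B : ℝ≥0∞} (h : HS α F B) :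
    HS α (fun x => conj (F x)) B := by
  obtain ⟨P, hP, hB⟩ := h
  refine ⟨SchwartzMap.postcompCLM (𝕜 := ℝ) (Complex.conjCLE : ℂ →L[ℝ] ℂ) P,
    fun x => by simp [hP], ?_⟩
  have : (⇑(SchwartzMap.postcompCLM (𝕜 := ℝ) (Complex.conjCLE : ℂ →L[ℝ] ℂ) P) : V2 → ℂ)
      = fun x => conj (P x) := by
    ext x; simp
  rw [this, HalS_conj]
  exact hB

lemma HS_mul {α : ℝ} (h0 : 0 < α) (h1 : α < 1) {u : V2 → ℂ} (hu : ContDiff ℝ (⊤ : ℕ∞) u)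
    {G : Fin 2 → 𝓢(V2, ℂ)} (hG : ∀ j x, pd2 j u x = G j x) (hb : ∀ x, ‖u x‖ ≤ 1)
    {R : ℝ≥0∞} (hR : 1 + 2 * N2 (fun x : V2 => ENNReal.ofReal (wf α ‖x‖)) * Agr α G ≤ R)
    {F : V2 → ℂ} {B : ℝ≥0∞} (h : HS α F B) : HS α (fun x => u x * F x) (R * B) := by
  obtain ⟨P, hP, hB⟩ := h
  obtain ⟨Q, hQ, hQB⟩ := prod_main α h0 h1 u hu G hG hb P
  exact ⟨Q, fun x => by rw [hQ, hP], hQB.trans (mul_le_mul' hR hB)⟩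

lemma HS_mul_conj {α : ℝ} (h0 : 0 < α) (h1 : α < 1) {u : V2 → ℂ} (hu : ContDiff ℝ (⊤ : ℕ∞) u)
    {G : Fin 2 → 𝓢(V2, ℂ)} (hG : ∀ j x, pd2 j u x = G j x) (hb : ∀ x, ‖u x‖ ≤ 1)
    {R : ℝ≥0∞} (hR : 1 + 2 * N2 (fun x : V2 => ENNReal.ofReal (wf α ‖x‖)) * Agr α G ≤ R)
    {F : V2 → ℂ} {B : ℝ≥0∞} (h : HS α F B) : HS α (fun x => F x * conj (u x)) (R * B) := by
  have := HS_conj (HS_mul h0 h1 hu hG hb hR (HS_conj h))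
  simpa [mul_comm] using this

lemma HalS_G {α : ℝ} (h0 : 0 < α) (h1 : α < 1) (f : 𝓢(V2, ℂ)) :
    HalS α f ≤ ENNReal.ofReal (2 * π) * (N2 (fun ξ => ‖f ξ‖₊) +
      N2 (fun ξ => ENNReal.ofReal (‖ξ‖ ^ α) * ‖ft2 f ξ‖₊)) := by
  rw [HalS_eq, mul_add, ← N2_Ft]
  have hm : Measurable (fun ξ : V2 => ENNReal.ofReal (‖ξ‖ ^ α) * (‖Ft f ξ‖₊ : ℝ≥0∞)) := by
    refine Measurable.mul ?_ (nnn_meas _)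
    fun_prop
  refine (N2_mono (b := fun ξ => (‖Ft f ξ‖₊ : ℝ≥0∞) +
    ENNReal.ofReal (‖ξ‖ ^ α) * (‖Ft f ξ‖₊ : ℝ≥0∞)) fun ξ => ?_).trans
    ((N2_add (nnn_meas _) hm).trans ?_)
  · have h := Wt_sub_le α h0 h1 ξ 0
    have h' : Wt α ξ ≤ 1 + ‖ξ‖ ^ α := by simpa [Wt] using h
    calc ENNReal.ofReal (Wt α ξ) * (‖Ft f ξ‖₊ : ℝ≥0∞)
        ≤ ENNReal.ofReal (1 + ‖ξ‖ ^ α) * (‖Ft f ξ‖₊ : ℝ≥0∞) := by gcongr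
      _ = _ := by
        rw [ENNReal.ofReal_add (by norm_num) (by positivity), add_mul]; simp
  · gcongr
    simp_rw [Ft_apply]
    refine le_mul_of_one_le_left zero_le ?_
    rw [ENNReal.one_le_ofReal]
    linarith [Real.pi_gt_three]

lemma N2_gradL2 {n : ℕ} (g : V2 → Matrix (Fin n) (Fin n) ℂ) (i k : Fin n) (j : Fin 2) :
    N2 (fun x => ‖pd2 j (fun y => g y i k) x‖₊) ≤ gradL2 g := by
  unfold N2 gradL2
  gcongr with x
  refine le_trans ?_ (Finset.single_le_sum (fun _ _ => zero_le) (Finset.mem_univ j))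
  refine le_trans ?_ (Finset.single_le_sum (fun _ _ => zero_le) (Finset.mem_univ i))
  exact Finset.single_le_sum (f := fun k => (‖pd2 j (fun y => g y i k) x‖₊ : ℝ≥0∞) ^ (2 : ℕ))
    (fun _ _ => zero_le) (Finset.mem_univ k)

lemma N2_DalGradL2 {n : ℕ} (α : ℝ) (g : V2 → Matrix (Fin n) (Fin n) ℂ) (i k : Fin n) (j : Fin 2) :
    N2 (fun ξ => ENNReal.ofReal (‖ξ‖ ^ α) * ‖ft2 (pd2 j (fun y => g y i k)) ξ‖₊)
      ≤ DalGradL2 α g := by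
  unfold N2 DalGradL2
  gcongr with x
  refine le_trans ?_ (Finset.single_le_sum (fun _ _ => zero_le) (Finset.mem_univ j))
  refine le_trans ?_ (Finset.single_le_sum (fun _ _ => zero_le) (Finset.mem_univ i))
  exact Finset.single_le_sum (f := fun k => (ENNReal.ofReal (‖x‖ ^ α) *
    (‖ft2 (pd2 j (fun y => g y i k)) x‖₊ : ℝ≥0∞)) ^ (2 : ℕ))
    (fun _ _ => zero_le) (Finset.mem_univ k)

lemma one_le_supM {n : ℕ} (hn : 1 ≤ n) (g : V2 → Matrix (Fin n) (Fin n) ℂ)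
    (hg : ∀ x, g x ∈ Matrix.unitaryGroup (Fin n) ℂ) : 1 ≤ supM g := by
  unfold supM
  refine le_trans ?_ (le_iSup _ (0 : V2))
  apply ENNReal.one_le_rpow _ (by norm_num)
  refine le_trans ?_ (Finset.single_le_sum (fun _ _ => zero_le) (Finset.mem_univ (⟨0, hn⟩ : Fin n)))
  have h := Matrix.mem_unitaryGroup_iff.1 (hg 0)
  have h2 := congrFun (congrFun h ⟨0, hn⟩) ⟨0, hn⟩
  rw [Matrix.mul_apply, Matrix.one_apply_eq] at h2
  simp only [Matrix.star_apply, RCLike.star_def, Complex.mul_conj] at h2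
  have h3 : ∑ k, ‖g 0 ⟨0, hn⟩ k‖₊ ^ 2 = 1 := by
    rw [← NNReal.coe_inj]
    push_cast
    simp_rw [← Complex.normSq_eq_norm_sq]
    exact_mod_cast h2
  have h4 : ((∑ k, ‖g 0 ⟨0, hn⟩ k‖₊ ^ 2 : NNReal) : ℝ≥0∞) = 1 := by rw [h3]; rfl
  push_cast at h4
  exact h4.ge

lemma pd2_conj (j : Fin 2) (u : V2 → ℂ) (x : V2) :
    pd2 j (fun y => conj (u y)) x = conj (pd2 j u x) := by
  have := (Complex.conjCLE).comp_fderiv (f := u) (x := x)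
  have h2 : (fun y => conj (u y)) = (Complex.conjCLE : ℂ → ℂ) ∘ u := by ext y; simp
  rw [pd2, h2, this]
  simp [pd2]

theorem gauge_main (α : ℝ) (h0 : 0 < α) (h1 : α < 1)
    (n : ℕ) (hn : 1 ≤ n) (g : V2 → Matrix (Fin n) (Fin n) ℂ)
    (hs : ∀ i k, ContDiff ℝ (⊤ : ℕ∞) fun x => g x i k)
    (hg : ∀ x, g x ∈ Matrix.unitaryGroup (Fin n) ℂ)
    (hG : ∀ (i k : Fin n) (j : Fin 2), ∃ G : SchwartzMap V2 ℂ,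
          (fun x => pd2 j (fun y => g y i k) x) = ⇑G)
    (h : Fin n → Fin n → SchwartzMap V2 ℂ) (M : ℝ≥0∞)
    (hM : M = 1 + 4 * N2 (fun x : V2 => ENNReal.ofReal (wf α ‖x‖))) :
    (∑ j : Fin 2, HalM α (fun x =>
              g x * Matrix.of (fun i k => h i k x) * star (g x) +
                g x * Matrix.of (fun i k => pd2 j (fun y => star (g y) i k) x))) ≤
            (2 * n ^ 2 * (n ^ 2 * M ^ 2 + n * M * ENNReal.ofReal (2 * π))) *
              ((HalM α (fun x => Matrix.of fun i k => h i k x) + 1) *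
                (gradL2 g + DalGradL2 α g + supM g) ^ (2 : ℕ)) := by
  set K := gradL2 g + DalGradL2 α g + supM g with hK
  set H := HalM α (fun x => Matrix.of fun i k => h i k x) with hH
  have hK1 : 1 ≤ K := (one_le_supM hn g hg).trans le_add_self
  have hGK : gradL2 g + DalGradL2 α g ≤ K := le_self_add
  choose G hG using hG
  have hG' : ∀ i k j x, pd2 j (fun y => g y i k) x = G i k j x := fun i k j x => congrFun (hG i k j) x
  have hb : ∀ i k x, ‖g x i k‖ ≤ 1 := fun i k x => entry_norm_bound_of_unitary (hg x) i k
  have hGj : ∀ i k j, N2 (fun ξ => ‖G i k j ξ‖₊) +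
      N2 (fun ξ => ENNReal.ofReal (‖ξ‖ ^ α) * ‖ft2 (G i k j) ξ‖₊) ≤ K := by
    intro i k j
    refine le_trans ?_ hGK
    have a1 := N2_gradL2 g i k j
    have a2 := N2_DalGradL2 α g i k j
    simp_rw [hG'] at a1
    rw [show pd2 j (fun y => g y i k) = ⇑(G i k j) from hG i k j] at a2
    exact add_le_add a1 a2
  have hA : ∀ i k, Agr α (G i k) ≤ 2 * K := by
    intro i k
    rw [Agr, Fin.sum_univ_two, two_mul]
    exact add_le_add (hGj i k 0) (hGj i k 1)
  have hR : ∀ i k, 1 + 2 * N2 (fun x : V2 => ENNReal.ofReal (wf α ‖x‖)) * Agr α (G i k) ≤ M * K := by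
    intro i k
    rw [hM, add_mul, one_mul]
    refine add_le_add hK1 ?_
    calc _ ≤ 2 * N2 (fun x : V2 => ENNReal.ofReal (wf α ‖x‖)) * (2 * K) := by gcongr; exact hA i k
      _ = _ := by ring
  have hh : ∀ a b, HS α (h a b) H := by
    intro a b
    refine ⟨h a b, fun _ => rfl, ?_⟩
    rw [hH, HalM]
    refine le_trans ?_ (Finset.single_le_sum (fun _ _ => zero_le) (Finset.mem_univ a))
    exact Finset.single_le_sum (f := fun b => HalS α (fun x => Matrix.of (fun i k => h i k x) a b))
      (fun _ _ => zero_le) (Finset.mem_univ b)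
  have hGS : ∀ i k j, HS α (G i k j) (ENNReal.ofReal (2 * π) * K) := fun i k j =>
    ⟨G i k j, fun _ => rfl, (HalS_G h0 h1 _).trans (by gcongr; exact hGj i k j)⟩
  have hent : ∀ j i k, HalS α (fun x =>
      (g x * Matrix.of (fun i k => h i k x) * star (g x) +
        g x * Matrix.of (fun i k => pd2 j (fun y => star (g y) i k) x)) i k) ≤
      (n ^ 2 * M ^ 2 + n * M * ENNReal.ofReal (2 * π)) * ((H + 1) * K ^ 2) := by
    intro j i k
    have e1 : HS α (fun x => ∑ b, (∑ a, g x i a * h a b x) * conj (g x k b))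
        (∑ _b : Fin n, M * K * (∑ _a : Fin n, M * K * H)) :=
      HS_sum _ _ _ fun b => HS_mul_conj h0 h1 (hs k b) (hG' k b) (hb k b) (hR k b)
        (HS_sum _ _ _ fun a => HS_mul h0 h1 (hs i a) (hG' i a) (hb i a) (hR i a) (hh a b))
    have e2 : HS α (fun x => ∑ a, g x i a * conj (G k a j x))
        (∑ _a : Fin n, M * K * (ENNReal.ofReal (2 * π) * K)) :=
      HS_sum _ _ _ fun a => HS_mul h0 h1 (hs i a) (hG' i a) (hb i a) (hR i a) (HS_conj (hGS k a j))
    have e3 := HS_le (HS_add e1 e2)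
    have e4 : (fun x => (g x * Matrix.of (fun i k => h i k x) * star (g x) +
        g x * Matrix.of (fun i k => pd2 j (fun y => star (g y) i k) x)) i k) =
        fun x => (∑ b, (∑ a, g x i a * h a b x) * conj (g x k b)) +
          ∑ a, g x i a * conj (G k a j x) := by
      ext x
      simp only [Matrix.add_apply, Matrix.mul_apply, Matrix.of_apply, Matrix.star_apply,
        RCLike.star_def, pd2_conj, hG']
    rw [e4]
    refine e3.trans ?_
    simp only [Finset.sum_const, Finset.card_univ, Fintype.card_fin, nsmul_eq_mul]
    calc _ = n ^ 2 * M ^ 2 * (H * K ^ 2) + n * M * ENNReal.ofReal (2 * π) * (1 * K ^ 2) := by ring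
      _ ≤ n ^ 2 * M ^ 2 * ((H + 1) * K ^ 2) +
          n * M * ENNReal.ofReal (2 * π) * ((H + 1) * K ^ 2) := by
        gcongr
        · exact le_self_add
        · exact le_add_self
      _ = _ := by ring
  calc _ ≤ ∑ _j : Fin 2, ∑ _i : Fin n, ∑ _k : Fin n,
        (n ^ 2 * M ^ 2 + n * M * ENNReal.ofReal (2 * π)) * ((H + 1) * K ^ 2) :=
        Finset.sum_le_sum fun j _ => Finset.sum_le_sum fun i _ => Finset.sum_le_sum fun k _ =>
          hent j i k
    _ = _ := by
      simp only [Finset.sum_const, Finset.card_univ, Fintype.card_fin, nsmul_eq_mul]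
      push_cast
      ring

/-- Gauge action continuity (fixed-time version of Lemma 3.1): for `0 < α < 1`
and `n ≥ 1` there is a constant `C` such that for every smooth unitary-valued
`g : ℝ² → U(n)` whose gradient is Schwartz, and every Schwartz `h : ℝ² → Mₙ(ℂ)`,
the gauge-transformed field `h_g = g h g⁻¹ + g ∂ⱼ(g⁻¹)` (both spatial components
measured and summed) satisfies `‖h_g‖_{H^α} ≤ C (‖h‖_{H^α} + 1) K²`, where
`K = ‖∇g‖_{L²} + ‖D^α∇g‖_{L²} + sup_x ‖g(x)‖` and `g⁻¹ = g*`. -/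
theorem gauge_action_estimate (α : ℝ) (hα1 : 0 < α) (hα2 : α < 1)
    (n : ℕ) (hn : 1 ≤ n) :
    ∃ C : ℝ, 0 < C ∧
      ∀ g : V2 → Matrix (Fin n) (Fin n) ℂ,
        (∀ i k, ContDiff ℝ (⊤ : ℕ∞) fun x => g x i k) →
        (∀ x, g x ∈ Matrix.unitaryGroup (Fin n) ℂ) →
        (∀ (i k : Fin n) (j : Fin 2), ∃ G : SchwartzMap V2 ℂ,
          (fun x => pd2 j (fun y => g y i k) x) = ⇑G) →
        ∀ h : Fin n → Fin n → SchwartzMap V2 ℂ,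
          (∑ j : Fin 2, HalM α (fun x =>
              g x * Matrix.of (fun i k => h i k x) * star (g x) +
                g x * Matrix.of (fun i k => pd2 j (fun y => star (g y) i k) x))) ≤
            ENNReal.ofReal C *
              ((HalM α (fun x => Matrix.of fun i k => h i k x) + 1) *
                (gradL2 g + DalGradL2 α g + supM g) ^ (2 : ℕ)) := by
  set M : ℝ≥0∞ := 1 + 4 * N2 (fun x : V2 => ENNReal.ofReal (wf α ‖x‖)) with hM
  have hMt : M ≠ ⊤ :=
    ENNReal.add_ne_top.2 ⟨ENNReal.one_ne_top, ENNReal.mul_ne_top (by simp) (wf_int α hα1)⟩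
  set D : ℝ≥0∞ := 2 * n ^ 2 * (n ^ 2 * M ^ 2 + n * M * ENNReal.ofReal (2 * π)) with hD
  have hDt : D ≠ ⊤ := by
    have h1 : (n : ℝ≥0∞) ≠ ⊤ := ENNReal.natCast_ne_top n
    refine ENNReal.mul_ne_top (ENNReal.mul_ne_top (by simp) (ENNReal.pow_ne_top h1))
      (ENNReal.add_ne_top.2 ⟨ENNReal.mul_ne_top (ENNReal.pow_ne_top h1) (ENNReal.pow_ne_top hMt),
        ENNReal.mul_ne_top (ENNReal.mul_ne_top h1 hMt) ENNReal.ofReal_ne_top⟩)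
  refine ⟨D.toReal + 1, by positivity, fun g hs hg hG h => ?_⟩
  refine (gauge_main α hα1 hα2 n hn g hs hg hG h M hM).trans ?_
  rw [← hD]
  gcongr
  rw [ENNReal.ofReal_add ENNReal.toReal_nonneg zero_le_one, ENNReal.ofReal_toReal hDt]
  exact le_self_add
end
end

section
/- Let n ≥ 1, 0 < s < 1/2, θ > 1/2, and 0 < a ≤ 2s. Then there exist ε₀ > 0 and C such that: if A_0, f, φ are Schwartz M_n(ℂ)-valued functions on ℝ^{1+2} satisfying △A_0 = −∂_1[A_0,∂_2 f] + ∂_2[A_0,∂_1 f] + ∂_1[∂_1 f,φ] + ∂_2[∂_2 f,φ] pointwise and ‖∇f‖_{H^{s,θ}} ≤ ε₀, then sup_{t∈ℝ} ‖A_0(t,·)‖_{Ḣ^a(ℝ²)} ≤ C·‖φ‖_{H^{s,θ}}·‖∇f‖_{H^{s,θ}}, where ‖g‖_{Ḣ^a(ℝ²)} = ‖|ξ|^a ĝ(ξ)‖_{L²_ξ}. -/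
noncomputable section

open MeasureTheory Real
open scoped ENNReal RealInnerProductSpace

/-- Space-time Fourier transform on `ℝ^{1+2}`, convention `e^{-i(tτ + x·ξ)}`. -/
def ftST (u : ℝ × V2 → ℂ) (τ : ℝ) (ξ : V2) : ℂ :=
  ∫ p : ℝ × V2, Complex.exp (-Complex.I * ((p.1 * τ + ⟪p.2, ξ⟫ : ℝ) : ℂ)) * u p

/-- The weight `(1+|ξ|²)^{s/2} (1+||τ|-|ξ||)^θ`. -/
def wgt (s θ τ : ℝ) (ξ : V2) : ℝ :=
  (1 + ‖ξ‖ ^ 2) ^ (s / 2) * (1 + |(|τ| - ‖ξ‖)|) ^ θ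

/-- The Wave–Sobolev norm `H^{s,θ}` on `ℝ^{1+2}`. -/
def HN (s θ : ℝ) (u : ℝ × V2 → ℂ) : ℝ≥0∞ :=
  (∫⁻ q : ℝ × V2, (ENNReal.ofReal (wgt s θ q.1 q.2) * (‖ftST u q.1 q.2‖₊ : ℝ≥0∞)) ^ (2 : ℕ)) ^
    ((1 : ℝ) / 2)

/-- Time derivative `∂ₜ u`. -/
def dtime (u : ℝ × V2 → ℂ) : ℝ × V2 → ℂ :=
  fun p => fderiv ℝ u p ((1 : ℝ), (0 : V2))

/-- The norm of `𝓗^{s,θ}`: `‖u‖_{H^{s,θ}} + ‖∂ₜu‖_{H^{s-1,θ}}`. -/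
def HHN (s θ : ℝ) (u : ℝ × V2 → ℂ) : ℝ≥0∞ :=
  HN s θ u + HN (s - 1) θ (dtime u)

/-- Spatial partial derivative `∂ⱼ u`, `j = 0, 1`. -/
def pdx (j : Fin 2) (u : ℝ × V2 → ℂ) : ℝ × V2 → ℂ :=
  fun p => fderiv ℝ u p ((0 : ℝ), EuclideanSpace.single j 1)

/-- Inverse space-time Fourier transform. -/
def iftST (F : ℝ → V2 → ℂ) (t : ℝ) (x : V2) : ℂ :=
  ((((2 * π) ^ 3)⁻¹ : ℝ) : ℂ) *
    ∫ q : ℝ × V2, Complex.exp (Complex.I * ((t * q.1 + ⟪x, q.2⟫ : ℝ) : ℂ)) * F q.1 q.2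

/-- The space-time Fourier multiplier with symbol `m`. -/
def mult (m : ℝ → V2 → ℂ) (u : ℝ × V2 → ℂ) : ℝ × V2 → ℂ :=
  fun p => iftST (fun τ ξ => m τ ξ * ftST u τ ξ) p.1 p.2

/-- The spatial Fourier multiplier `D_x^a` with symbol `|ξ|^a`, acting on functions
on space-time for each fixed time. -/
def DxA (a : ℝ) (u : ℝ × V2 → ℂ) : ℝ × V2 → ℂ :=
  fun p => ift2 (fun ξ => ((‖ξ‖ ^ a : ℝ) : ℂ) * ft2 (fun y => u (p.1, y)) ξ) p.2

/-- Entrywise coercion of a Schwartz matrix-valued function to a matrix of functions. -/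
def cF {n : ℕ} (A : Fin n → Fin n → SchwartzMap (ℝ × V2) ℂ) :
    Fin n → Fin n → (ℝ × V2 → ℂ) :=
  fun i k => ⇑(A i k)

/-- Entrywise commutator `[U,V] = UV - VU` of matrix-valued functions. -/
def mcomm {n : ℕ} (U V : Fin n → Fin n → (ℝ × V2 → ℂ)) (i k : Fin n) :
    ℝ × V2 → ℂ :=
  fun p => (∑ l, U i l p * V l k p) - ∑ l, V i l p * U l k p

/-- The matrix `∂ⱼ f` of spatial partial derivatives of a Schwartz matrix-valued map. -/
def pdf {n : ℕ} (j : Fin 2) (f : Fin n → Fin n → SchwartzMap (ℝ × V2) ℂ) :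
    Fin n → Fin n → (ℝ × V2 → ℂ) :=
  fun i k => pdx j ⇑(f i k)

/-- `H^{s,θ}` norm of a matrix-valued function, applied entrywise and summed. -/
def HNM {n : ℕ} (s θ : ℝ) (U : Fin n → Fin n → (ℝ × V2 → ℂ)) : ℝ≥0∞ :=
  ∑ i, ∑ k, HN s θ (U i k)

/-- `‖∇f‖_{H^{s,θ}} = (‖∂₁f‖² + ‖∂₂f‖²)^{1/2}`. -/
def gradN {n : ℕ} (s θ : ℝ) (f : Fin n → Fin n → SchwartzMap (ℝ × V2) ℂ) : ℝ≥0∞ :=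
  (HNM s θ (pdf 0 f) ^ (2 : ℕ) + HNM s θ (pdf 1 f) ^ (2 : ℕ)) ^ ((1 : ℝ) / 2)

/-- The elliptic equation
`△A₀ = -∂₁[A₀,∂₂f] + ∂₂[A₀,∂₁f] + ∂₁[∂₁f,φ] + ∂₂[∂₂f,φ]`, holding pointwise. -/
def EllipticEq {n : ℕ} (A0 f φ : Fin n → Fin n → SchwartzMap (ℝ × V2) ℂ) : Prop :=
  ∀ (i k : Fin n) (p : ℝ × V2),
    pdx 0 (pdx 0 ⇑(A0 i k)) p + pdx 1 (pdx 1 ⇑(A0 i k)) p =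
      -pdx 0 (mcomm (cF A0) (pdf 1 f) i k) p + pdx 1 (mcomm (cF A0) (pdf 0 f) i k) p +
        pdx 0 (mcomm (pdf 0 f) (cF φ) i k) p + pdx 1 (mcomm (pdf 1 f) (cF φ) i k) p

/-- Pointwise norm of a matrix of functions (entrywise and summed). -/
def mE {n : ℕ} (U : Fin n → Fin n → (ℝ × V2 → ℂ)) (p : ℝ × V2) : ℝ≥0∞ :=
  ∑ i, ∑ k, (‖U i k p‖₊ : ℝ≥0∞)

/-- Entrywise application of the multiplier `D_x^a` to a matrix of functions. -/
def DxU {n : ℕ} (a : ℝ) (U : Fin n → Fin n → (ℝ × V2 → ℂ)) :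
    Fin n → Fin n → (ℝ × V2 → ℂ) :=
  fun i k => DxA a (U i k)

/-- Spatial `L^q` norm of a matrix-valued function at fixed time `t`. -/
def LqAt {n : ℕ} (q : ℝ) (U : Fin n → Fin n → (ℝ × V2 → ℂ)) (t : ℝ) : ℝ≥0∞ :=
  (∫⁻ x : V2, mE U (t, x) ^ q) ^ q⁻¹

/-- `L^p` norm in time, written in terms of `rp = 1/p ∈ [0,1]`; `rp = 0` is `L^∞`. -/
def LtR (rp : ℝ) (F : ℝ → ℝ≥0∞) : ℝ≥0∞ :=
  if rp = 0 then essSup F volume else (∫⁻ t : ℝ, F t ^ rp⁻¹) ^ rp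

/-- `L^p` norm in time, `p` finite. -/
def Ltp (p : ℝ) (F : ℝ → ℝ≥0∞) : ℝ≥0∞ :=
  (∫⁻ t : ℝ, F t ^ p) ^ p⁻¹

/-- The homogeneous Sobolev norm `Ḣ^a(ℝ²)` of a scalar function, `‖|ξ|^a ĝ‖_{L²}`. -/
def hSob (a : ℝ) (g : V2 → ℂ) : ℝ≥0∞ :=
  (∫⁻ ξ : V2, (ENNReal.ofReal (‖ξ‖ ^ a) * (‖ft2 g ξ‖₊ : ℝ≥0∞)) ^ (2 : ℕ)) ^ ((1 : ℝ) / 2)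

namespace EllAux
theorem cs {X : Type*} [MeasurableSpace X] {μ : Measure X} {f g : X → ℝ≥0∞}
    (hf : AEMeasurable f μ) (hg : AEMeasurable g μ) :
    (∫⁻ x, f x * g x ∂μ) ^ 2 ≤ (∫⁻ x, f x ^ 2 ∂μ) * ∫⁻ x, g x ^ 2 ∂μ := by
  have h := ENNReal.lintegral_mul_le_Lp_mul_Lq μ Real.HolderConjugate.two_two hf hg
  simp only [Pi.mul_apply, ENNReal.rpow_ofNat] at h
  calc _ ≤ _ := pow_le_pow_left' h 2
    _ = _ := by
      rw [mul_pow, ← ENNReal.rpow_natCast, ← ENNReal.rpow_natCast, ← ENNReal.rpow_mul, ← ENNReal.rpow_mul]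
      norm_num

def w (e : ℝ) (x : V2) : ℝ≥0∞ := ENNReal.ofReal (‖x‖ ^ e)

theorem measurable_w (e : ℝ) : Measurable (w e) := by
  unfold w; fun_prop

theorem radial (e : ℝ) (he : e < 1) : ∃ c : ℝ≥0∞, c ≠ ⊤ ∧ ∀ r : ℝ, 0 < r →
    ∫⁻ x : V2, (if ‖x‖ ≤ r then w (-e) x ^ 2 else 0) ≤ c * ENNReal.ofReal (r ^ (2 - 2 * e)) := by
  refine ⟨ENNReal.ofReal (2 * (volume.real (Metric.ball (0 : V2) 1) * (1 / (2 - 2 * e)))),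
    ENNReal.ofReal_ne_top, fun r hr => ?_⟩
  set g : ℝ → ℝ := (Set.Iic r).indicator (fun y => y ^ (-(2 * e))) with hg
  have h1 : ∀ x : V2, (if ‖x‖ ≤ r then w (-e) x ^ 2 else 0) = ENNReal.ofReal (g ‖x‖) := by
    intro x
    simp only [hg, Set.indicator, Set.mem_Iic, w]
    split_ifs
    · rw [← ENNReal.ofReal_pow (by positivity), ← Real.rpow_natCast, ← Real.rpow_mul (norm_nonneg _)]
      congr 2; push_cast; ring
    · simp
  have hgn : ∀ x : V2, 0 ≤ g ‖x‖ := by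
    intro x
    simp only [hg, Set.indicator, Set.mem_Iic]
    split_ifs
    · positivity
    · exact le_rfl
  have h2 : Set.EqOn (fun y : ℝ => y ^ (Module.finrank ℝ V2 - 1) • g y)
      ((Set.Ioc 0 r).indicator (fun y => y ^ (1 - 2 * e))) (Set.Ioi 0) := by
    intro y hy
    have hy' : 0 < y := hy
    simp only [hg, Set.indicator, Set.mem_Iic, Set.mem_Ioc, hy', true_and, finrank_euclideanSpace_fin]
    split_ifs
    · simp only [smul_eq_mul]; norm_num
      nth_rewrite 1 [← Real.rpow_one y]
      rw [← Real.rpow_add hy']; congr 1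
    · simp
  have h3 : IntegrableOn (fun y : ℝ => y ^ (1 - 2 * e)) (Set.Ioc 0 r) := by
    have := intervalIntegral.intervalIntegrable_rpow' (a := 0) (b := r) (r := 1 - 2 * e) (by linarith)
    rwa [intervalIntegrable_iff_integrableOn_Ioc_of_le hr.le] at this
  have h4 : Integrable (fun x : V2 => g ‖x‖) := by
    rw [integrable_fun_norm_addHaar volume (f := g)]
    rw [integrableOn_congr_fun h2 measurableSet_Ioi]
    rw [IntegrableOn, integrable_indicator_iff measurableSet_Ioc]
    exact IntegrableOn.mono_measure h3 Measure.restrict_le_self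
  simp_rw [h1]
  rw [← ofReal_integral_eq_lintegral_ofReal h4 (Filter.Eventually.of_forall hgn),
    integral_fun_norm_addHaar volume g, setIntegral_congr_fun measurableSet_Ioi h2,
    setIntegral_indicator measurableSet_Ioc, Set.inter_eq_right.2 Set.Ioc_subset_Ioi_self,
    ← intervalIntegral.integral_of_le hr.le, integral_rpow (Or.inl (by linarith)),
    ← ENNReal.ofReal_mul (by have : 0 < 2 - 2 * e := by linarith
                             positivity)]
  apply ENNReal.ofReal_le_ofReal
  rw [Real.zero_rpow (by linarith)]
  simp only [finrank_euclideanSpace_fin, nsmul_eq_mul, smul_eq_mul]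
  apply le_of_eq
  have : 1 - 2 * e + 1 = 2 - 2 * e := by ring
  rw [this]; push_cast; ring

end EllAux

namespace EllAux

theorem half_rpow {A B e : ℝ} (hA : 0 < A) (hB : 0 < B) (h : A ≤ 2 * B) (e0 : 0 ≤ e) (e1 : e ≤ 1) :
    B ^ (-e) ≤ 2 * A ^ (-e) := by
  have h1 : (2 * B) ^ (-e) ≤ A ^ (-e) := Real.rpow_le_rpow_of_nonpos hA h (by linarith)
  rw [Real.mul_rpow (by norm_num) hB.le] at h1
  have h2 : (1 / 2 : ℝ) ≤ 2 ^ (-e) := by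
    have := Real.rpow_le_rpow_of_exponent_le (x := 2) (by norm_num) (show (-1 : ℝ) ≤ -e by linarith)
    rw [Real.rpow_neg_one] at this
    linarith
  have h3 : 0 < B ^ (-e) := by positivity
  nlinarith

theorem kernel_real {α β X Y Z : ℝ} (hα : 0 ≤ α) (hβ : 0 ≤ β) (hab : α + β < 1)
    (hX : 0 < X) (hY : 0 < Y) (hZ : 0 < Z) (h1 : X ≤ Z + Y) (h2 : Y ≤ X + Z) (h3 : Z ≤ X + Y) :
    X ^ (α + β - 1) * Z ^ (-α) * Y ^ (-β) ≤
      2 * ((if X ≤ Y then X ^ (α + β - 1) * Y ^ (-(α + β)) else 0) +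
        (if Z ≤ X then Z ^ (-α) * X ^ (α - 1) else 0) +
        (if Y ≤ X then Y ^ (-β) * X ^ (β - 1) else 0)) := by
  have p1 : 0 ≤ (if X ≤ Y then X ^ (α + β - 1) * Y ^ (-(α + β)) else 0) := by
    split_ifs <;> positivity
  have p2 : 0 ≤ (if Z ≤ X then Z ^ (-α) * X ^ (α - 1) else 0) := by
    split_ifs <;> positivity
  have p3 : 0 ≤ (if Y ≤ X then Y ^ (-β) * X ^ (β - 1) else 0) := by
    split_ifs <;> positivity
  by_cases c1 : X ≤ Y ∧ X ≤ Z
  · have q : Z ^ (-α) ≤ 2 * Y ^ (-α) := half_rpow hY hZ (by linarith) hα (by linarith)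
    have e : Y ^ (-(α + β)) = Y ^ (-α) * Y ^ (-β) := by rw [← Real.rpow_add hY]; congr 1; ring
    have : X ^ (α + β - 1) * Z ^ (-α) * Y ^ (-β) ≤ 2 * (X ^ (α + β - 1) * Y ^ (-(α + β))) := by
      rw [e]
      calc _ ≤ X ^ (α + β - 1) * (2 * Y ^ (-α)) * Y ^ (-β) := by gcongr
        _ = _ := by ring
    rw [if_pos c1.1]; linarith
  · by_cases c2 : Z ≤ X ∧ Z ≤ Y
    · have q : Y ^ (-β) ≤ 2 * X ^ (-β) := half_rpow hX hY (by linarith) hβ (by linarith)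
      have e : X ^ (α - 1) = X ^ (α + β - 1) * X ^ (-β) := by rw [← Real.rpow_add hX]; congr 1; ring
      have : X ^ (α + β - 1) * Z ^ (-α) * Y ^ (-β) ≤ 2 * (Z ^ (-α) * X ^ (α - 1)) := by
        rw [e]
        calc _ ≤ X ^ (α + β - 1) * Z ^ (-α) * (2 * X ^ (-β)) := by gcongr
          _ = _ := by ring
      rw [if_pos c2.1] at *; linarith
    · have c3 : Y ≤ X ∧ Y ≤ Z := by
        by_contra hc
        simp only [not_and_or, not_le] at c1 c2 hc
        rcases c1 with c1 | c1 <;> rcases c2 with c2 | c2 <;> rcases hc with c3 | c3 <;> linarith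
      have q : Z ^ (-α) ≤ 2 * X ^ (-α) := half_rpow hX hZ (by linarith) hα (by linarith)
      have e : X ^ (β - 1) = X ^ (α + β - 1) * X ^ (-α) := by rw [← Real.rpow_add hX]; congr 1; ring
      have : X ^ (α + β - 1) * Z ^ (-α) * Y ^ (-β) ≤ 2 * (Y ^ (-β) * X ^ (β - 1)) := by
        rw [e]
        calc _ ≤ X ^ (α + β - 1) * (2 * X ^ (-α)) * Y ^ (-β) := by gcongr
          _ = _ := by ring
      rw [if_pos c3.1] at *; linarith

def kk (e e' : ℝ) (x y : V2) : ℝ≥0∞ := if ‖x‖ ≤ ‖y‖ then w e x * w e' y else 0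

theorem measurable_kk (e e' : ℝ) : Measurable (fun p : V2 × V2 => kk e e' p.1 p.2) := by
  unfold kk
  refine Measurable.ite ?_ ?_ measurable_const
  · exact measurableSet_le (by fun_prop) (by fun_prop)
  · exact ((measurable_w e).comp measurable_fst).mul ((measurable_w e').comp measurable_snd)

theorem kk_eq (e e' : ℝ) (x y : V2) :
    kk e e' x y = ENNReal.ofReal (if ‖x‖ ≤ ‖y‖ then ‖x‖ ^ e * ‖y‖ ^ e' else 0) := by
  unfold kk w
  split_ifs
  · rw [ENNReal.ofReal_mul (by positivity)]
  · simp

theorem kernel {α β : ℝ} (hα : 0 ≤ α) (hβ : 0 ≤ β) (hab : α + β < 1) {x y : V2}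
    (hx : x ≠ 0) (hy : y ≠ 0) (hz : x - y ≠ 0) :
    w (α + β - 1) x * w (-α) (x - y) * w (-β) y ≤
      2 * (kk (α + β - 1) (-(α + β)) x y + kk (-α) (α - 1) (x - y) x + kk (-β) (β - 1) y x) := by
  have hX : 0 < ‖x‖ := norm_pos_iff.2 hx
  have hY : 0 < ‖y‖ := norm_pos_iff.2 hy
  have hZ : 0 < ‖x - y‖ := norm_pos_iff.2 hz
  have t1 : ‖x‖ ≤ ‖x - y‖ + ‖y‖ := by simpa using norm_add_le (x - y) y
  have t2 : ‖y‖ ≤ ‖x‖ + ‖x - y‖ := by simpa using norm_sub_le x (x - y)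
  have t3 : ‖x - y‖ ≤ ‖x‖ + ‖y‖ := norm_sub_le x y
  have := kernel_real hα hβ hab hX hY hZ t1 t2 t3
  have nn : ∀ (e e' X Y : ℝ), 0 ≤ X → 0 ≤ Y → 0 ≤ (if X ≤ Y then X ^ e * Y ^ e' else 0) := by
    intro e e' X Y _ _; split_ifs <;> positivity
  rw [kk_eq, kk_eq, kk_eq]
  rw [← ENNReal.ofReal_add (nn _ _ _ _ hX.le hY.le) (nn _ _ _ _ hZ.le hX.le),
    ← ENNReal.ofReal_add (add_nonneg (nn _ _ _ _ hX.le hY.le) (nn _ _ _ _ hZ.le hX.le))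
      (nn _ _ _ _ hY.le hX.le)]
  have h2 : ∀ S : ℝ, (2 : ℝ≥0∞) * ENNReal.ofReal S = ENNReal.ofReal (2 * S) := by
    intro S; rw [ENNReal.ofReal_mul (by norm_num)]; simp
  rw [h2]
  unfold w
  rw [← ENNReal.ofReal_mul (by positivity), ← ENNReal.ofReal_mul (by positivity)]
  exact ENNReal.ofReal_le_ofReal this

theorem w_sq (e : ℝ) (x : V2) : w e x ^ 2 = ENNReal.ofReal (‖x‖ ^ (2 * e)) := by
  rw [w, ← ENNReal.ofReal_pow (by positivity), ← Real.rpow_natCast, ← Real.rpow_mul (norm_nonneg _)]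
  congr 2; push_cast; ring

theorem kk_int (e : ℝ) (he : e < 1) : ∃ c : ℝ≥0∞, c ≠ ⊤ ∧ ∀ y : V2, y ≠ 0 →
    ∫⁻ x : V2, kk (-e) (e - 1) x y ^ 2 ≤ c := by
  obtain ⟨c, hc, h⟩ := radial e he
  refine ⟨c, hc, fun y hy => ?_⟩
  have hY : 0 < ‖y‖ := norm_pos_iff.2 hy
  have e1 : ∀ x, kk (-e) (e - 1) x y ^ 2 = (if ‖x‖ ≤ ‖y‖ then w (-e) x ^ 2 else 0) * w (e - 1) y ^ 2 := by
    intro x; unfold kk; split_ifs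
    · rw [mul_pow]
    · simp
  simp_rw [e1]
  rw [lintegral_mul_const _ (Measurable.ite (measurableSet_le (by fun_prop) (by fun_prop))
    ((measurable_w _).pow_const _) measurable_const)]
  calc _ ≤ c * ENNReal.ofReal (‖y‖ ^ (2 - 2 * e)) * w (e - 1) y ^ 2 := by gcongr; exact h _ hY
    _ = c := by
      rw [w_sq, mul_assoc, ← ENNReal.ofReal_mul (by positivity), ← Real.rpow_add hY]
      ring_nf; simp

/-- First region. -/
theorem reg1 (e : ℝ) (he : e < 1) : ∃ c : ℝ≥0∞, c ≠ ⊤ ∧ ∀ P Q : V2 → ℝ≥0∞, Measurable P →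
    Measurable Q → ∫⁻ x, (∫⁻ y, kk (-e) (e - 1) x y * (P (x - y) * Q y)) ^ 2 ≤
      c * ((∫⁻ x, P x ^ 2) * ∫⁻ x, Q x ^ 2) := by
  obtain ⟨c, hc, h⟩ := kk_int e he
  refine ⟨c, hc, fun P Q hP hQ => ?_⟩
  have mk := measurable_kk (-e) (e - 1)
  calc _ ≤ ∫⁻ x, (∫⁻ y, P y ^ 2) * ∫⁻ y, (kk (-e) (e - 1) x y * Q y) ^ 2 := by
        refine lintegral_mono fun x => ?_
        have := cs (μ := volume) (f := fun y => P (x - y)) (g := fun y => kk (-e) (e - 1) x y * Q y)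
          (by fun_prop) ((mk.comp measurable_prodMk_left).mul hQ).aemeasurable
        rw [lintegral_sub_left_eq_self (fun y => P y ^ 2) x] at this
        refine le_trans (le_of_eq ?_) this
        congr 1
        refine lintegral_congr fun y => ?_
        ring
    _ = (∫⁻ y, P y ^ 2) * ∫⁻ y, ∫⁻ x, (kk (-e) (e - 1) x y * Q y) ^ 2 := by
        have m2 : Measurable (fun p : V2 × V2 => (kk (-e) (e - 1) p.1 p.2 * Q p.2) ^ 2) :=
          (mk.mul (hQ.comp measurable_snd)).pow_const _
        rw [lintegral_const_mul _ m2.lintegral_prod_right', lintegral_lintegral_swap m2.aemeasurable]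
    _ ≤ (∫⁻ y, P y ^ 2) * ∫⁻ y, c * Q y ^ 2 := by
        gcongr 1
        refine lintegral_mono_ae ?_
        filter_upwards [(Set.finite_singleton (0 : V2)).measure_zero volume |> compl_mem_ae_iff.2] with y hy
        simp_rw [mul_pow]
        have m4 : Measurable (fun x => kk (-e) (e - 1) x y ^ 2) :=
          (mk.comp (measurable_prodMk_right (y := y))).pow_const 2
        rw [lintegral_mul_const _ m4]
        gcongr
        exact h y hy
    _ = _ := by rw [lintegral_const_mul _ (hQ.pow_const _)]; ring

theorem ae_ne (x : V2) : ∀ᵐ y : V2, y ≠ x := by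
  filter_upwards [(Set.finite_singleton x).measure_zero volume |> compl_mem_ae_iff.2] with y hy
  exact hy

/-- Third region. -/
theorem reg3 (e : ℝ) (he : e < 1) : ∃ c : ℝ≥0∞, c ≠ ⊤ ∧ ∀ P Q : V2 → ℝ≥0∞, Measurable P →
    Measurable Q → ∫⁻ x, (∫⁻ y, kk (-e) (e - 1) y x * (P (x - y) * Q y)) ^ 2 ≤
      c * ((∫⁻ x, P x ^ 2) * ∫⁻ x, Q x ^ 2) := by
  obtain ⟨c, hc, h⟩ := kk_int e he
  refine ⟨c, hc, fun P Q hP hQ => ?_⟩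
  have mk := measurable_kk (-e) (e - 1)
  have m2 : Measurable (fun p : V2 × V2 => (P (p.1 - p.2) * Q p.2) ^ 2) := by fun_prop
  calc _ ≤ ∫⁻ x, c * ∫⁻ y, (P (x - y) * Q y) ^ 2 := by
        refine lintegral_mono_ae ?_
        filter_upwards [ae_ne 0] with x hx
        refine (cs (μ := volume) (mk.comp measurable_prodMk_right).aemeasurable (by fun_prop)).trans ?_
        gcongr
        exact h x hx
    _ = c * ∫⁻ y, ∫⁻ x, (P (x - y) * Q y) ^ 2 := by
        rw [lintegral_const_mul _ m2.lintegral_prod_right', lintegral_lintegral_swap m2.aemeasurable]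
    _ = c * ∫⁻ y, (∫⁻ x, P x ^ 2) * Q y ^ 2 := by
        congr 1
        refine lintegral_congr fun y => ?_
        simp_rw [mul_pow]
        rw [lintegral_mul_const _ (by fun_prop), lintegral_sub_right_eq_self (fun x => P x ^ 2) y]
    _ = _ := by rw [lintegral_const_mul _ (hQ.pow_const _)]

/-- Second region. -/
theorem reg2 (e : ℝ) (he : e < 1) : ∃ c : ℝ≥0∞, c ≠ ⊤ ∧ ∀ P Q : V2 → ℝ≥0∞, Measurable P →
    Measurable Q → ∫⁻ x, (∫⁻ y, kk (-e) (e - 1) (x - y) x * (P (x - y) * Q y)) ^ 2 ≤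
      c * ((∫⁻ x, P x ^ 2) * ∫⁻ x, Q x ^ 2) := by
  obtain ⟨c, hc, h⟩ := reg3 e he
  refine ⟨c, hc, fun P Q hP hQ => ?_⟩
  have := h Q P hQ hP
  rw [mul_comm (∫⁻ x, P x ^ 2)]
  refine le_trans (le_of_eq ?_) this
  refine lintegral_congr fun x => ?_
  rw [← lintegral_sub_left_eq_self (fun y => kk (-e) (e - 1) y x * (Q (x - y) * P y)) x]
  simp_rw [sub_sub_cancel, mul_comm]

theorem w_mul_w_neg {e : ℝ} {x : V2} (hx : x ≠ 0) : w (-e) x * w e x = 1 := by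
  have hX : 0 < ‖x‖ := norm_pos_iff.2 hx
  unfold w
  rw [← ENNReal.ofReal_mul (by positivity), ← Real.rpow_add hX]; simp

theorem sq3 (a b c : ℝ≥0∞) : (2 * (a + b + c)) ^ 2 ≤ 12 * (a ^ 2 + b ^ 2 + c ^ 2) := by
  by_cases ha : a = ⊤
  · simp [ha]
  by_cases hb : b = ⊤
  · simp [hb]
  by_cases hc : c = ⊤
  · simp [hc]
  lift a to NNReal using ha
  lift b to NNReal using hb
  lift c to NNReal using hc
  norm_cast
  rw [← NNReal.coe_le_coe]
  push_cast
  nlinarith [sq_nonneg ((a : ℝ) - b), sq_nonneg ((a : ℝ) - c), sq_nonneg ((b : ℝ) - c)]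

theorem bilin {α β : ℝ} (hα : 0 ≤ α) (hβ : 0 ≤ β) (hab : α + β < 1) (hab0 : 0 < α + β) :
    ∃ c : ℝ≥0∞, c ≠ ⊤ ∧ ∀ F G : V2 → ℝ≥0∞, Measurable F → Measurable G →
      ∫⁻ x, (w (α + β - 1) x * ∫⁻ y, F (x - y) * G y) ^ 2 ≤
        c * ((∫⁻ x, (w α x * F x) ^ 2) * ∫⁻ x, (w β x * G x) ^ 2) := by
  obtain ⟨c1, hc1, h1⟩ := reg1 (1 - (α + β)) (by linarith)
  obtain ⟨c2, hc2, h2⟩ := reg2 α (by linarith)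
  obtain ⟨c3, hc3, h3⟩ := reg3 β (by linarith)
  refine ⟨12 * (c1 + c2 + c3), by finiteness, fun F G hF hG => ?_⟩
  set P : V2 → ℝ≥0∞ := fun x => w α x * F x with hP
  set Q : V2 → ℝ≥0∞ := fun x => w β x * G x with hQ
  have mP : Measurable P := (measurable_w α).mul hF
  have mQ : Measurable Q := (measurable_w β).mul hG
  have e1 : -(1 - (α + β)) = α + β - 1 := by ring
  have e2 : 1 - (α + β) - 1 = -(α + β) := by ring
  specialize h1 P Q mP mQ
  specialize h2 P Q mP mQ
  specialize h3 P Q mP mQ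
  rw [e1, e2] at h1
  have k1 := measurable_kk (α + β - 1) (-(α + β))
  have k2 := measurable_kk (-α) (α - 1)
  have k3 := measurable_kk (-β) (β - 1)
  have m1 : Measurable (fun p : V2 × V2 => kk (α + β - 1) (-(α + β)) p.1 p.2 * (P (p.1 - p.2) * Q p.2)) :=
    k1.mul (by fun_prop)
  have m2 : Measurable (fun p : V2 × V2 => kk (-α) (α - 1) (p.1 - p.2) p.1 * (P (p.1 - p.2) * Q p.2)) :=
    (k2.comp (g := fun p : V2 × V2 => kk (-α) (α - 1) p.1 p.2)
      (f := fun p : V2 × V2 => (p.1 - p.2, p.1)) (by fun_prop)).mul (by fun_prop)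
  have m3 : Measurable (fun p : V2 × V2 => kk (-β) (β - 1) p.2 p.1 * (P (p.1 - p.2) * Q p.2)) :=
    (k3.comp (g := fun p : V2 × V2 => kk (-β) (β - 1) p.1 p.2)
      (f := fun p : V2 × V2 => (p.2, p.1)) (by fun_prop)).mul (by fun_prop)
  calc _ ≤ ∫⁻ x, 12 * ((∫⁻ y, kk (α + β - 1) (-(α + β)) x y * (P (x - y) * Q y)) ^ 2 +
        (∫⁻ y, kk (-α) (α - 1) (x - y) x * (P (x - y) * Q y)) ^ 2 +
        (∫⁻ y, kk (-β) (β - 1) y x * (P (x - y) * Q y)) ^ 2) := by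
        refine lintegral_mono_ae ?_
        filter_upwards [ae_ne 0] with x hx
        refine le_trans (pow_le_pow_left' ?_ 2) (sq3 _ _ _)
        have mm1 := m1.comp (measurable_prodMk_left (x := x))
        have mm3 := m3.comp (measurable_prodMk_left (x := x))
        simp only [Function.comp_def] at mm1 mm3
        rw [← lintegral_add_left mm1, ← lintegral_add_right _ mm3,
          ← lintegral_const_mul' 2 _ (by simp),
          ← lintegral_const_mul' (w (α + β - 1) x) _ ENNReal.ofReal_ne_top]
        refine lintegral_mono_ae ?_
        filter_upwards [ae_ne 0, ae_ne x] with y hy hxy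
        have hz : x - y ≠ 0 := sub_ne_zero.2 (Ne.symm hxy)
        calc w (α + β - 1) x * (F (x - y) * G y)
            = w (α + β - 1) x * w (-α) (x - y) * w (-β) y * (P (x - y) * Q y) := by
              have a1 := w_mul_w_neg (e := α) hz
              have a2 := w_mul_w_neg (e := β) hy
              calc _ = w (α + β - 1) x * ((w (-α) (x - y) * w α (x - y)) * F (x - y) *
                    ((w (-β) y * w β y) * G y)) := by rw [a1, a2]; simp
                _ = _ := by simp only [hP, hQ]; ring
          _ ≤ _ := by
              refine (mul_le_mul_left (kernel hα hβ hab hx hy hz) _).trans (le_of_eq ?_)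
              ring
    _ ≤ _ := by
        have q1 : Measurable (fun x : V2 => (∫⁻ y, kk (α + β - 1) (-(α + β)) x y * (P (x - y) * Q y)) ^ 2) :=
          (Measurable.lintegral_prod_right' (ν := volume) m1).pow_const 2
        have q3 : Measurable (fun x : V2 => (∫⁻ y, kk (-β) (β - 1) y x * (P (x - y) * Q y)) ^ 2) :=
          (Measurable.lintegral_prod_right' (ν := volume) m3).pow_const 2
        rw [lintegral_const_mul' _ _ (by simp), lintegral_add_right _ q3, lintegral_add_left q1,
          mul_assoc, add_mul, add_mul]
        gcongr

end EllAux

namespace EllAux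
open scoped FourierTransform SchwartzMap LineDeriv

theorem ft2_eq (g : V2 → ℂ) (ξ : V2) : ft2 g ξ = 𝓕 g ((2 * π)⁻¹ • ξ) := by
  rw [Real.fourier_eq', ft2]
  congr 1; ext x
  rw [inner_smul_right, smul_eq_mul]
  congr 2
  have : (π : ℂ) ≠ 0 := by exact_mod_cast Real.pi_ne_zero
  push_cast
  field_simp

theorem ft2_continuous (u : 𝓢(V2, ℂ)) : Continuous (ft2 u) := by
  have : ft2 u = fun ξ => (𝓕 u : 𝓢(V2, ℂ)) ((2 * π)⁻¹ • ξ) := by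
    ext ξ; rw [ft2_eq, SchwartzMap.fourier_coe]
  rw [this]; fun_prop

theorem ft2_measurable (u : 𝓢(V2, ℂ)) : Measurable (fun ξ => (‖ft2 u ξ‖₊ : ℝ≥0∞)) :=
  (ft2_continuous u).nnnorm.measurable.coe_nnreal_ennreal

def mulS (u v : 𝓢(V2, ℂ)) : 𝓢(V2, ℂ) := SchwartzMap.pairing (ContinuousLinearMap.mul ℂ ℂ) u v

@[simp] theorem mulS_apply (u v : 𝓢(V2, ℂ)) (x : V2) : mulS u v x = u x * v x := rfl

theorem fourier_mulS (u v : 𝓢(V2, ℂ)) (x : V2) :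
    𝓕 (mulS u v) x = ∫ y, 𝓕 u (x - y) * 𝓕 v y := by
  have h := SchwartzMap.convolution_apply (ContinuousLinearMap.mul ℂ ℂ) (𝓕⁻ u) (𝓕⁻ v) (-x)
  have h1 : SchwartzMap.convolution (ContinuousLinearMap.mul ℂ ℂ) (𝓕⁻ u) (𝓕⁻ v) = 𝓕⁻ (mulS u v) := by
    simp [SchwartzMap.convolution, mulS]
  have key : ∀ (g : 𝓢(V2, ℂ)) (y : V2), 𝓕⁻ g y = 𝓕 g (-y) := by
    intro g y
    rw [SchwartzMap.fourierInv_coe, SchwartzMap.fourier_coe, Real.fourierInv_eq_fourier_neg]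
  rw [h1, key, neg_neg] at h
  rw [h, convolution_def]
  refine (integral_sub_right_eq_self _ x).symm.trans ?_
  congr 1; ext y
  simp [key]

theorem ft2_mul : ∃ c : ℝ≥0∞, c ≠ ⊤ ∧ ∀ (u v : 𝓢(V2, ℂ)) (ξ : V2),
    (‖ft2 (mulS u v) ξ‖₊ : ℝ≥0∞) ≤ c * ∫⁻ η, (‖ft2 u (ξ - η)‖₊ : ℝ≥0∞) * (‖ft2 v η‖₊ : ℝ≥0∞) := by
  have hr : (2 * π) ≠ 0 := by positivity
  refine ⟨ENNReal.ofReal |((2 * π) ^ Module.finrank ℝ V2)⁻¹|, ENNReal.ofReal_ne_top, fun u v ξ => ?_⟩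
  have h := Measure.map_addHaar_smul (volume : Measure V2) hr
  have m : Measurable (fun η => (‖ft2 u (ξ - η)‖₊ : ℝ≥0∞) * (‖ft2 v η‖₊ : ℝ≥0∞)) :=
    ((ft2_measurable u).comp (measurable_const.sub measurable_id)).mul (ft2_measurable v)
  rw [← smul_eq_mul, ← lintegral_smul_measure, ← h, lintegral_map m (by fun_prop)]
  rw [ft2_eq, ← SchwartzMap.fourier_coe, fourier_mulS]
  refine (enorm_integral_le_lintegral_enorm _).trans (le_of_eq ?_)
  refine lintegral_congr fun y => ?_
  rw [enorm_mul, ft2_eq, ft2_eq, smul_sub, smul_smul, inv_mul_cancel₀ hr, one_smul,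
    SchwartzMap.fourier_coe, SchwartzMap.fourier_coe]
  rfl

theorem rpow_half_sq (x : ℝ≥0∞) : (x ^ ((1 : ℝ) / 2)) ^ 2 = x := by
  rw [← ENNReal.rpow_natCast, ← ENNReal.rpow_mul]; norm_num

theorem sq_rpow_half (x : ℝ≥0∞) : (x ^ 2) ^ ((1 : ℝ) / 2) = x := by
  rw [← ENNReal.rpow_natCast, ← ENNReal.rpow_mul]; norm_num

theorem hSob_mul {α β : ℝ} (hα : 0 ≤ α) (hβ : 0 ≤ β) (hab : α + β < 1) (hab0 : 0 < α + β) :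
    ∃ c : ℝ≥0∞, c ≠ ⊤ ∧ ∀ u v : 𝓢(V2, ℂ),
      hSob (α + β - 1) (mulS u v) ≤ c * (hSob α u * hSob β v) := by
  obtain ⟨c1, hc1, h1⟩ := bilin hα hβ hab hab0
  obtain ⟨c2, hc2, h2⟩ := ft2_mul
  refine ⟨c2 * c1 ^ ((1 : ℝ) / 2), ENNReal.mul_ne_top hc2 (ENNReal.rpow_ne_top_of_nonneg (by norm_num) hc1),
    fun u v => ?_⟩
  specialize h1 _ _ (ft2_measurable u) (ft2_measurable v)
  have h3 : ∫⁻ ξ : V2, (w (α + β - 1) ξ * (‖ft2 (mulS u v) ξ‖₊ : ℝ≥0∞)) ^ 2 ≤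
      c2 ^ 2 * (c1 * ((∫⁻ x, (w α x * (‖ft2 u x‖₊ : ℝ≥0∞)) ^ 2) * ∫⁻ x, (w β x * (‖ft2 v x‖₊ : ℝ≥0∞)) ^ 2)) := by
    refine le_trans ?_ (mul_le_mul_right h1 _)
    rw [← lintegral_const_mul' _ _ (by finiteness)]
    refine lintegral_mono fun ξ => ?_
    rw [← mul_pow]
    gcongr ?_ ^ 2
    rw [mul_left_comm]
    gcongr
    exact h2 u v ξ
  unfold hSob
  refine (ENNReal.rpow_le_rpow h3 (by norm_num : (0 : ℝ) ≤ 1 / 2)).trans (le_of_eq ?_)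
  simp only [ENNReal.mul_rpow_of_nonneg _ _ (by norm_num : (0 : ℝ) ≤ 1 / 2), sq_rpow_half]
  rw [mul_assoc]; rfl

theorem ft2_add (u v : 𝓢(V2, ℂ)) (ξ : V2) : ft2 (u + v : 𝓢(V2, ℂ)) ξ = ft2 u ξ + ft2 v ξ := by
  simp only [ft2_eq, ← SchwartzMap.fourier_coe, FourierTransform.fourier_add]; rfl

theorem ft2_neg (u : 𝓢(V2, ℂ)) (ξ : V2) : ft2 (-u : 𝓢(V2, ℂ)) ξ = - ft2 u ξ := by
  simp only [ft2_eq, ← SchwartzMap.fourier_coe, FourierTransform.fourier_neg]; rfl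

theorem hSob_neg (e : ℝ) (u : 𝓢(V2, ℂ)) : hSob e (-u : 𝓢(V2, ℂ)) = hSob e u := by
  simp only [hSob, ft2_neg, nnnorm_neg]

theorem L2_add {f g : V2 → ℝ≥0∞} (hf : Measurable f) (hg : Measurable g) :
    (∫⁻ x, (f x + g x) ^ 2) ^ ((1 : ℝ) / 2) ≤
      (∫⁻ x, f x ^ 2) ^ ((1 : ℝ) / 2) + (∫⁻ x, g x ^ 2) ^ ((1 : ℝ) / 2) := by
  have := ENNReal.lintegral_Lp_add_le (μ := volume) (p := 2) hf.aemeasurable hg.aemeasurable (by norm_num)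
  simpa using this

theorem hSob_meas (e : ℝ) (u : 𝓢(V2, ℂ)) :
    Measurable (fun ξ => ENNReal.ofReal (‖ξ‖ ^ e) * (‖ft2 u ξ‖₊ : ℝ≥0∞)) :=
  (measurable_w e).mul (ft2_measurable u)

theorem hSob_add (e : ℝ) (u v : 𝓢(V2, ℂ)) :
    hSob e (u + v : 𝓢(V2, ℂ)) ≤ hSob e u + hSob e v := by
  refine le_trans ?_ (L2_add (hSob_meas e u) (hSob_meas e v))
  refine ENNReal.rpow_le_rpow (lintegral_mono fun ξ => ?_) (by norm_num)
  rw [ft2_add, ← mul_add]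
  gcongr
  exact_mod_cast nnnorm_add_le _ _

theorem hSob_sub (e : ℝ) (u v : 𝓢(V2, ℂ)) :
    hSob e (u - v : 𝓢(V2, ℂ)) ≤ hSob e u + hSob e v := by
  rw [sub_eq_add_neg, ← hSob_neg e v]; exact hSob_add _ _ _

theorem hSob_zero (e : ℝ) : hSob e (0 : 𝓢(V2, ℂ)) = 0 := by
  have : ∀ ξ, ft2 (0 : 𝓢(V2, ℂ)) ξ = 0 := by intro ξ; simp [ft2]
  simp only [hSob, this]; simp

theorem hSob_sum {ι : Type*} (s : Finset ι) (e : ℝ) (u : ι → 𝓢(V2, ℂ)) :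
    hSob e (∑ i ∈ s, u i : 𝓢(V2, ℂ)) ≤ ∑ i ∈ s, hSob e (u i) := by
  classical
  induction s using Finset.induction_on with
  | empty => simp only [Finset.sum_empty]; rw [hSob_zero]
  | insert a s ha ih =>
    rw [Finset.sum_insert ha, Finset.sum_insert ha]
    exact (hSob_add _ _ _).trans (by gcongr)

theorem ft2_deriv (u : 𝓢(V2, ℂ)) (j : Fin 2) (ξ : V2) :
    ft2 (∂_{(EuclideanSpace.single j 1 : V2)} u : 𝓢(V2, ℂ)) ξ = Complex.I * (ξ j : ℂ) * ft2 u ξ := by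
  have ht : (fun x : V2 => inner ℝ x (EuclideanSpace.single j 1 : V2)).HasTemperateGrowth := by fun_prop
  rw [ft2_eq, ft2_eq, ← SchwartzMap.fourier_coe, ← SchwartzMap.fourier_coe,
    SchwartzMap.fourier_lineDerivOp_eq]
  rw [SchwartzMap.smul_apply, SchwartzMap.smulLeftCLM_apply_apply ht, real_inner_smul_left]
  simp [EuclideanSpace.inner_single_right]
  have : (π : ℂ) ≠ 0 := by exact_mod_cast Real.pi_ne_zero
  field_simp

theorem hSob_elliptic (a : ℝ) (ha : 0 < a) (A N0 N1 : 𝓢(V2, ℂ))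
    (h : ∂_{(EuclideanSpace.single 0 1 : V2)} (∂_{(EuclideanSpace.single 0 1 : V2)} A) +
      ∂_{(EuclideanSpace.single 1 1 : V2)} (∂_{(EuclideanSpace.single 1 1 : V2)} A) =
      ∂_{(EuclideanSpace.single 0 1 : V2)} N0 + ∂_{(EuclideanSpace.single 1 1 : V2)} N1) :
    hSob a A ≤ hSob (a - 1) N0 + hSob (a - 1) N1 := by
  refine le_trans ?_ (L2_add (hSob_meas _ N0) (hSob_meas _ N1))
  refine ENNReal.rpow_le_rpow (lintegral_mono fun ξ => ?_) (by norm_num)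
  gcongr ?_ ^ 2
  by_cases h0 : ξ = 0
  · simp [h0, Real.zero_rpow ha.ne']
  have hX : 0 < ‖ξ‖ := norm_pos_iff.2 h0
  have h1 := congrArg (fun u : 𝓢(V2, ℂ) => ft2 u ξ) h
  simp only [ft2_add, ft2_deriv] at h1
  have h2 : ((‖ξ‖ ^ 2 : ℝ) : ℂ) * ft2 A ξ = -(Complex.I * (ξ 0 : ℂ) * ft2 N0 ξ + Complex.I * (ξ 1 : ℂ) * ft2 N1 ξ) := by
    rw [← h1, EuclideanSpace.norm_sq_eq]
    simp [Fin.sum_univ_two]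
    linear_combination ((ξ 0 : ℂ) ^ 2 + (ξ 1 : ℂ) ^ 2) * ft2 A ξ * Complex.I_sq
  have h3 : ‖ξ‖ ^ 2 * ‖ft2 A ξ‖ ≤ ‖ξ‖ * (‖ft2 N0 ξ‖ + ‖ft2 N1 ξ‖) := by
    have := congrArg norm h2
    rw [norm_mul, Complex.norm_real, Real.norm_of_nonneg (by positivity), norm_neg] at this
    rw [this]
    refine (norm_add_le _ _).trans ?_
    simp only [norm_mul, Complex.norm_I, one_mul, Complex.norm_real]
    rw [mul_add]
    gcongr
    · exact PiLp.norm_apply_le ξ 0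
    · exact PiLp.norm_apply_le ξ 1
  have h4 : ‖ξ‖ * ‖ft2 A ξ‖ ≤ ‖ft2 N0 ξ‖ + ‖ft2 N1 ξ‖ := by
    rw [pow_two, mul_assoc] at h3
    exact le_of_mul_le_mul_left h3 hX
  have h5 : ‖ξ‖ ^ a = ‖ξ‖ ^ (a - 1) * ‖ξ‖ := by
    rw [← Real.rpow_add_one hX.ne']; congr 1; ring
  rw [← mul_add, h5, ENNReal.ofReal_mul (by positivity), mul_assoc]
  gcongr
  have h6 := ENNReal.ofReal_le_ofReal h4
  rw [ENNReal.ofReal_mul (by positivity), ENNReal.ofReal_add (by positivity) (by positivity)] at h6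
  simp only [ofReal_norm] at h6 ⊢
  exact h6

theorem hSob_lt_top (a : ℝ) (ha : 0 < a) (ha1 : a < 1) (u : 𝓢(V2, ℂ)) : hSob a u ≠ ⊤ := by
  have hr : (2 * π)⁻¹ ≠ 0 := by positivity
  let L : V2 ≃L[ℝ] V2 := ContinuousLinearEquiv.smulLeft (Units.mk0 _ hr)
  let ψ : 𝓢(V2, ℂ) := SchwartzMap.compCLMOfContinuousLinearEquiv ℝ L (𝓕 u)
  have hψ : ∀ ξ, ft2 u ξ = ψ ξ := by
    intro ξ; rw [ft2_eq, ← SchwartzMap.fourier_coe]; rfl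
  unfold hSob
  refine ENNReal.rpow_ne_top_of_nonneg (by norm_num) ?_
  set M := SchwartzMap.seminorm ℝ 0 0 ψ
  have hM : ∀ ξ, ‖ψ ξ‖ ≤ M := fun ξ => SchwartzMap.norm_le_seminorm ℝ ψ ξ
  have hi : Integrable (fun ξ => M * (‖ξ‖ ^ 0 * ‖ψ ξ‖ + ‖ξ‖ ^ 2 * ‖ψ ξ‖)) :=
    ((ψ.integrable_pow_mul volume 0).add (ψ.integrable_pow_mul volume 2)).const_mul M
  refine ne_of_lt (lt_of_le_of_lt (lintegral_mono fun ξ => ?_) hi.lintegral_lt_top)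
  rw [hψ, ← enorm_eq_nnnorm, ← ofReal_norm, ← ENNReal.ofReal_mul (by positivity),
    ← ENNReal.ofReal_pow (by positivity)]
  apply ENNReal.ofReal_le_ofReal
  have h1 : (‖ξ‖ ^ a) ^ 2 ≤ 1 + ‖ξ‖ ^ 2 := by
    rcases le_total ‖ξ‖ 1 with h | h
    · have : ‖ξ‖ ^ a ≤ 1 := Real.rpow_le_one (norm_nonneg _) h ha.le
      have h' : 0 ≤ ‖ξ‖ ^ a := by positivity
      nlinarith [sq_nonneg ‖ξ‖]
    · have : ‖ξ‖ ^ a ≤ ‖ξ‖ := by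
        simpa using Real.rpow_le_rpow_of_exponent_le h ha1.le
      have h' : 0 ≤ ‖ξ‖ ^ a := by positivity
      nlinarith
  calc _ = (‖ξ‖ ^ a) ^ 2 * (‖ψ ξ‖ * ‖ψ ξ‖) := by ring
    _ ≤ (1 + ‖ξ‖ ^ 2) * (M * ‖ψ ξ‖) := by gcongr; exact hM ξ
    _ = _ := by ring

end EllAux

namespace EllAux
open scoped FourierTransform SchwartzMap LineDeriv

instance instHaarProd : (volume : Measure (ℝ × V2)).IsAddHaarMeasure := by
  rw [Measure.volume_eq_prod]; infer_instance

theorem ftST_continuous (u : 𝓢(ℝ × V2, ℂ)) : Continuous (fun q : ℝ × V2 => ftST u q.1 q.2) := by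
  unfold ftST
  refine continuous_of_dominated (bound := fun p => ‖u p‖) ?_ ?_ u.integrable.norm ?_
  · intro q; exact Continuous.aestronglyMeasurable (by fun_prop)
  · intro q
    refine Filter.Eventually.of_forall fun p => ?_
    rw [norm_mul, Complex.norm_exp]; simp
  · refine Filter.Eventually.of_forall fun p => ?_
    fun_prop

theorem slice_bound (u : 𝓢(ℝ × V2, ℂ)) : ∃ C : ℝ, ∀ (t : ℝ) (x : V2),
    ‖u (t, x)‖ ≤ C * (1 + ‖x‖) ^ (-(3 : ℝ)) := by
  refine ⟨2 ^ 3 * ((Finset.Iic (3, 0)).sup fun m => SchwartzMap.seminorm ℝ m.1 m.2) u, fun t x => ?_⟩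
  have h := SchwartzMap.one_add_le_sup_seminorm_apply (𝕜 := ℝ) (m := (3, 0)) (k := 3) (n := 0) le_rfl le_rfl
    u (t, x)
  rw [norm_iteratedFDeriv_zero] at h
  have hx : ‖x‖ ≤ ‖(t, x)‖ := norm_snd_le (t, x)
  have hp : (0 : ℝ) < (1 + ‖x‖) ^ 3 := by positivity
  rw [Real.rpow_neg (by positivity), ← div_eq_mul_inv, le_div_iff₀ (by positivity)]
  refine le_trans ?_ h
  rw [mul_comm]
  have : (1 + ‖x‖) ^ (3 : ℝ) = (1 + ‖x‖) ^ 3 := by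
    rw [← Real.rpow_natCast]; norm_num
  rw [this]
  gcongr

theorem slice_continuous (u : 𝓢(ℝ × V2, ℂ)) (ξ : V2) :
    Continuous (fun t : ℝ => ft2 (fun x => u (t, x)) ξ) := by
  obtain ⟨C, hC⟩ := slice_bound u
  unfold ft2
  refine continuous_of_dominated (bound := fun x => C * (1 + ‖x‖) ^ (-(3 : ℝ))) ?_ ?_ ?_ ?_
  · intro q; exact Continuous.aestronglyMeasurable (by fun_prop)
  · intro t
    refine Filter.Eventually.of_forall fun x => ?_
    rw [norm_mul, Complex.norm_exp]; simpa using hC t x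
  · exact (integrable_one_add_norm (by rw [finrank_euclideanSpace_fin]; norm_num)).const_mul C
  · refine Filter.Eventually.of_forall fun p => ?_
    fun_prop

theorem phase_integrable (u : 𝓢(ℝ × V2, ℂ)) (g : ℝ × V2 → ℝ) (hg : Continuous g) :
    Integrable (fun p : ℝ × V2 => Complex.exp (-Complex.I * (g p : ℂ)) * u p) := by
  refine u.integrable.norm.mono' (Continuous.aestronglyMeasurable (by fun_prop)) ?_
  refine Filter.Eventually.of_forall fun p => ?_
  rw [norm_mul, Complex.norm_exp]; simp

theorem slice_integrable (u : 𝓢(ℝ × V2, ℂ)) (ξ : V2) :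
    Integrable (fun t : ℝ => ft2 (fun x => u (t, x)) ξ) :=
  (phase_integrable u (fun p => ⟪p.2, ξ⟫) (by fun_prop)).integral_prod_left

theorem ftST_eq (u : 𝓢(ℝ × V2, ℂ)) (τ : ℝ) (ξ : V2) :
    ftST u τ ξ = ∫ t : ℝ, Complex.exp (-Complex.I * ((t * τ : ℝ) : ℂ)) * ft2 (fun x => u (t, x)) ξ := by
  unfold ftST
  refine (integral_prod _ (phase_integrable u (fun p => p.1 * τ + ⟪p.2, ξ⟫) (by fun_prop))).trans ?_
  congr 1; ext t
  unfold ft2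
  rw [← integral_const_mul]
  congr 1; ext x
  rw [← mul_assoc, ← Complex.exp_add]
  congr 2; push_cast; ring

theorem fourier_slice (u : 𝓢(ℝ × V2, ℂ)) (σ : ℝ) (ξ : V2) :
    𝓕 (fun t : ℝ => ft2 (fun x => u (t, x)) ξ) σ = ftST u (2 * π * σ) ξ := by
  rw [Real.fourier_eq', ftST_eq]
  congr 1; ext t
  rw [smul_eq_mul]
  congr 2
  simp; ring

theorem ftST_slice_meas (u : 𝓢(ℝ × V2, ℂ)) (ξ : V2) :
    Measurable (fun τ : ℝ => (‖ftST u τ ξ‖₊ : ℝ≥0∞)) :=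
  ((ftST_continuous u).comp (by fun_prop : Continuous fun σ : ℝ => ((σ, ξ) : ℝ × V2))).nnnorm.measurable.coe_nnreal_ennreal

theorem slice_le (u : 𝓢(ℝ × V2, ℂ)) (t : ℝ) (ξ : V2) :
    (‖ft2 (fun x => u (t, x)) ξ‖₊ : ℝ≥0∞) ≤
      ENNReal.ofReal |(2 * π)⁻¹| * ∫⁻ τ : ℝ, (‖ftST u τ ξ‖₊ : ℝ≥0∞) := by
  set h : ℝ → ℂ := fun t => ft2 (fun x => u (t, x)) ξ with hh
  have hF : 𝓕 h = fun σ => ftST u (2 * π * σ) ξ := by ext σ; exact fourier_slice u σ ξ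
  have hc : Continuous (𝓕 h) := by
    rw [hF]
    exact (ftST_continuous u).comp (by fun_prop : Continuous fun σ : ℝ => ((2 * π * σ, ξ) : ℝ × V2))
  have hm : Measurable (fun τ : ℝ => (‖ftST u τ ξ‖₊ : ℝ≥0∞)) :=
    ((ftST_continuous u).comp (by fun_prop : Continuous fun σ : ℝ => ((σ, ξ) : ℝ × V2))).nnnorm.measurable.coe_nnreal_ennreal
  have e1 : ENNReal.ofReal |(2 * π)⁻¹| * ∫⁻ τ : ℝ, (‖ftST u τ ξ‖₊ : ℝ≥0∞) = ∫⁻ σ, ‖𝓕 h σ‖ₑ := by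
    have hr : (2 * π) ≠ 0 := by positivity
    rw [← smul_eq_mul, ← lintegral_smul_measure, ← Real.map_volume_mul_left hr,
      lintegral_map hm (by fun_prop), hF]
    rfl
  rw [e1]
  by_cases hi : Integrable (𝓕 h)
  · have := Continuous.fourierInv_fourier_eq (slice_continuous u ξ) (slice_integrable u ξ) hi
    have h2 : 𝓕⁻ (𝓕 h) t = h t := congrFun this t
    change ‖h t‖ₑ ≤ _
    rw [← h2, Real.fourierInv_eq]
    refine (enorm_integral_le_lintegral_enorm _).trans (le_of_eq ?_)
    refine lintegral_congr fun σ => ?_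
    rw [← ofReal_norm, ← ofReal_norm, Circle.norm_smul]
  · have : ∫⁻ σ, ‖𝓕 h σ‖ₑ = ⊤ := by
      by_contra hne
      exact hi ⟨hc.aestronglyMeasurable, lt_top_iff_ne_top.2 hne⟩
    rw [this]; exact le_top

theorem time_weight (θ : ℝ) (hθ : 1 / 2 < θ) : ∃ c : ℝ≥0∞, c ≠ ⊤ ∧ ∀ r : ℝ,
    ∫⁻ τ : ℝ, ENNReal.ofReal ((1 + |(|τ| - r)|) ^ (-θ)) ^ 2 ≤ c := by
  set g : ℝ → ℝ≥0∞ := fun τ => ENNReal.ofReal ((1 + ‖τ‖) ^ (-(2 * θ))) with hg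
  have hgm : Measurable g := by fun_prop
  have hgi : ∫⁻ τ, g τ ≠ ⊤ := by
    have : Integrable (fun τ : ℝ => (1 + ‖τ‖) ^ (-(2 * θ))) :=
      integrable_one_add_norm (by simp; linarith)
    exact this.lintegral_lt_top.ne
  refine ⟨(∫⁻ τ, g τ) + ∫⁻ τ, g τ, by finiteness, fun r => ?_⟩
  calc _ ≤ ∫⁻ τ, (g (τ - r) + g (τ + r)) := by
        refine lintegral_mono fun τ => ?_
        rw [← ENNReal.ofReal_pow (by positivity), ← Real.rpow_natCast, ← Real.rpow_mul (by positivity)]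
        have e : -θ * (2 : ℕ) = -(2 * θ) := by push_cast; ring
        rw [e]
        rcases le_total 0 τ with h | h
        · rw [abs_of_nonneg h]
          exact le_add_of_nonneg_right (zero_le)
        · rw [abs_of_nonpos h]
          have : |(-τ - r)| = ‖τ + r‖ := by rw [Real.norm_eq_abs, ← abs_neg]; congr 1; ring
          rw [this]
          exact le_add_of_nonneg_left (zero_le)
    _ = _ := by
        rw [lintegral_add_left (by fun_prop), lintegral_sub_right_eq_self g r, lintegral_add_right_eq_self g r]

set_option maxHeartbeats 400000 in
theorem hSob_slice (s θ : ℝ) (hθ : 1 / 2 < θ) : ∃ c : ℝ≥0∞, c ≠ ⊤ ∧ ∀ e : ℝ, 0 ≤ e → e ≤ s →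
    ∀ (u : 𝓢(ℝ × V2, ℂ)) (t : ℝ), hSob e (fun x => u (t, x)) ≤ c * HN s θ u := by
  obtain ⟨c, hc, h⟩ := time_weight θ hθ
  set k : ℝ≥0∞ := ENNReal.ofReal |(2 * π)⁻¹| with hk
  refine ⟨k * c ^ ((1 : ℝ) / 2), ENNReal.mul_ne_top ENNReal.ofReal_ne_top
    (ENNReal.rpow_ne_top_of_nonneg (by norm_num) hc), fun e he hes u t => ?_⟩
  have hm : Measurable (fun q : ℝ × V2 => (‖ftST u q.1 q.2‖₊ : ℝ≥0∞)) :=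
    (ftST_continuous u).nnnorm.measurable.coe_nnreal_ennreal
  have hwm : Measurable (fun q : ℝ × V2 => ENNReal.ofReal (wgt s θ q.1 q.2)) := by
    unfold wgt; fun_prop
  have hM : Measurable (fun q : ℝ × V2 =>
      (ENNReal.ofReal (wgt s θ q.1 q.2) * (‖ftST u q.1 q.2‖₊ : ℝ≥0∞)) ^ 2) := (hwm.mul hm).pow_const 2
  have key : ∀ ξ : V2, (ENNReal.ofReal (‖ξ‖ ^ e) * (‖ft2 (fun x => u (t, x)) ξ‖₊ : ℝ≥0∞)) ^ 2 ≤
      (k ^ 2 * c) * ∫⁻ τ : ℝ, (ENNReal.ofReal (wgt s θ τ ξ) * (‖ftST u τ ξ‖₊ : ℝ≥0∞)) ^ 2 := by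
    intro ξ
    set b : ℝ := (1 + ‖ξ‖ ^ 2) ^ (s / 2) with hb
    have hb1 : ‖ξ‖ ^ e ≤ b := by
      have h1 : (1 : ℝ) ≤ 1 + ‖ξ‖ ^ 2 := by nlinarith [sq_nonneg ‖ξ‖]
      have h2 : ‖ξ‖ ≤ (1 + ‖ξ‖ ^ 2) ^ ((1 : ℝ) / 2) := by
        rw [← Real.sqrt_eq_rpow]; apply Real.le_sqrt_of_sq_le; linarith
      calc ‖ξ‖ ^ e ≤ ((1 + ‖ξ‖ ^ 2) ^ ((1 : ℝ) / 2)) ^ e := Real.rpow_le_rpow (norm_nonneg _) h2 he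
        _ = (1 + ‖ξ‖ ^ 2) ^ (e / 2) := by rw [← Real.rpow_mul (by positivity)]; congr 1; ring
        _ ≤ _ := Real.rpow_le_rpow_of_exponent_le h1 (by linarith)
    set p : ℝ → ℝ≥0∞ := fun τ => ENNReal.ofReal ((1 + |(|τ| - ‖ξ‖)|) ^ (-θ)) with hp
    set q : ℝ → ℝ≥0∞ := fun τ => ENNReal.ofReal (wgt s θ τ ξ) * (‖ftST u τ ξ‖₊ : ℝ≥0∞) with hq
    have hpm : Measurable p := by fun_prop
    have hfm : Measurable (fun τ : ℝ => (‖ftST u τ ξ‖₊ : ℝ≥0∞)) := ftST_slice_meas u ξ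
    have hwm2 : Measurable (fun τ : ℝ => ENNReal.ofReal (wgt s θ τ ξ)) := by
      unfold wgt; fun_prop
    have hqm : Measurable q := hwm2.mul hfm
    have e1 : ENNReal.ofReal (‖ξ‖ ^ e) * (‖ft2 (fun x => u (t, x)) ξ‖₊ : ℝ≥0∞) ≤ k * ∫⁻ τ, p τ * q τ := by
      calc _ ≤ ENNReal.ofReal b * (k * ∫⁻ τ : ℝ, (‖ftST u τ ξ‖₊ : ℝ≥0∞)) := by
            gcongr
            exact slice_le u t ξ
        _ = k * ∫⁻ τ : ℝ, ENNReal.ofReal b * (‖ftST u τ ξ‖₊ : ℝ≥0∞) := by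
            rw [lintegral_const_mul _ hfm]; ring
        _ = _ := by
            congr 1
            refine lintegral_congr fun τ => ?_
            simp only [hp, hq]
            rw [← mul_assoc, ← ENNReal.ofReal_mul (by positivity)]
            congr 2
            unfold wgt
            rw [← hb, mul_left_comm, ← Real.rpow_add (by positivity)]
            simp
    calc _ ≤ (k * ∫⁻ τ, p τ * q τ) ^ 2 := pow_le_pow_left' e1 2
      _ = k ^ 2 * (∫⁻ τ, p τ * q τ) ^ 2 := by rw [mul_pow]
      _ ≤ k ^ 2 * ((∫⁻ τ, p τ ^ 2) * ∫⁻ τ, q τ ^ 2) := by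
          gcongr; exact cs hpm.aemeasurable hqm.aemeasurable
      _ ≤ k ^ 2 * (c * ∫⁻ τ, q τ ^ 2) := by gcongr; exact h ‖ξ‖
      _ = _ := by rw [mul_assoc]
  have tot : ∫⁻ ξ : V2, (ENNReal.ofReal (‖ξ‖ ^ e) * (‖ft2 (fun x => u (t, x)) ξ‖₊ : ℝ≥0∞)) ^ 2 ≤
      (k ^ 2 * c) * ∫⁻ q : ℝ × V2, (ENNReal.ofReal (wgt s θ q.1 q.2) * (‖ftST u q.1 q.2‖₊ : ℝ≥0∞)) ^ 2 := by
    refine (lintegral_mono key).trans ?_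
    rw [lintegral_const_mul' _ _ (by finiteness)]
    gcongr
    rw [Measure.volume_eq_prod, lintegral_prod_symm _ hM.aemeasurable]
  unfold hSob HN
  refine (ENNReal.rpow_le_rpow tot (by norm_num : (0 : ℝ) ≤ 1 / 2)).trans (le_of_eq ?_)
  simp only [ENNReal.mul_rpow_of_nonneg _ _ (by norm_num : (0 : ℝ) ≤ 1 / 2), sq_rpow_half]

end EllAux

namespace EllAux
open scoped FourierTransform SchwartzMap LineDeriv

theorem slMap_growth (t : ℝ) : (fun x : V2 => ((t, x) : ℝ × V2)).HasTemperateGrowth := by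
  have h : (fun x : V2 => ((t, x) : ℝ × V2)) =
      (fun _ : V2 => ((t, 0) : ℝ × V2)) + (fun x : V2 => ContinuousLinearMap.inr ℝ ℝ V2 x) := by
    ext x <;> simp
  rw [h]
  exact (Function.HasTemperateGrowth.const _).add (ContinuousLinearMap.inr ℝ ℝ V2).hasTemperateGrowth

theorem slMap_anti (t : ℝ) : AntilipschitzWith 1 (fun x : V2 => ((t, x) : ℝ × V2)) := by
  intro x y
  simp [Prod.edist_eq]

def sl (t : ℝ) : 𝓢(ℝ × V2, ℂ) →L[ℂ] 𝓢(V2, ℂ) :=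
  SchwartzMap.compCLMOfAntilipschitz ℂ (slMap_growth t) (slMap_anti t)

@[simp] theorem sl_apply (t : ℝ) (u : 𝓢(ℝ × V2, ℂ)) (x : V2) : sl t u x = u (t, x) := rfl

def PD (j : Fin 2) (u : 𝓢(ℝ × V2, ℂ)) : 𝓢(ℝ × V2, ℂ) :=
  ∂_{(((0 : ℝ), EuclideanSpace.single j 1) : ℝ × V2)} u

theorem PD_coe (j : Fin 2) (u : 𝓢(ℝ × V2, ℂ)) : ⇑(PD j u) = pdx j u := by
  ext p; exact SchwartzMap.lineDerivOp_apply_eq_fderiv _ _ _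

theorem sl_PD (t : ℝ) (j : Fin 2) (u : 𝓢(ℝ × V2, ℂ)) :
    sl t (PD j u) = ∂_{(EuclideanSpace.single j 1 : V2)} (sl t u) := by
  ext x
  rw [SchwartzMap.lineDerivOp_apply_eq_fderiv, sl_apply, PD,
    SchwartzMap.lineDerivOp_apply_eq_fderiv]
  have h1 : HasFDerivAt (fun x : V2 => ((t, x) : ℝ × V2)) (ContinuousLinearMap.inr ℝ ℝ V2) x :=
    hasFDerivAt_prodMk_right t x
  have h2 := (u.differentiableAt (x := (t, x))).hasFDerivAt.comp x h1
  have h3 : fderiv ℝ (sl t u) x = _ := h2.fderiv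
  rw [h3]
  simp

def mulST (u v : 𝓢(ℝ × V2, ℂ)) : 𝓢(ℝ × V2, ℂ) :=
  SchwartzMap.pairing (ContinuousLinearMap.mul ℂ ℂ) u v

theorem mulST_apply (u v : 𝓢(ℝ × V2, ℂ)) (p : ℝ × V2) : mulST u v p = u p * v p := rfl

variable {n : ℕ}

def commS (U V : Fin n → Fin n → 𝓢(ℝ × V2, ℂ)) (i k : Fin n) : 𝓢(ℝ × V2, ℂ) :=
  (∑ l, mulST (U i l) (V l k)) - ∑ l, mulST (V i l) (U l k)

theorem commS_coe (U V : Fin n → Fin n → 𝓢(ℝ × V2, ℂ)) (i k : Fin n) :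
    ⇑(commS U V i k) = mcomm (cF U) (cF V) i k := by
  ext p
  simp [commS, mcomm, cF, mulST_apply]

theorem pdf_eq (j : Fin 2) (f : Fin n → Fin n → 𝓢(ℝ × V2, ℂ)) :
    _root_.pdf j f = cF (fun i k => PD j (f i k)) := by
  ext i k p
  simp [_root_.pdf, cF, PD_coe]

theorem sl_commS (t : ℝ) (U V : Fin n → Fin n → 𝓢(ℝ × V2, ℂ)) (i k : Fin n) :
    sl t (commS U V i k) =
      (∑ l, mulS (sl t (U i l)) (sl t (V l k))) - ∑ l, mulS (sl t (U l k)) (sl t (V i l)) := by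
  ext x
  simp [commS, mulST_apply, mul_comm]

def SM (e t : ℝ) (U : Fin n → Fin n → 𝓢(ℝ × V2, ℂ)) : ℝ≥0∞ :=
  ∑ i, ∑ k, hSob e (sl t (U i k))

theorem mat_sum (c : ℝ≥0∞) (a b : Fin n → Fin n → ℝ≥0∞) :
    ∑ i, ∑ k, ∑ l, c * (a i l * b l k) ≤ c * ((∑ i, ∑ k, a i k) * ∑ i, ∑ k, b i k) := by
  simp only [← Finset.mul_sum]
  gcongr
  calc ∑ i, ∑ k, ∑ l, a i l * b l k = ∑ i, ∑ l, a i l * ∑ k, b l k := by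
        refine Finset.sum_congr rfl fun i _ => ?_
        rw [Finset.sum_comm]
        simp only [Finset.mul_sum]
    _ ≤ ∑ i, ∑ l, a i l * ∑ l', ∑ k, b l' k := by
        refine Finset.sum_le_sum fun i _ => Finset.sum_le_sum fun l _ => mul_le_mul_right ?_ _
        exact Finset.single_le_sum (f := fun l' => ∑ k, b l' k) (fun _ _ => zero_le) (Finset.mem_univ l)
    _ = _ := by simp only [← Finset.sum_mul]

theorem comm_est {α β : ℝ} (hα : 0 ≤ α) (hβ : 0 ≤ β) (hab : α + β < 1) (hab0 : 0 < α + β) :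
    ∃ c : ℝ≥0∞, c ≠ ⊤ ∧ ∀ (U V : Fin n → Fin n → 𝓢(ℝ × V2, ℂ)) (t : ℝ),
      SM (α + β - 1) t (commS U V) ≤ c * (SM α t U * SM β t V) := by
  obtain ⟨c, hc, h⟩ := hSob_mul hα hβ hab hab0
  refine ⟨c + c, by finiteness, fun U V t => ?_⟩
  have e1 : ∀ i k, hSob (α + β - 1) (sl t (commS U V i k)) ≤
      (∑ l, c * (hSob α (sl t (U i l)) * hSob β (sl t (V l k)))) +
        ∑ l, c * (hSob β (sl t (V i l)) * hSob α (sl t (U l k))) := by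
    intro i k
    rw [sl_commS]
    refine (hSob_sub _ _ _).trans (add_le_add ?_ ?_)
    · exact (hSob_sum _ _ _).trans (Finset.sum_le_sum fun l _ => h _ _)
    · refine (hSob_sum _ _ _).trans (Finset.sum_le_sum fun l _ => ?_)
      rw [mul_comm (hSob β _)]; exact h _ _
  calc SM (α + β - 1) t (commS U V) ≤ ∑ i, ∑ k, ((∑ l, c * (hSob α (sl t (U i l)) * hSob β (sl t (V l k)))) +
        ∑ l, c * (hSob β (sl t (V i l)) * hSob α (sl t (U l k)))) :=
        Finset.sum_le_sum fun i _ => Finset.sum_le_sum fun k _ => e1 i k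
    _ = (∑ i, ∑ k, ∑ l, c * (hSob α (sl t (U i l)) * hSob β (sl t (V l k)))) +
        ∑ i, ∑ k, ∑ l, c * (hSob β (sl t (V i l)) * hSob α (sl t (U l k))) := by
        simp only [Finset.sum_add_distrib]
    _ ≤ c * (SM α t U * SM β t V) + c * (SM β t V * SM α t U) := by
        exact add_le_add (mat_sum c (fun i l => hSob α (sl t (U i l))) (fun l k => hSob β (sl t (V l k))))
          (mat_sum c (fun i l => hSob β (sl t (V i l))) (fun l k => hSob α (sl t (U l k))))
    _ = _ := by ring

theorem SM_slice (s θ : ℝ) (hθ : 1 / 2 < θ) : ∃ c : ℝ≥0∞, c ≠ ⊤ ∧ ∀ e : ℝ, 0 ≤ e → e ≤ s →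
    ∀ (U : Fin n → Fin n → 𝓢(ℝ × V2, ℂ)) (t : ℝ), SM e t U ≤ c * HNM s θ (cF U) := by
  obtain ⟨c, hc, h⟩ := hSob_slice s θ hθ
  refine ⟨c, hc, fun e he hes U t => ?_⟩
  unfold SM HNM
  simp only [Finset.mul_sum]
  exact Finset.sum_le_sum fun i _ => Finset.sum_le_sum fun k _ => h e he hes (U i k) t

theorem le_pyth (x y : ℝ≥0∞) : x ≤ (x ^ 2 + y ^ 2) ^ ((1 : ℝ) / 2) := by
  calc x = (x ^ 2) ^ ((1 : ℝ) / 2) := by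
        rw [← ENNReal.rpow_natCast, ← ENNReal.rpow_mul]; norm_num
    _ ≤ _ := ENNReal.rpow_le_rpow le_self_add (by norm_num)

theorem HNM_le_gradN (s θ : ℝ) (f : Fin n → Fin n → 𝓢(ℝ × V2, ℂ)) (j : Fin 2) :
    HNM s θ (cF (fun i k => PD j (f i k))) ≤ gradN s θ f := by
  rw [← pdf_eq]
  unfold gradN
  fin_cases j
  · exact le_pyth _ _
  · rw [add_comm]; exact le_pyth _ _

theorem SM_elliptic (a : ℝ) (ha : 0 < a) (A f φ : Fin n → Fin n → 𝓢(ℝ × V2, ℂ))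
    (h : EllipticEq A f φ) (t : ℝ) :
    SM a t A ≤ (SM (a - 1) t (commS A fun i k => PD 1 (f i k)) +
        SM (a - 1) t (commS (fun i k => PD 0 (f i k)) φ)) +
      (SM (a - 1) t (commS A fun i k => PD 0 (f i k)) +
        SM (a - 1) t (commS (fun i k => PD 1 (f i k)) φ)) := by
  unfold SM
  simp only [← Finset.sum_add_distrib]
  refine Finset.sum_le_sum fun i _ => Finset.sum_le_sum fun k _ => ?_
  set B1 := commS A (fun i k => PD 1 (f i k)) i k with hB1
  set B0 := commS A (fun i k => PD 0 (f i k)) i k with hB0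
  set D0 := commS (fun i k => PD 0 (f i k)) φ i k with hD0
  set D1 := commS (fun i k => PD 1 (f i k)) φ i k with hD1
  have e1 : PD 0 (PD 0 (A i k)) + PD 1 (PD 1 (A i k)) = -PD 0 B1 + PD 1 B0 + PD 0 D0 + PD 1 D1 := by
    ext p
    have := h i k p
    simp only [pdf_eq, ← commS_coe, ← PD_coe] at this
    simpa using this
  have e2 := congrArg (sl t) e1
  simp only [map_add, map_neg, sl_PD] at e2
  refine (hSob_elliptic a ha (sl t (A i k)) (-sl t B1 + sl t D0) (sl t B0 + sl t D1) ?_).trans ?_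
  · rw [e2]
    simp only [LineDeriv.lineDerivOp_add, LineDeriv.lineDerivOp_neg]
    abel
  · refine add_le_add ((hSob_add _ _ _).trans ?_) (hSob_add _ _ _)
    rw [hSob_neg]

theorem SM_ne_top (a : ℝ) (ha : 0 < a) (ha1 : a < 1) (A : Fin n → Fin n → 𝓢(ℝ × V2, ℂ)) (t : ℝ) :
    SM a t A ≠ ⊤ := by
  unfold SM
  exact ENNReal.sum_ne_top.2 fun i _ => ENNReal.sum_ne_top.2 fun k _ => hSob_lt_top a ha ha1 _

theorem absorb {X Y q : ℝ≥0∞} (hX : X ≠ ⊤) (hq : q ≤ 1 / 2) (h : X ≤ q * X + Y) : X ≤ 2 * Y := by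
  have h1 : X ≤ X / 2 + Y := by
    refine h.trans ?_
    gcongr
    calc q * X ≤ (1 / 2) * X := by gcongr
      _ = X / 2 := by rw [one_div, mul_comm, div_eq_mul_inv]
  have h3 : X / 2 ≤ Y := by
    have hh : X / 2 ≠ ⊤ := by finiteness
    refine (ENNReal.add_le_add_iff_left hh).1 ?_
    rwa [ENNReal.add_halves]
  calc X = 2 * (X / 2) := by rw [two_mul, ENNReal.add_halves]
    _ ≤ _ := by gcongr

theorem main (n : ℕ) (s θ a : ℝ) (hs1 : s < 1 / 2) (hθ : 1 / 2 < θ)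
    (hs0 : 0 < s) (ha0 : 0 < a) (ha1 : a ≤ 2 * s) :
    ∃ ε₀ C : ℝ, 0 < ε₀ ∧ 0 < C ∧
      ∀ A0 f φ : Fin n → Fin n → SchwartzMap (ℝ × V2) ℂ,
        EllipticEq A0 f φ →
        gradN s θ f ≤ ENNReal.ofReal ε₀ →
        (⨆ t : ℝ, ∑ i, ∑ k, hSob a fun x => (A0 i k) (t, x)) ≤
          ENNReal.ofReal C * (HNM s θ (cF φ) * gradN s θ f) := by
  obtain ⟨c1, hc1, h1⟩ := comm_est (n := n) (α := a) (β := 0) ha0.le le_rfl (by linarith) (by linarith)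
  obtain ⟨c2, hc2, h2⟩ := comm_est (n := n) (α := a / 2) (β := a / 2) (by linarith) (by linarith)
    (by linarith) (by linarith)
  obtain ⟨k, hk, h3⟩ := SM_slice (n := n) s θ hθ
  have ea : a + 0 - 1 = a - 1 := by ring
  have eb : a / 2 + a / 2 - 1 = a - 1 := by ring
  rw [ea] at h1
  rw [eb] at h2
  set M : ℝ := c1.toReal + c2.toReal + k.toReal + 1 with hM
  have p1 := c1.toReal_nonneg
  have p2 := c2.toReal_nonneg
  have p3 := k.toReal_nonneg
  have hM0 : 0 < M := by linarith
  set m : ℝ≥0∞ := ENNReal.ofReal M with hm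
  have b1 : c1 ≤ m := (ENNReal.le_ofReal_iff_toReal_le hc1 hM0.le).2 (by linarith)
  have b2 : c2 ≤ m := (ENNReal.le_ofReal_iff_toReal_le hc2 hM0.le).2 (by linarith)
  have b3 : k ≤ m := (ENNReal.le_ofReal_iff_toReal_le hk hM0.le).2 (by linarith)
  refine ⟨1 / (4 * M ^ 2), 4 * M ^ 3, by positivity, by positivity, fun A f φ hE hG => ?_⟩
  refine iSup_le fun t => ?_
  change SM a t A ≤ _
  set G := gradN s θ f with hGdef
  set Φ := HNM s θ (cF φ) with hΦ
  have g : ∀ e, 0 ≤ e → e ≤ s → ∀ j : Fin 2, SM e t (fun i k => PD j (f i k)) ≤ m * G := by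
    intro e he hes j
    refine (h3 e he hes _ t).trans ?_
    gcongr
    exact HNM_le_gradN s θ f j
  have gφ : SM (a / 2) t φ ≤ m * Φ := (h3 _ (by linarith) (by linarith) _ t).trans (by gcongr)
  have key : SM a t A ≤ (2 * m ^ 2 * G) * SM a t A + 2 * m ^ 3 * (Φ * G) := by
    refine (SM_elliptic a ha0 A f φ hE t).trans ?_
    have q1 : ∀ j, SM (a - 1) t (commS A fun i k => PD j (f i k)) ≤ m * (SM a t A * (m * G)) := by
      intro j
      refine (h1 _ _ t).trans ?_
      gcongr
      exact g 0 le_rfl hs0.le j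
    have q2 : ∀ j, SM (a - 1) t (commS (fun i k => PD j (f i k)) φ) ≤ m * ((m * G) * (m * Φ)) := by
      intro j
      refine (h2 _ _ t).trans ?_
      gcongr
      exact g _ (by linarith) (by linarith) j
    refine (add_le_add (add_le_add (q1 1) (q2 0)) (add_le_add (q1 0) (q2 1))).trans (le_of_eq ?_)
    ring
  have hq : 2 * m ^ 2 * G ≤ 1 / 2 := by
    calc 2 * m ^ 2 * G ≤ 2 * m ^ 2 * ENNReal.ofReal (1 / (4 * M ^ 2)) := by gcongr
      _ = ENNReal.ofReal (1 / 2) := by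
          have : (2 : ℝ≥0∞) = ENNReal.ofReal 2 := by simp
          rw [this, hm, ← ENNReal.ofReal_pow hM0.le, ← ENNReal.ofReal_mul (by norm_num),
            ← ENNReal.ofReal_mul (by positivity)]
          congr 1
          field_simp
          norm_num
      _ ≤ 1 / 2 := by
          rw [ENNReal.ofReal_div_of_pos (by norm_num)]; simp
  refine (absorb (SM_ne_top a ha0 (by linarith) A t) hq key).trans (le_of_eq ?_)
  have : ENNReal.ofReal (4 * M ^ 3) = 4 * m ^ 3 := by
    rw [ENNReal.ofReal_mul (by norm_num), ENNReal.ofReal_pow hM0.le]; simp [hm]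
  rw [this]
  ring

end EllAux

/-- Uniform-in-time homogeneous Sobolev bound for `A₀` (case `p = ∞`, `q = 2`,
`a ≤ 2s` of the homogeneous elliptic estimate): for `0 < s < 1/2`, `θ > 1/2`,
`0 < a ≤ 2s`, there exist `ε₀ > 0` and `C` such that any Schwartz matrix-valued
solution of `△A₀ = -∂₁[A₀,∂₂f] + ∂₂[A₀,∂₁f] + ∂₁[∂₁f,φ] + ∂₂[∂₂f,φ]` with
`‖∇f‖_{H^{s,θ}} ≤ ε₀` satisfies
`sup_t ‖A₀(t,·)‖_{Ḣ^a(ℝ²)} ≤ C ‖φ‖_{H^{s,θ}} ‖∇f‖_{H^{s,θ}}`. -/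
theorem elliptic_uniform_Hdot_estimate (n : ℕ) (hn : 1 ≤ n)
    (s θ a : ℝ) (hs0 : 0 < s) (hs1 : s < 1 / 2) (hθ : 1 / 2 < θ)
    (ha0 : 0 < a) (ha1 : a ≤ 2 * s) :
    ∃ ε₀ C : ℝ, 0 < ε₀ ∧ 0 < C ∧
      ∀ A0 f φ : Fin n → Fin n → SchwartzMap (ℝ × V2) ℂ,
        EllipticEq A0 f φ →
        gradN s θ f ≤ ENNReal.ofReal ε₀ →
        (⨆ t : ℝ, ∑ i, ∑ k, hSob a fun x => (A0 i k) (t, x)) ≤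
          ENNReal.ofReal C * (HNM s θ (cF φ) * gradN s θ f) := by
  exact EllAux.main n s θ a hs1 hθ hs0 ha0 ha1
end
end
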